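/- arXiv:2108.06263 — 2 statements merged into one kernel-verified Lean document; each statement's English description precedes it below -/
import Mathlib

section
/- For every positive integer n, the border rank of the n×n matrix multiplication tensor satisfies BR(M⟨n⟩) ≥ 2n² − n. -/
open scoped BigOperators

noncomputable section

/-- A tensor `T ∈ ℂ^{ι₁} ⊗ ℂ^{ι₂} ⊗ ℂ^{ι₃}`, written in coordinates, has rank at most `r`
if it is a sum of `r` simple tensors. -/
def rankLE {ι₁ ι₂ ι₃ : Type*} (T : ι₁ → ι₂ → ι₃ → ℂ) (r : ℕ) : Prop :=
  ∃ u : Fin r → ι₁ → ℂ, ∃ v : Fin r → ι₂ → ℂ, ∃ w : Fin r → ι₃ → ℂ,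
    T = fun i j k => ∑ l, u l i * v l j * w l k

/-- The rank of a tensor. -/
def trank {ι₁ ι₂ ι₃ : Type*} (T : ι₁ → ι₂ → ι₃ → ℂ) : ℕ :=
  sInf {r | rankLE T r}

/-- The border rank of a tensor: the least `r` such that `T` is a limit of tensors of rank
at most `r` (closure in the Euclidean = product topology). -/
def brank {ι₁ ι₂ ι₃ : Type*} [Fintype ι₁] [Fintype ι₂] [Fintype ι₃]
    (T : ι₁ → ι₂ → ι₃ → ℂ) : ℕ :=
  sInf {r | T ∈ closure {S : ι₁ → ι₂ → ι₃ → ℂ | rankLE S r}}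

/-- The matrix multiplication tensor `M⟨a,b,c⟩ = Σ e_{ij} ⊗ e_{jk} ⊗ e_{ki}`. -/
def matMulTensor (a b c : ℕ) :
    (Fin a × Fin b) → (Fin b × Fin c) → (Fin c × Fin a) → ℂ :=
  fun x y z => if x.2 = y.1 ∧ y.2 = z.1 ∧ z.2 = x.1 then 1 else 0

/-- Kronecker product of tensors. -/
def kron {ι₁ ι₂ ι₃ κ₁ κ₂ κ₃ : Type*} (T : ι₁ → ι₂ → ι₃ → ℂ) (T' : κ₁ → κ₂ → κ₃ → ℂ) :
    (ι₁ × κ₁) → (ι₂ × κ₂) → (ι₃ × κ₃) → ℂ :=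
  fun i j k => T i.1 j.1 k.1 * T' i.2 j.2 k.2

/-- The little Coppersmith–Winograd tensor
`cw_q = Σ_{i=1}^q (e₀⊗eᵢ⊗eᵢ + eᵢ⊗e₀⊗eᵢ + eᵢ⊗eᵢ⊗e₀)`. -/
def cw (q : ℕ) : Fin (q + 1) → Fin (q + 1) → Fin (q + 1) → ℂ :=
  fun i j k =>
    if (i.val = 0 ∧ j = k ∧ j.val ≠ 0) ∨ (j.val = 0 ∧ i = k ∧ i.val ≠ 0) ∨
       (k.val = 0 ∧ i = j ∧ i.val ≠ 0)
    then 1 else 0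

/-- The big Coppersmith–Winograd tensor `CW_{m-2} ∈ ℂ^m ⊗ ℂ^m ⊗ ℂ^m` (for `m ≥ 3`). -/
def bigCW (m : ℕ) : Fin m → Fin m → Fin m → ℂ :=
  fun i j k =>
    if (i.val = 0 ∧ j.val = 0 ∧ k.val = m - 1) ∨
       (i.val = 0 ∧ j.val = m - 1 ∧ k.val = 0) ∨
       (i.val = m - 1 ∧ j.val = 0 ∧ k.val = 0) ∨
       (i.val = 0 ∧ j = k ∧ 1 ≤ j.val ∧ j.val ≤ m - 2) ∨
       (j.val = 0 ∧ i = k ∧ 1 ≤ i.val ∧ i.val ≤ m - 2) ∨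
       (k.val = 0 ∧ i = j ∧ 1 ≤ i.val ∧ i.val ≤ m - 2)
    then 1 else 0

/-- The skew Coppersmith–Winograd tensor `T_{skewcw,2} ∈ ℂ³⊗ℂ³⊗ℂ³`. -/
def skewCW2 : Fin 3 → Fin 3 → Fin 3 → ℂ :=
  fun i j k =>
    if (i = 0 ∧ j = 1 ∧ k = 1) ∨ (i = 0 ∧ j = 2 ∧ k = 2) ∨ (i = 1 ∧ j = 0 ∧ k = 1) ∨
       (i = 2 ∧ j = 0 ∧ k = 2) ∨ (i = 1 ∧ j = 2 ∧ k = 0)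
    then 1
    else if i = 2 ∧ j = 1 ∧ k = 0 then -1 else 0

/-- Action of a triple of linear maps (matrices) on a tensor. -/
def triApply {a b c a' b' c' : ℕ}
    (g₁ : Matrix (Fin a') (Fin a) ℂ) (g₂ : Matrix (Fin b') (Fin b) ℂ)
    (g₃ : Matrix (Fin c') (Fin c) ℂ) (T : Fin a → Fin b → Fin c → ℂ) :
    Fin a' → Fin b' → Fin c' → ℂ :=
  fun i j k => ∑ i', ∑ j', ∑ k', g₁ i i' * g₂ j j' * g₃ k k' * T i' j' k'

/-- The unit (diagonal) tensor `I_r ∈ ℂ^r ⊗ ℂ^r ⊗ ℂ^r`. -/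
def unitTensor (r : ℕ) : Fin r → Fin r → Fin r → ℂ :=
  fun i j k => if i = j ∧ j = k then 1 else 0

/-- The unit tensor `I_r = Σ_{ℓ=1}^r a_ℓ⊗b_ℓ⊗c_ℓ` embedded in `ℂ^a ⊗ ℂ^b ⊗ ℂ^c`
(for `r ≤ min{a,b,c}`). -/
def unitIn (a b c r : ℕ) : Fin a → Fin b → Fin c → ℂ :=
  fun i j k => if i.val = j.val ∧ j.val = k.val ∧ i.val < r then 1 else 0

/-- The subrank `Q(T)`: largest `r` so that linear maps take `T` to the unit tensor `I_r`. -/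
def subrank {a b c : ℕ} (T : Fin a → Fin b → Fin c → ℂ) : ℕ :=
  sSup {r | ∃ f : Matrix (Fin r) (Fin a) ℂ, ∃ g : Matrix (Fin r) (Fin b) ℂ,
    ∃ h : Matrix (Fin r) (Fin c) ℂ, triApply f g h T = unitTensor r}

/-- The `GL(A) × GL(B) × GL(C)`-orbit of a tensor. -/
def glOrbit {a b c : ℕ} (T : Fin a → Fin b → Fin c → ℂ) :
    Set (Fin a → Fin b → Fin c → ℂ) :=
  {S | ∃ g₁ : Matrix (Fin a) (Fin a) ℂ, ∃ g₂ : Matrix (Fin b) (Fin b) ℂ,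
    ∃ g₃ : Matrix (Fin c) (Fin c) ℂ, IsUnit g₁ ∧ IsUnit g₂ ∧ IsUnit g₃ ∧
      S = triApply g₁ g₂ g₃ T}

/-- The border subrank `Q̲(T)`: largest `r` (with `r ≤ min{a,b,c}`) such that `I_r` lies in
the closure of the `GL×GL×GL`-orbit of `T`. -/
def bsubrank {a b c : ℕ} (T : Fin a → Fin b → Fin c → ℂ) : ℕ :=
  sSup {r | r ≤ min a (min b c) ∧ unitIn a b c r ∈ closure (glOrbit T)}

/-- Multilinear rank in the `A`-factor: rank of the contraction `T_A : A* → B⊗C`. -/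
def mlA {a b c : ℕ} (T : Fin a → Fin b → Fin c → ℂ) : ℕ :=
  (Matrix.of fun (i : Fin a) (p : Fin b × Fin c) => T i p.1 p.2).rank

/-- Multilinear rank in the `B`-factor. -/
def mlB {a b c : ℕ} (T : Fin a → Fin b → Fin c → ℂ) : ℕ :=
  (Matrix.of fun (j : Fin b) (p : Fin a × Fin c) => T p.1 j p.2).rank

/-- Multilinear rank in the `C`-factor. -/
def mlC {a b c : ℕ} (T : Fin a → Fin b → Fin c → ℂ) : ℕ :=
  (Matrix.of fun (k : Fin c) (p : Fin a × Fin b) => T p.1 p.2 k).rank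

/-- `T` is `1_A`-generic: some contraction `T(α) : B* → C` has full rank `m`. -/
def oneAGeneric {m : ℕ} (T : Fin m → Fin m → Fin m → ℂ) : Prop :=
  ∃ α : Fin m → ℂ, (Matrix.of fun j k => ∑ i, α i * T i j k).rank = m

def oneBGeneric {m : ℕ} (T : Fin m → Fin m → Fin m → ℂ) : Prop :=
  ∃ β : Fin m → ℂ, (Matrix.of fun i k => ∑ j, β j * T i j k).rank = m

def oneCGeneric {m : ℕ} (T : Fin m → Fin m → Fin m → ℂ) : Prop :=
  ∃ γ : Fin m → ℂ, (Matrix.of fun i j => ∑ k, γ k * T i j k).rank = m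

/-- `T` is `1`-generic. -/
def oneGeneric {m : ℕ} (T : Fin m → Fin m → Fin m → ℂ) : Prop :=
  oneAGeneric T ∧ oneBGeneric T ∧ oneCGeneric T

/-- The symmetry Lie algebra `g̃_T ⊂ gl(A) ⊕ gl(B) ⊕ gl(C)` of a tensor, as a set. -/
def symLieSet {m : ℕ} (T : Fin m → Fin m → Fin m → ℂ) :
    Set (Matrix (Fin m) (Fin m) ℂ × Matrix (Fin m) (Fin m) ℂ × Matrix (Fin m) (Fin m) ℂ) :=
  {XYZ | ∀ i j k, (∑ i', XYZ.1 i i' * T i' j k) + (∑ j', XYZ.2.1 j j' * T i j' k) +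
    (∑ k', XYZ.2.2 k k' * T i j k') = 0}


/-! ### Koszul differential in coordinates -/

/-- The sign of `s` in the finite set `V`. -/
def ksg (s : ℕ) (V : Finset ℕ) : ℂ := (-1) ^ (V.filter (· < s)).card

/-- Exterior multiplication by the vector `u`, in coordinates. -/
def kD (u : ℕ → ℂ) (f : Finset ℕ → ℂ) (V : Finset ℕ) : ℂ :=
  ∑ s ∈ V, ksg s V * u s * f (V.erase s)

lemma ksg_ne_zero (s : ℕ) (V : Finset ℕ) : ksg s V ≠ 0 := by
  unfold ksg; exact pow_ne_zero _ (by norm_num)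

lemma ksg_erase_gt {s t : ℕ} {V : Finset ℕ} (h : s < t) : ksg s (V.erase t) = ksg s V := by
  unfold ksg
  congr 2
  ext x
  simp only [Finset.mem_filter, Finset.mem_erase]
  constructor
  · rintro ⟨⟨_, h1⟩, h2⟩; exact ⟨h1, h2⟩
  · rintro ⟨h1, h2⟩; exact ⟨⟨by omega, h1⟩, h2⟩

lemma ksg_erase_lt {s t : ℕ} {V : Finset ℕ} (hs : s ∈ V) (h : s < t) :
    ksg t (V.erase s) = - ksg t V := by
  unfold ksg
  have h1 : (V.erase s).filter (· < t) = (V.filter (· < t)).erase s := by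
    ext x
    simp only [Finset.mem_filter, Finset.mem_erase]
    tauto
  have h2 : s ∈ V.filter (· < t) := by simp [hs, h]
  rw [h1, ← Finset.card_erase_add_one h2, pow_succ]
  ring

lemma ksg_swap {s t : ℕ} {V : Finset ℕ} (hs : s ∈ V) (ht : t ∈ V) (h : s ≠ t) :
    ksg s V * ksg t (V.erase s) = - (ksg t V * ksg s (V.erase t)) := by
  rcases lt_or_gt_of_ne h with h | h
  · rw [ksg_erase_lt hs h, ksg_erase_gt h]; ring
  · rw [ksg_erase_lt ht h, ksg_erase_gt h]; ring

lemma kD_kD (u : ℕ → ℂ) (f : Finset ℕ → ℂ) (V : Finset ℕ) : kD u (kD u f) V = 0 := by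
  have key : kD u (kD u f) V = ∑ s ∈ V, ∑ t ∈ V, if s ≠ t then
      ksg s V * ksg t (V.erase s) * (u s * u t * f ((V.erase s).erase t)) else 0 := by
    unfold kD
    refine Finset.sum_congr rfl fun s _ => ?_
    rw [Finset.mul_sum, ← Finset.sum_filter]
    have : V.erase s = V.filter (s ≠ ·) := by
      ext x; simp only [Finset.mem_filter, Finset.mem_erase]; tauto
    rw [← this]
    refine Finset.sum_congr rfl fun t _ => ?_
    ring
  have key2 : kD u (kD u f) V = - kD u (kD u f) V := by
    conv_lhs => rw [key, Finset.sum_comm]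
    rw [key, ← Finset.sum_neg_distrib]
    refine Finset.sum_congr rfl fun s hs => ?_
    rw [← Finset.sum_neg_distrib]
    refine Finset.sum_congr rfl fun t ht => ?_
    by_cases h : s = t
    · simp [h]
    · rw [if_pos (Ne.symm h), if_pos h, ksg_swap ht hs (Ne.symm h), Finset.erase_right_comm]
      ring
  linear_combination (1 / 2) * key2

/-- Rows of the matrix of exterior multiplication by `u` are in the span of the rows
indexed by sets that contain `a`. -/
lemma kD_row (p : ℕ) (u : ℕ → ℂ) :
    ∃ a ∈ Finset.range (2 * p + 1), ∀ T ∈ Finset.powersetCard (p + 1) (Finset.range (2 * p + 1)),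
      ∃ g : (Finset.powersetCard p ((Finset.range (2 * p + 1)).erase a)) → ℂ,
        ∀ f : Finset ℕ → ℂ, kD u f T = ∑ U, g U * kD u f (insert a U.1) := by
  by_cases h0 : ∃ a ∈ Finset.range (2 * p + 1), u a ≠ 0
  · obtain ⟨a, ha, hu⟩ := h0
    refine ⟨a, ha, fun T hT => ?_⟩
    rw [Finset.mem_powersetCard] at hT
    obtain ⟨hT, hc⟩ := hT
    by_cases haT : a ∈ T
    · refine ⟨fun U => if U.1 = T.erase a then 1 else 0, fun f => ?_⟩
      have hm : T.erase a ∈ Finset.powersetCard p ((Finset.range (2 * p + 1)).erase a) := by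
        rw [Finset.mem_powersetCard]
        exact ⟨Finset.erase_subset_erase _ hT, by rw [Finset.card_erase_of_mem haT, hc]; rfl⟩
      rw [Finset.sum_eq_single ⟨T.erase a, hm⟩]
      · simp [Finset.insert_erase haT]
      · intro U _ hU
        have hne : U.1 ≠ T.erase a := fun h => hU (Subtype.ext h)
        simp [hne]
      · simp
    · refine ⟨fun U => - (ksg a (insert a T) * u a)⁻¹ * ∑ s ∈ T,
        ksg s (insert a T) * u s * (if U.1 = T.erase s then 1 else 0), fun f => ?_⟩
      have hd := kD_kD u f (insert a T)
      rw [kD, Finset.sum_insert haT, Finset.erase_insert haT] at hd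
      have hne : ksg a (insert a T) * u a ≠ 0 := mul_ne_zero (ksg_ne_zero _ _) hu
      have hd2 : kD u f T = - (ksg a (insert a T) * u a)⁻¹ * ∑ s ∈ T,
          ksg s (insert a T) * u s * kD u f ((insert a T).erase s) := by
        have := eq_neg_of_add_eq_zero_left hd
        rw [neg_mul, ← mul_neg, ← this, inv_mul_cancel_left₀ hne]
      rw [hd2]
      simp_rw [mul_assoc (-(ksg a (insert a T) * u a)⁻¹)]
      rw [← Finset.mul_sum]
      congr 1
      simp_rw [Finset.sum_mul]
      rw [Finset.sum_comm]
      refine Finset.sum_congr rfl fun s hs => ?_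
      have hm : T.erase s ∈ Finset.powersetCard p ((Finset.range (2 * p + 1)).erase a) := by
        rw [Finset.mem_powersetCard]
        refine ⟨fun x hx => ?_, by rw [Finset.card_erase_of_mem hs, hc]; rfl⟩
        rw [Finset.mem_erase] at hx ⊢
        exact ⟨fun h => haT (h ▸ hx.2), hT hx.2⟩
      rw [Finset.sum_eq_single ⟨T.erase s, hm⟩]
      · have : s ≠ a := fun h => haT (h ▸ hs)
        rw [Finset.erase_insert_of_ne this.symm]
        simp
      · intro U _ hU
        rw [if_neg, mul_zero, zero_mul]
        intro h; exact hU (Subtype.ext h)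
      · simp
  · push Not at h0
    refine ⟨0, by simp, fun T hT => ⟨0, fun f => ?_⟩⟩
    rw [Finset.mem_powersetCard] at hT
    simp only [Pi.zero_apply, zero_mul, Finset.sum_const_zero]
    exact Finset.sum_eq_zero fun s hs => by rw [h0 s (hT.1 hs)]; ring

/-! ### The Koszul flattening -/

/-- Subsets of `{0, …, 2p}` with `q` elements. -/
abbrev KS (p q : ℕ) : Type := Finset.powersetCard q (Finset.range (2 * p + 1))

/-- The tensors of format `n × n × n` matrix multiplication, `n = p + 1`. -/
abbrev KT (p : ℕ) : Type :=
  (Fin (p + 1) × Fin (p + 1)) → (Fin (p + 1) × Fin (p + 1)) → (Fin (p + 1) × Fin (p + 1)) → ℂ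

/-- The projection of the first factor `e_{ij} ↦ e_{i+j}`. -/
def kproj {p : ℕ} (S : KT p) (y z : Fin (p + 1) × Fin (p + 1)) (s : ℕ) : ℂ :=
  ∑ x : Fin (p + 1) × Fin (p + 1), if (x.1 : ℕ) + (x.2 : ℕ) = s then S x y z else 0

/-- The Koszul flattening of the projected tensor. -/
def kflat {p : ℕ} (S : KT p) :
    Matrix (KS p (p + 1) × (Fin (p + 1) × Fin (p + 1))) (KS p p × (Fin (p + 1) × Fin (p + 1))) ℂ :=
  Matrix.of fun Tz Qy => kD (kproj S Qy.2 Tz.2) (fun R => if R = Qy.1.1 then 1 else 0) Tz.1.1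

lemma kflat_continuous (p : ℕ) : Continuous (kflat (p := p)) := by
  refine continuous_matrix fun i j => ?_
  simp only [kflat, kD, kproj, Matrix.of_apply]
  refine continuous_finsetSum _ fun s _ => ?_
  refine Continuous.mul (Continuous.mul continuous_const ?_) continuous_const
  refine continuous_finsetSum _ fun x _ => ?_
  split_ifs
  · fun_prop
  · exact continuous_const

lemma kflat_sum {p r : ℕ} (S : Fin r → KT p) :
    kflat (fun x y z => ∑ l, S l x y z) = ∑ l, kflat (S l) := by
  ext i j
  rw [Matrix.sum_apply]
  simp only [kflat, kD, kproj, Matrix.of_apply]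
  rw [Finset.sum_comm]
  refine Finset.sum_congr rfl fun s _ => ?_
  rw [← Finset.sum_mul, ← Finset.mul_sum]
  congr 2
  rw [Finset.sum_comm]
  refine Finset.sum_congr rfl fun x _ => ?_
  split_ifs <;> simp

lemma kflat_rank_one {p : ℕ} (u v w : Fin (p + 1) × Fin (p + 1) → ℂ) :
    (kflat (fun x y z => u x * v y * w z)).rank ≤ (2 * p).choose p := by
  set u' : ℕ → ℂ := fun s => ∑ x : Fin (p + 1) × Fin (p + 1),
    if (x.1 : ℕ) + (x.2 : ℕ) = s then u x else 0 with hu'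
  obtain ⟨a, ha, h⟩ := kD_row p u'
  choose g hg using h
  have hfac : kflat (fun x y z => u x * v y * w z) =
      (Matrix.of fun (Tz : KS p (p + 1) × (Fin (p + 1) × Fin (p + 1)))
        (U : Finset.powersetCard p ((Finset.range (2 * p + 1)).erase a)) =>
          g Tz.1.1 Tz.1.2 U * w Tz.2) *
      (Matrix.of fun (U : Finset.powersetCard p ((Finset.range (2 * p + 1)).erase a))
        (Qy : KS p p × (Fin (p + 1) × Fin (p + 1))) =>
          kD u' (fun R => if R = Qy.1.1 then 1 else 0) (insert a U.1) * v Qy.2) := by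
    ext Tz Qy
    have hp : kproj (fun x y z => u x * v y * w z) Qy.2 Tz.2 =
        fun s => u' s * (v Qy.2 * w Tz.2) := by
      funext s
      simp only [kproj, hu', Finset.sum_mul]
      refine Finset.sum_congr rfl fun x _ => ?_
      split_ifs
      · ring
      · ring
    rw [Matrix.mul_apply]
    simp only [kflat, Matrix.of_apply]
    rw [hp]
    have h2 : ∀ f V, kD (fun s => u' s * (v Qy.2 * w Tz.2)) f V =
        kD u' f V * (v Qy.2 * w Tz.2) := by
      intro f V
      simp only [kD, Finset.sum_mul]
      refine Finset.sum_congr rfl fun x _ => ?_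
      ring
    rw [h2, hg Tz.1.1 Tz.1.2, Finset.sum_mul]
    refine Finset.sum_congr rfl fun x _ => ?_
    ring
  rw [hfac]
  refine (Matrix.rank_mul_le_left _ _).trans ((Matrix.rank_le_card_width _).trans ?_)
  rw [Fintype.card_coe, Finset.card_powersetCard, Finset.card_erase_of_mem ha, Finset.card_range]
  simp

lemma rank_sum_le' {m n : Type*} [Fintype m] [Fintype n] {ι : Type*}
    (s : Finset ι) (M : ι → Matrix m n ℂ) (c : ℕ) (h : ∀ i, (M i).rank ≤ c) :
    (∑ i ∈ s, M i).rank ≤ s.card * c := by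
  classical
  induction s using Finset.induction_on with
  | empty => simp
  | insert a s ha ih =>
    rw [Finset.sum_insert ha, Finset.card_insert_of_notMem ha]
    have h1 : (M a + ∑ i ∈ s, M i).rank ≤ (M a).rank + (∑ i ∈ s, M i).rank := by
      unfold Matrix.rank
      rw [Matrix.mulVecLin_add]
      exact (Submodule.finrank_mono (LinearMap.range_add_le _ _)).trans
        (Submodule.finrank_add_le_finrank_add_finrank _ _)
    have := h a
    linarith

lemma kflat_rank_le {p r : ℕ} (S : KT p) (h : rankLE S r) :
    (kflat S).rank ≤ r * (2 * p).choose p := by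
  obtain ⟨u, v, w, rfl⟩ := h
  rw [kflat_sum (fun l x y z => u l x * v l y * w l z)]
  have := rank_sum_le' Finset.univ (fun l => kflat (fun x y z => u l x * v l y * w l z))
    ((2 * p).choose p) (fun l => kflat_rank_one _ _ _)
  simpa using this

/-! ### Injectivity of the flattening of matrix multiplication -/

/-- The number of elements of `S` below `x`. -/
def kcnt (S : Finset ℕ) (x : ℕ) : ℕ := (S.filter (· < x)).card

lemma kcnt_succ (S : Finset ℕ) (x : ℕ) :
    kcnt S (x + 1) = kcnt S x + if x ∈ S then 1 else 0 := by
  unfold kcnt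
  have : S.filter (· < x + 1) = S.filter (· < x) ∪ S.filter (· = x) := by
    ext y; simp only [Finset.mem_filter, Finset.mem_union]; 
    constructor
    · rintro ⟨h, h2⟩
      rcases Nat.lt_succ_iff_lt_or_eq.mp h2 with h3 | h3 <;> tauto
    · rintro (⟨h, h2⟩ | ⟨h, h2⟩)
      · exact ⟨h, by omega⟩
      · exact ⟨h, by omega⟩
  rw [this, Finset.card_union_of_disjoint, Finset.filter_eq']
  · split_ifs <;> simp
  · rw [Finset.disjoint_filter]; intro y _ h; omega

lemma kcnt_le_add (S : Finset ℕ) (x d : ℕ) : kcnt S (x + d) ≤ kcnt S x + d := by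
  induction d with
  | zero => simp
  | succ d ih =>
    rw [← add_assoc, kcnt_succ]
    split_ifs <;> omega

lemma kcnt_mono (S : Finset ℕ) {x y : ℕ} (h : x ≤ y) : kcnt S x ≤ kcnt S y := by
  unfold kcnt
  refine Finset.card_le_card fun z hz => ?_
  rw [Finset.mem_filter] at hz ⊢
  exact ⟨hz.1, by omega⟩

lemma kcnt_le_card (S : Finset ℕ) (x : ℕ) : kcnt S x ≤ S.card := Finset.card_filter_le _ _

/-- The `j`-th missing element of `S`. -/
lemma khole (p : ℕ) (S : KS p p) (j : Fin (p + 1)) :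
    ∃ s, s ∈ Finset.range (2 * p + 1) ∧ s ∉ S.1 ∧ s = j + kcnt S.1 s := by
  obtain ⟨S, hS⟩ := S
  rw [Finset.mem_powersetCard] at hS
  obtain ⟨hS, hc⟩ := hS
  have hj := j.2
  have hex : ∃ x, (j : ℕ) + kcnt S (x + 1) < x + 1 := by
    refine ⟨2 * p, ?_⟩
    have := kcnt_le_card S (2 * p + 1)
    omega
  classical
  set x := Nat.find hex with hx
  have h1 : (j : ℕ) + kcnt S (x + 1) < x + 1 := Nat.find_spec hex
  have h2 : x ≤ j + kcnt S x := by
    rcases Nat.eq_zero_or_pos x with h0 | h0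
    · omega
    · have := Nat.find_min hex (m := x - 1) (by omega)
      rw [Nat.sub_add_cancel h0] at this
      omega
  rw [kcnt_succ] at h1
  have hxS : x ∉ S := by
    intro h; rw [if_pos h] at h1; omega
  rw [if_neg hxS] at h1
  have := kcnt_le_card S x
  refine ⟨x, ?_, hxS, by show x = j + kcnt S x; omega⟩
  rw [Finset.mem_range]; omega

/-- The concave potential. -/
def kA (p : ℕ) (S : Finset ℕ) (j : ℕ) (x : ℕ) : ℤ :=
  (∑ y ∈ S, |(x : ℤ) - y|) - (x : ℤ) ^ 2 + (2 * j + p) * x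

lemma kA_succ (p : ℕ) (S : Finset ℕ) (hS : S.card = p) (j x : ℕ) :
    kA p S j (x + 1) - kA p S j x = 2 * (kcnt S (x + 1) : ℤ) - 2 * x - 1 + 2 * j := by
  have h : (∑ y ∈ S, |((x + 1 : ℕ) : ℤ) - y|) - (∑ y ∈ S, |(x : ℤ) - y|) =
      2 * (kcnt S (x + 1) : ℤ) - p := by
    have e : (p : ℤ) = ∑ y ∈ S, 1 := by simp [hS]
    rw [kcnt, Finset.card_filter, e, ← Finset.sum_sub_distrib]
    push_cast
    rw [Finset.mul_sum, ← Finset.sum_sub_distrib]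
    refine Finset.sum_congr rfl fun y _ => ?_
    by_cases hy : y < x + 1
    · rw [if_pos hy, abs_of_nonneg, abs_of_nonneg]
      · ring
      · omega
      · omega
    · rw [if_neg hy, abs_of_nonpos, abs_of_nonpos]
      · ring
      · omega
      · omega
  unfold kA
  push_cast at h ⊢
  linear_combination h

lemma kA_lt (p : ℕ) (S : Finset ℕ) (hS : S.card = p) (j s x : ℕ) (hs : s ∉ S)
    (hj : s = j + kcnt S s) (hx : x ≠ s) : kA p S j x < kA p S j s := by
  rcases lt_or_gt_of_ne hx with h | h
  · -- below the hole
    have : ∀ d y, y + d + 1 = s → kA p S j y < kA p S j s := by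
      intro d
      induction d with
      | zero =>
        intro y hy
        have h1 := kA_succ p S hS j y
        have hy' : y + 1 = s := by omega
        rw [hy'] at h1
        omega
      | succ d ih =>
        intro y hy
        have h1 := kA_succ p S hS j y
        have h2 := ih (y + 1) (by omega)
        have h3 := kcnt_le_add S (y + 1) (d + 1)
        have h4 : y + 1 + (d + 1) = s := by omega
        rw [h4] at h3
        omega
    exact this (s - x - 1) x (by omega)
  · have : ∀ d, kA p S j (s + 1 + d) < kA p S j s := by
      intro d
      induction d with
      | zero =>
        have h1 := kA_succ p S hS j s
        have h2 := kcnt_succ S s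
        rw [if_neg hs] at h2
        simp only [add_zero] at h2 ⊢
        omega
      | succ d ih =>
        have h1 := kA_succ p S hS j (s + 1 + d)
        have h2 := kcnt_succ S s
        rw [if_neg hs] at h2
        have h3 := kcnt_le_add S (s + 1) (d + 1)
        rw [← add_assoc] at h3 ⊢
        push_cast at h1
        omega
    have := this (x - s - 1)
    rwa [show s + 1 + (x - s - 1) = x by omega] at this

/-- The potential on targets. -/
def kB (p : ℕ) (T : Finset ℕ) (i : ℕ) : ℤ :=
  (∑ x ∈ T, ∑ y ∈ T, |(x : ℤ) - y|) - 2 * (i : ℤ) ^ 2 + 2 * p * ∑ x ∈ T, (x : ℤ)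

/-- The potential on sources. -/
def kC (p : ℕ) (S : Finset ℕ) (j : ℕ) : ℤ :=
  (∑ x ∈ S, ∑ y ∈ S, |(x : ℤ) - y|) - 2 * (j : ℤ) ^ 2 + 2 * p * ∑ x ∈ S, (x : ℤ)

lemma kB_eq (p : ℕ) (S : Finset ℕ) (i j s : ℕ) (hs : s ∉ S) (h : s = i + j) :
    kB p (insert s S) i = 2 * kA p S j s + kC p S j := by
  unfold kB kA kC
  rw [Finset.sum_insert hs, Finset.sum_insert hs]
  have : ∀ x ∈ S, ∑ y ∈ insert s S, |(x : ℤ) - y| = |(s : ℤ) - x| + ∑ y ∈ S, |(x : ℤ) - y| := by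
    intro x _
    rw [Finset.sum_insert hs, abs_sub_comm]
  rw [Finset.sum_congr rfl this, Finset.sum_insert hs, Finset.sum_add_distrib]
  have e : (s : ℤ) = i + j := by exact_mod_cast h
  simp only [sub_self, abs_zero, zero_add]
  generalize (∑ x ∈ S, |(s : ℤ) - x|) = X
  rw [e]
  ring

lemma kproj_matMul (p : ℕ) (y z : Fin (p + 1) × Fin (p + 1)) (s : ℕ) :
    kproj (matMulTensor (p + 1) (p + 1) (p + 1)) y z s =
      if y.2 = z.1 ∧ (z.2 : ℕ) + y.1 = s then 1 else 0 := by
  unfold kproj matMulTensor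
  rw [Finset.sum_eq_single (z.2, y.1)]
  · by_cases h1 : y.2 = z.1 <;> by_cases h2 : (z.2 : ℕ) + y.1 = s <;> simp [h1, h2]
  · intro x _ hx
    rw [if_neg (c := x.2 = y.1 ∧ _)]
    · simp
    · rintro ⟨h1, h2, h3⟩
      exact hx (Prod.ext h3.symm h1)
  · simp

lemma kflat_matMul_injective (p : ℕ) :
    Function.Injective (kflat (matMulTensor (p + 1) (p + 1) (p + 1))).mulVec := by
  classical
  rw [← Matrix.coe_mulVecLin, ← LinearMap.ker_eq_bot, LinearMap.ker_eq_bot']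
  intro c hc
  by_contra hne
  choose hole hr hS hh using khole p
  set Φ : KS p p × (Fin (p + 1) × Fin (p + 1)) → ℤ := fun q =>
    2 * kA p q.1.1 q.2.1 (hole q.1 q.2.1) + kC p q.1.1 q.2.1 with hΦ
  have hsupp : (Finset.univ.filter fun q => c q ≠ 0).Nonempty := by
    obtain ⟨q, hq⟩ := Function.ne_iff.mp hne
    exact ⟨q, by simpa using hq⟩
  obtain ⟨⟨S, j, k⟩, hq, hmax⟩ := Finset.exists_max_image _ Φ hsupp
  rw [Finset.mem_filter] at hq
  have hq := hq.2
  have hSc := (Finset.mem_powersetCard.mp S.2)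
  set s := hole S j with hs
  have hsS : s ∉ S.1 := hS S j
  have hsj : s = j + kcnt S.1 s := hh S j
  have hcl := kcnt_le_card S.1 s
  set a : Fin (p + 1) := ⟨kcnt S.1 s, by omega⟩ with ha
  have hT : insert s S.1 ∈ Finset.powersetCard (p + 1) (Finset.range (2 * p + 1)) := by
    rw [Finset.mem_powersetCard]
    refine ⟨Finset.insert_subset (hr S j) hSc.1, ?_⟩
    rw [Finset.card_insert_of_notMem hsS, hSc.2]
  have hrow := congrFun hc (⟨insert s S.1, hT⟩, (k, a))
  rw [Matrix.mulVecLin_apply, Matrix.mulVec, dotProduct, Finset.sum_eq_single (S, (j, k))] at hrow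
  · -- the diagonal entry
    rw [Pi.zero_apply, mul_eq_zero] at hrow
    rcases hrow with h | h
    · simp only [kflat, Matrix.of_apply, kD] at h
      rw [Finset.sum_eq_single s] at h
      · rw [kproj_matMul, if_pos, Finset.erase_insert hsS, if_pos rfl] at h
        · exact ksg_ne_zero _ _ (by simpa using h)
        · refine ⟨rfl, ?_⟩
          simp only [ha]; omega
      · intro t ht hts
        rw [if_neg, mul_zero]
        intro h2
        have : s ∈ (insert s S.1).erase t := by simp [Ne.symm hts]
        rw [h2] at this
        exact hsS this
      · intro h2; exact absurd (Finset.mem_insert_self _ _) h2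
    · exact hq h
  · rintro ⟨Q, b, k'⟩ _ hQ
    by_contra hprod
    have hK := left_ne_zero_of_mul hprod
    have hcQ := right_ne_zero_of_mul hprod
    simp only [kflat, Matrix.of_apply, kD] at hK
    obtain ⟨t, ht, hterm⟩ := Finset.exists_ne_zero_of_sum_ne_zero hK
    have g1 := right_ne_zero_of_mul hterm
    have g2 := right_ne_zero_of_mul (left_ne_zero_of_mul hterm)
    rw [kproj_matMul] at g2
    have h1 : (insert s S.1).erase t = Q.1 := by
      by_contra h; simp [h] at g1
    have h2 : k' = k ∧ (a : ℕ) + b = t := by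
      by_contra h; exact g2 (if_neg h)
    obtain ⟨rfl, h2⟩ := h2
    have htQ : t ∉ Q.1 := by rw [← h1]; simp
    have hTQ : insert s S.1 = insert t Q.1 := by rw [← h1, Finset.insert_erase ht]
    have hm := hmax (Q, (b, k')) (by simp [hcQ])
    have e1 : Φ (S, (j, k')) = kB p (insert s S.1) a := by
      rw [kB_eq p S.1 a j s hsS (by simp only [ha]; omega)]
    have e2 : kB p (insert s S.1) a = 2 * kA p Q.1 b t + kC p Q.1 b := by
      rw [hTQ, kB_eq p Q.1 a b t htQ h2.symm]
    rw [e1, e2] at hm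
    have hQc := (Finset.mem_powersetCard.mp Q.2)
    by_cases hth : t = hole Q b
    · have ht2 : t = b + kcnt Q.1 t := by rw [hth]; exact hh Q b
      have ht3 : kcnt Q.1 t = kcnt S.1 s := by
        have : (a : ℕ) = kcnt S.1 s := rfl
        omega
      have hst : t = s := by
        have c1 : kcnt (insert s S.1) s = kcnt S.1 s := by
          unfold kcnt; rw [Finset.filter_insert, if_neg (lt_irrefl _)]
        have c2 : kcnt (insert s S.1) t = kcnt Q.1 t := by
          rw [hTQ]; unfold kcnt; rw [Finset.filter_insert, if_neg (lt_irrefl _)]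
        rcases lt_trichotomy t s with h | h | h
        · have := kcnt_succ (insert s S.1) t
          rw [if_pos ht] at this
          have := kcnt_mono (insert s S.1) (show t + 1 ≤ s from h)
          omega
        · exact h
        · have := kcnt_succ (insert s S.1) s
          rw [if_pos (Finset.mem_insert_self _ _)] at this
          have := kcnt_mono (insert s S.1) (show s + 1 ≤ t from h)
          omega
      apply hQ
      have hSQ : S = Q := by
        apply Subtype.ext
        rw [← h1, hst, Finset.erase_insert hsS]
      have hbj : b = j := by
        apply Fin.ext
        have : (a : ℕ) = kcnt S.1 s := rfl
        omega
      rw [hSQ, hbj]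
    · have := kA_lt p Q.1 hQc.2 b (hole Q b) t (hS Q b) (hh Q b) hth
      simp only [hΦ] at hm
      linarith
  · intro h; exact absurd (Finset.mem_univ _) h

/-! ### Semicontinuity and conclusion -/

lemma rankLE_exists {ι₁ ι₂ ι₃ : Type*} [Fintype ι₁] [Fintype ι₂] [Fintype ι₃]
    (T : ι₁ → ι₂ → ι₃ → ℂ) : ∃ r, rankLE T r := by
  classical
  let e := Fintype.equivFin (ι₁ × ι₂ × ι₃)
  refine ⟨Fintype.card (ι₁ × ι₂ × ι₃), fun l i => if (e.symm l).1 = i then 1 else 0,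
    fun l j => if (e.symm l).2.1 = j then 1 else 0,
    fun l k => if (e.symm l).2.2 = k then T (e.symm l).1 (e.symm l).2.1 k else 0, ?_⟩
  funext i j k
  rw [e.symm.sum_comp (fun q : ι₁ × ι₂ × ι₃ => (if q.1 = i then (1 : ℂ) else 0) *
    (if q.2.1 = j then 1 else 0) * (if q.2.2 = k then T q.1 q.2.1 k else 0))]
  rw [Finset.sum_eq_single (i, j, k)]
  · simp
  · rintro ⟨i', j', k'⟩ _ hne
    by_cases h1 : i' = i
    · by_cases h2 : j' = j
      · have h3 : k' ≠ k := by rintro rfl; exact hne (by rw [h1, h2])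
        simp [h3]
      · simp [h2]
    · simp [h1]
  · simp

lemma closure_rank_bound (p r : ℕ) (h : matMulTensor (p + 1) (p + 1) (p + 1) ∈
    closure {S : KT p | rankLE S r}) :
    (2 * p + 1).choose p * ((p + 1) * (p + 1)) ≤ r * (2 * p).choose p := by
  classical
  set K := kflat (matMulTensor (p + 1) (p + 1) (p + 1)) with hK
  obtain ⟨L, hL⟩ := LinearMap.exists_leftInverse_of_injective K.mulVecLin
    (LinearMap.ker_eq_bot.mpr (kflat_matMul_injective p))
  have hLK : LinearMap.toMatrix' L * K = 1 := by
    apply Matrix.toLin'.injective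
    rw [Matrix.toLin'_mul, Matrix.toLin'_toMatrix', Matrix.toLin'_one]
    exact hL
  have hcont : Continuous fun S : KT p => (LinearMap.toMatrix' L * kflat S).det :=
    Continuous.matrix_det (Continuous.matrix_mul continuous_const (kflat_continuous p))
  have hopen : IsOpen {S : KT p | (LinearMap.toMatrix' L * kflat S).det ≠ 0} :=
    isOpen_ne_fun hcont continuous_const
  have hmem : matMulTensor (p + 1) (p + 1) (p + 1) ∈
      {S : KT p | (LinearMap.toMatrix' L * kflat S).det ≠ 0} := by
    show (LinearMap.toMatrix' L * K).det ≠ 0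
    rw [hLK, Matrix.det_one]; exact one_ne_zero
  obtain ⟨S, hS1, hS2⟩ := mem_closure_iff.mp h _ hopen hmem
  have hS1 : (LinearMap.toMatrix' L * kflat S).det ≠ 0 := hS1
  have h1 := Matrix.rank_of_isUnit _ ((Matrix.isUnit_iff_isUnit_det _).mpr hS1.isUnit)
  have h2 := Matrix.rank_mul_le_right (LinearMap.toMatrix' L) (kflat S)
  have h3 := kflat_rank_le S hS2
  rw [h1] at h2
  have h4 := h2.trans h3
  simpa [Fintype.card_prod, Fintype.card_coe, Finset.card_powersetCard] using h4

/-- `BR(M⟨n⟩) ≥ 2n² − n`. -/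
theorem borderRank_matMul_ge_LO (n : ℕ) (hn : 1 ≤ n) :
    2 * n ^ 2 - n ≤ brank (matMulTensor n n n) := by
  obtain ⟨p, rfl⟩ : ∃ p, n = p + 1 := ⟨n - 1, by omega⟩
  have hne : {r | matMulTensor (p + 1) (p + 1) (p + 1) ∈
      closure {S : KT p | rankLE S r}}.Nonempty := by
    obtain ⟨r, hr⟩ := rankLE_exists (matMulTensor (p + 1) (p + 1) (p + 1))
    exact ⟨r, subset_closure hr⟩
  have hmem := Nat.sInf_mem hne
  have hb := closure_rank_bound p _ hmem
  change _ ≤ brank (matMulTensor (p + 1) (p + 1) (p + 1)) * _ at hb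
  have hid : (2 * p + 1) * (2 * p).choose p = (2 * p + 1).choose p * (p + 1) := by
    have h1 := Nat.add_one_mul_choose_eq (2 * p) p
    have h2 : (2 * p + 1).choose (p + 1) = (2 * p + 1).choose p :=
      Nat.choose_symm_of_eq_add (by omega)
    rw [h2] at h1
    exact h1
  have hpos : 0 < (2 * p).choose p := Nat.choose_pos (by omega)
  have hfin : (2 * p + 1) * (p + 1) ≤ brank (matMulTensor (p + 1) (p + 1) (p + 1)) := by
    refine Nat.le_of_mul_le_mul_right ?_ hpos
    calc (2 * p + 1) * (p + 1) * (2 * p).choose p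
        = (2 * p + 1).choose p * ((p + 1) * (p + 1)) := by rw [← mul_assoc, ← hid]; ring
      _ ≤ _ := hb
  refine le_trans ?_ hfin
  have : 2 * (p + 1) ^ 2 = (2 * p + 1) * (p + 1) + (p + 1) := by ring
  omega

end
end

section
/- The border rank of the 3×3 matrix multiplication tensor satisfies BR(M⟨3⟩) ≥ 17. -/
open scoped BigOperators

noncomputable section

/-! ### Part 1: linear algebra -/

theorem finrank_le_of_pivots {κ : Type*} [Fintype κ] (K : Submodule ℂ (κ → ℂ)) (P : Finset κ)
    (h : ∀ x ∈ K, (∀ p ∈ P, x p = 0) → x = 0) : Module.finrank ℂ K ≤ P.card := by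
  classical
  let f : K →ₗ[ℂ] (P → ℂ) :=
    { toFun := fun x p => x.1 p.1
      map_add' := fun x y => rfl
      map_smul' := fun c x => rfl }
  have hf : Function.Injective f := by
    rw [← LinearMap.ker_eq_bot, LinearMap.ker_eq_bot']
    intro x hx
    apply Subtype.ext
    apply h x.1 x.2
    intro p hp
    exact congrFun hx ⟨p, hp⟩
  have := LinearMap.finrank_le_finrank_of_injective hf
  simpa using this

theorem card_le_finrank_of_indep {κ : Type*} [Fintype κ] [DecidableEq κ]
    (E : Submodule ℂ (κ → ℂ)) (P : Finset κ)
    (h : ∀ p ∈ P, ∃ v ∈ E, v p = 1 ∧ ∀ q ∈ P, q ≠ p → v q = 0) :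
    P.card ≤ Module.finrank ℂ E := by
  choose! v hv h1 h0 using h
  let w : P → E := fun p => ⟨v p.1, hv p.1 p.2⟩
  have hw : LinearIndependent ℂ w := by
    rw [Fintype.linearIndependent_iff]
    intro g hg p
    have h2 := congrArg (fun x : E => x.1 p.1) hg
    simp only [AddSubmonoidClass.coe_finsetSum, Finset.sum_apply] at h2
    rw [Finset.sum_eq_single p] at h2
    · simpa [w, h1 p.1 p.2] using h2
    · intro q _ hq
      have : v q.1 p.1 = 0 := h0 q.1 q.2 p.1 p.2 (fun e => hq (Subtype.ext e.symm))
      simp [w, this]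
    · simp
  simpa using hw.fintype_card_le_finrank

theorem finrank_map_add_inf_ker {V W : Type*} [AddCommGroup V] [Module ℂ V] [AddCommGroup W]
    [Module ℂ W] [FiniteDimensional ℂ V] (f : V →ₗ[ℂ] W) (S : Submodule ℂ V) :
    Module.finrank ℂ (S.map f) + Module.finrank ℂ (S ⊓ LinearMap.ker f : Submodule ℂ V)
      = Module.finrank ℂ S := by
  have h := LinearMap.finrank_range_add_finrank_ker (f.domRestrict S)
  have h1 : LinearMap.range (f.domRestrict S) = S.map f := by
    ext y; simp
  have h2 : Module.finrank ℂ (LinearMap.ker (f.domRestrict S))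
      = Module.finrank ℂ (S ⊓ LinearMap.ker f : Submodule ℂ V) := by
    have : (LinearMap.ker (f.domRestrict S)).map S.subtype = S ⊓ LinearMap.ker f := by
      ext y; simp [and_comm]
    rw [← this]
    exact (Submodule.finrank_map_subtype_eq _ _).symm
  rw [← h, h1, h2]

/-! ### Part 2: weight filtrations and initial subspaces -/

set_option linter.unusedSectionVars false
section Weights
variable {κ : Type*} [Fintype κ] (wt : κ → ℕ)

/-- vectors supported in weights `< w`. -/
def wF (w : ℕ) : Submodule ℂ (κ → ℂ) where
  carrier := {x | ∀ i, w ≤ wt i → x i = 0}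
  add_mem' := by
    intro x y hx hy i hi
    simp [hx i hi, hy i hi]
  zero_mem' := by intro i _; rfl
  smul_mem' := by
    intro c x hx i hi
    simp [hx i hi]

/-- the weight-`w` component. -/
def wcomp (w : ℕ) : (κ → ℂ) →ₗ[ℂ] (κ → ℂ) where
  toFun x := fun i => if wt i = w then x i else 0
  map_add' := by
    intro x y; funext i
    by_cases h : wt i = w <;> simp [h]
  map_smul' := by
    intro c x; funext i
    by_cases h : wt i = w <;> simp [h]

/-- the initial subspace. -/
def wInit (E : Submodule ℂ (κ → ℂ)) : Submodule ℂ (κ → ℂ) where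
  carrier := {x | ∀ w, ∃ y ∈ E, y ∈ wF wt (w + 1) ∧ ∀ i, wt i = w → y i = x i}
  add_mem' := by
    intro a b ha hb w
    obtain ⟨y, hy, hyF, hya⟩ := ha w
    obtain ⟨z, hz, hzF, hzb⟩ := hb w
    refine ⟨y + z, E.add_mem hy hz, (wF wt (w+1)).add_mem hyF hzF, ?_⟩
    intro i hi
    simp [hya i hi, hzb i hi]
  zero_mem' := by
    intro w
    exact ⟨0, E.zero_mem, Submodule.zero_mem _, fun i _ => rfl⟩
  smul_mem' := by
    intro c a ha w
    obtain ⟨y, hy, hyF, hya⟩ := ha w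
    refine ⟨c • y, E.smul_mem c hy, Submodule.smul_mem _ c hyF, ?_⟩
    intro i hi
    simp [hya i hi]

def wGraded (E : Submodule ℂ (κ → ℂ)) : Prop := ∀ x, x ∈ E ↔ ∀ w, wcomp wt w x ∈ E

theorem wInit_graded (E : Submodule ℂ (κ → ℂ)) : wGraded wt (wInit wt E) := by
  intro x
  constructor
  · intro hx w v
    by_cases h : v = w
    · subst h
      obtain ⟨y, hy, hyF, hya⟩ := hx v
      refine ⟨y, hy, hyF, ?_⟩
      intro i hi
      simp [wcomp, hi, hya i hi]
    · refine ⟨0, E.zero_mem, Submodule.zero_mem _, ?_⟩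
      intro i hi
      have : wt i ≠ w := by omega
      simp [wcomp, this]
  · intro hx w
    obtain ⟨y, hy, hyF, hya⟩ := hx w w
    refine ⟨y, hy, hyF, ?_⟩
    intro i hi
    rw [hya i hi]
    simp [wcomp, hi]

theorem wF_succ_inf_ker (w : ℕ) :
    (wF wt (w+1)) ⊓ LinearMap.ker (wcomp wt w) = wF wt w := by
  ext x
  simp only [Submodule.mem_inf, LinearMap.mem_ker]
  constructor
  · rintro ⟨h1, h2⟩ i hi
    rcases Nat.lt_or_ge w (wt i) with h | h
    · exact h1 i h
    · have := congrFun h2 i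
      have e : wt i = w := by omega
      simpa [wcomp, e] using this
  · intro h
    refine ⟨fun i hi => h i (by omega), ?_⟩
    funext i
    by_cases e : wt i = w
    · simp [wcomp, e, h i (by omega)]
    · simp [wcomp, e]

theorem wF_zero : wF wt 0 = ⊥ := by
  ext x
  constructor
  · intro h
    rw [Submodule.mem_bot]
    funext i
    exact h i (Nat.zero_le _)
  · intro h
    rw [Submodule.mem_bot] at h
    subst h
    exact Submodule.zero_mem _

theorem wF_top (w : ℕ) (h : ∀ i, wt i < w) : wF wt w = ⊤ := by
  ext x
  simp only [Submodule.mem_top, iff_true]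
  intro i hi
  have := h i
  omega

theorem wInit_map (E : Submodule ℂ (κ → ℂ)) (w : ℕ) :
    (wInit wt E ⊓ wF wt (w+1)).map (wcomp wt w) = (E ⊓ wF wt (w+1)).map (wcomp wt w) := by
  ext z
  simp only [Submodule.mem_map, Submodule.mem_inf]
  constructor
  · rintro ⟨x, ⟨hx, hxF⟩, rfl⟩
    obtain ⟨y, hy, hyF, hya⟩ := hx w
    refine ⟨y, ⟨hy, hyF⟩, ?_⟩
    funext i
    by_cases e : wt i = w
    · simp [wcomp, e, hya i e]
    · simp [wcomp, e]
  · rintro ⟨y, ⟨hy, hyF⟩, rfl⟩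
    refine ⟨wcomp wt w y, ⟨?_, ?_⟩, ?_⟩
    · intro v
      by_cases h : v = w
      · subst h
        refine ⟨y, hy, hyF, ?_⟩
        intro i hi
        simp [wcomp, hi]
      · refine ⟨0, E.zero_mem, Submodule.zero_mem _, ?_⟩
        intro i hi
        have : wt i ≠ w := by omega
        simp [wcomp, this]
    · intro i hi
      have : wt i ≠ w := by omega
      simp [wcomp, this]
    · funext i
      by_cases e : wt i = w <;> simp [wcomp, e]

theorem wInit_finrank_inf (E : Submodule ℂ (κ → ℂ)) (w : ℕ) :
    Module.finrank ℂ (wInit wt E ⊓ wF wt w : Submodule ℂ (κ → ℂ))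
      = Module.finrank ℂ (E ⊓ wF wt w : Submodule ℂ (κ → ℂ)) := by
  induction w with
  | zero => rw [wF_zero, inf_bot_eq, inf_bot_eq]
  | succ w ih =>
    rw [← finrank_map_add_inf_ker (wcomp wt w) (wInit wt E ⊓ wF wt (w+1)),
      ← finrank_map_add_inf_ker (wcomp wt w) (E ⊓ wF wt (w+1)), wInit_map, inf_assoc, inf_assoc,
      wF_succ_inf_ker, ih]

theorem wInit_finrank (E : Submodule ℂ (κ → ℂ)) :
    Module.finrank ℂ (wInit wt E) = Module.finrank ℂ E := by
  have h : ∀ i, wt i < (Finset.univ.sup wt) + 1 := by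
    intro i
    exact Nat.lt_succ_of_le (Finset.le_sup (f := wt) (Finset.mem_univ i))
  have := wInit_finrank_inf wt E ((Finset.univ.sup wt) + 1)
  rwa [wF_top wt _ h, inf_top_eq, inf_top_eq] at this

theorem wInit_comp {κ' : Type*} [Fintype κ'] (wt' : κ' → ℕ) (f : κ' → κ) (c : ℕ)
    (hf : ∀ p, wt (f p) = wt' p + c) (K : Submodule ℂ (κ → ℂ)) (E : Submodule ℂ (κ' → ℂ))
    (h : ∀ x ∈ K, (fun p => x (f p)) ∈ E) :
    ∀ x ∈ wInit wt K, (fun p => x (f p)) ∈ wInit wt' E := by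
  intro x hx w
  obtain ⟨y, hy, hyF, hya⟩ := hx (w + c)
  refine ⟨_, h y hy, ?_, ?_⟩
  · intro p hp
    apply hyF
    rw [hf]; omega
  · intro p hp
    apply hya
    rw [hf, hp]

theorem wInit_symm (σ : κ → κ) (hσ : ∀ p, wt (σ p) = wt p) (K : Submodule ℂ (κ → ℂ))
    (h : ∀ x ∈ K, ∀ p, x (σ p) = x p) :
    ∀ x ∈ wInit wt K, ∀ p, x (σ p) = x p := by
  intro x hx p
  obtain ⟨y, hy, hyF, hya⟩ := hx (wt p)
  rw [← hya p rfl, ← hya (σ p) (hσ p)]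
  exact h y hy p

theorem mem_wInit_of_homog (E : Submodule ℂ (κ → ℂ)) (x : κ → ℂ) (hx : x ∈ E) (w : ℕ)
    (hw : ∀ i, wt i ≠ w → x i = 0) : x ∈ wInit wt E := by
  intro v
  by_cases h : v = w
  · subst h
    refine ⟨x, hx, ?_, fun i _ => rfl⟩
    intro i hi
    exact hw i (by omega)
  · refine ⟨0, E.zero_mem, Submodule.zero_mem _, ?_⟩
    intro i hi
    rw [hw i (by omega)]; rfl

/-- `N` raises weights by exactly `d`. -/
def wRaises (d : ℕ) (N : (κ → ℂ) →ₗ[ℂ] (κ → ℂ)) : Prop :=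
  ∀ x i, (∀ j, wt j + d = wt i → x j = 0) → N x i = 0

theorem wUnip_injOn {d : ℕ} (hd : 1 ≤ d) (N N2 : (κ → ℂ) →ₗ[ℂ] (κ → ℂ)) (hN : wRaises wt d N)
    (hN2 : wRaises wt (2 * d) N2) (w : ℕ) (x : κ → ℂ) (hx : ∀ i, wt i < w → x i = 0)
    (hgx : ∀ i, w ≤ wt i → x i + N x i + N2 x i = 0) : x = 0 := by
  have key : ∀ v, ∀ i, wt i < v → x i = 0 := by
    intro v
    induction v with
    | zero => intro i hi; omega
    | succ v ih =>
      intro i hi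
      rcases Nat.lt_or_ge (wt i) w with h | h
      · exact hx i h
      · have h1 := hgx i h
        rw [hN x i (fun j hj => ih j (by omega)), hN2 x i (fun j hj => ih j (by omega))] at h1
        simpa using h1
  funext i
  exact key (wt i + 1) i (Nat.lt_succ_self _)

/-- projection on weights `< w` -/
def wlow (w : ℕ) : (κ → ℂ) →ₗ[ℂ] (κ → ℂ) where
  toFun x := fun i => if wt i < w then x i else 0
  map_add' := by
    intro x y; funext i
    by_cases h : wt i < w <;> simp [h]
  map_smul' := by
    intro c x; funext i
    by_cases h : wt i < w <;> simp [h]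

theorem wlow_mem {E : Submodule ℂ (κ → ℂ)} (hE : wGraded wt E) {x : κ → ℂ} (hx : x ∈ E) (w : ℕ) :
    wlow wt w x ∈ E ⊓ wF wt w := by
  refine ⟨?_, ?_⟩
  · rw [SetLike.mem_coe, hE]
    intro v
    by_cases h : v < w
    · have e : wcomp wt v (wlow wt w x) = wcomp wt v x := by
        funext i
        by_cases e : wt i = v
        · simp [wcomp, wlow, e, h]
        · simp [wcomp, e]
      rw [e]
      exact (hE x).1 hx v
    · have e : wcomp wt v (wlow wt w x) = 0 := by
        funext i
        by_cases e : wt i = v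
        · simp [wcomp, wlow, e, h]
        · simp [wcomp, e]
      rw [e]
      exact E.zero_mem
  · intro i hi
    have : ¬ wt i < w := by omega
    simp [wlow, this]

section unip

theorem wUnip_injective {d : ℕ} (hd : 1 ≤ d) (N N2 g : (κ → ℂ) →ₗ[ℂ] (κ → ℂ)) (hN : wRaises wt d N)
    (hN2 : wRaises wt (2 * d) N2) (hg : ∀ x i, g x i = x i + N x i + N2 x i)
    : Function.Injective g := by
  rw [← LinearMap.ker_eq_bot, LinearMap.ker_eq_bot']
  intro x hx
  apply wUnip_injOn wt hd N N2 hN hN2 0 x (fun i hi => by omega)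
  intro i _
  rw [← hg, hx]; rfl

theorem finrank_pull {d : ℕ} (hd : 1 ≤ d) (N N2 g : (κ → ℂ) →ₗ[ℂ] (κ → ℂ)) (hN : wRaises wt d N)
    (hN2 : wRaises wt (2 * d) N2) (hg : ∀ x i, g x i = x i + N x i + N2 x i)
    (E : Submodule ℂ (κ → ℂ)) (w : ℕ) :
    Module.finrank ℂ (E.map g ⊓ wF wt w : Submodule ℂ (κ → ℂ)) =
      Module.finrank ℂ ((E ⊓ (wF wt w).comap g).map (wlow wt w)) := by
  have h1 := finrank_map_add_inf_ker g (E ⊓ (wF wt w).comap g)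
  have h2 := finrank_map_add_inf_ker (wlow wt w) (E ⊓ (wF wt w).comap g)
  have h3 : LinearMap.ker g = ⊥ := LinearMap.ker_eq_bot.2 (wUnip_injective wt hd N N2 g hN hN2 hg)
  have h4 : (E ⊓ (wF wt w).comap g) ⊓ LinearMap.ker (wlow wt w) = ⊥ := by
    rw [eq_bot_iff]
    rintro x ⟨⟨hx, hx2⟩, hx3⟩
    rw [Submodule.mem_bot]
    apply wUnip_injOn wt hd N N2 hN hN2 w x
    · intro i hi
      have := congrFun hx3 i
      simpa [wlow, hi] using this
    · intro i hi
      rw [← hg]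
      exact hx2 i hi
  have h5 : (E ⊓ (wF wt w).comap g).map g = E.map g ⊓ wF wt w := by
    ext y
    simp only [Submodule.mem_map, Submodule.mem_inf, Submodule.mem_comap]
    constructor
    · rintro ⟨x, ⟨hx, hx2⟩, rfl⟩
      exact ⟨⟨x, hx, rfl⟩, hx2⟩
    · rintro ⟨⟨x, hx, rfl⟩, hx2⟩
      exact ⟨x, ⟨hx, hx2⟩, rfl⟩
  rw [h3, inf_bot_eq, finrank_bot, h5] at h1
  rw [h4, finrank_bot] at h2
  omega

theorem wlow_map_le {d : ℕ} (hd : 1 ≤ d) (N N2 g : (κ → ℂ) →ₗ[ℂ] (κ → ℂ)) (hN : wRaises wt d N)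
    (hN2 : wRaises wt (2 * d) N2) (hg : ∀ x i, g x i = x i + N x i + N2 x i)
    {E : Submodule ℂ (κ → ℂ)} (hE : wGraded wt E) (w : ℕ) :
    (E ⊓ (wF wt w).comap g).map (wlow wt w) ≤ E ⊓ wF wt w := by
  rintro y ⟨x, ⟨hx, _⟩, rfl⟩
  exact wlow_mem wt hE hx w

theorem finrank_unip_le {d : ℕ} (hd : 1 ≤ d) (N N2 g : (κ → ℂ) →ₗ[ℂ] (κ → ℂ)) (hN : wRaises wt d N)
    (hN2 : wRaises wt (2 * d) N2) (hg : ∀ x i, g x i = x i + N x i + N2 x i)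
    {E : Submodule ℂ (κ → ℂ)} (hE : wGraded wt E) (w : ℕ) :
    Module.finrank ℂ (E.map g ⊓ wF wt w : Submodule ℂ (κ → ℂ)) ≤
      Module.finrank ℂ (E ⊓ wF wt w : Submodule ℂ (κ → ℂ)) := by
  rw [finrank_pull wt hd N N2 g hN hN2 hg]
  exact Submodule.finrank_mono (wlow_map_le wt hd N N2 g hN hN2 hg hE w)

theorem unip_stable {d : ℕ} (hd : 1 ≤ d) (N N2 g : (κ → ℂ) →ₗ[ℂ] (κ → ℂ)) (hN : wRaises wt d N)
    (hN2 : wRaises wt (2 * d) N2) (hg : ∀ x i, g x i = x i + N x i + N2 x i)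
    {E : Submodule ℂ (κ → ℂ)} (hE : wGraded wt E)
    (heq : ∀ w, Module.finrank ℂ (E ⊓ wF wt w : Submodule ℂ (κ → ℂ)) ≤
      Module.finrank ℂ (E.map g ⊓ wF wt w : Submodule ℂ (κ → ℂ))) :
    ∀ x ∈ E, N x ∈ E := by
  have hom : ∀ v, ∀ x ∈ E, N (wcomp wt v x) ∈ E := by
    intro v x hx
    have hx' := (hE x).1 hx v
    have heq' := heq (v+1)
    rw [finrank_pull wt hd N N2 g hN hN2 hg] at heq'
    have e := Submodule.eq_of_le_of_finrank_le (wlow_map_le wt hd N N2 g hN hN2 hg hE (v+1)) heq'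
    have hx2 : wcomp wt v x ∈ E ⊓ wF wt (v+1) := by
      refine ⟨hx', ?_⟩
      intro i hi
      have : wt i ≠ v := by omega
      simp [wcomp, this]
    rw [← e] at hx2
    obtain ⟨z, ⟨hz, hgz⟩, hzx⟩ := hx2
    have hzc : ∀ i, wt i < v + 1 → z i = wcomp wt v x i := by
      intro i hi
      rw [← hzx]
      simp only [wlow, LinearMap.coe_mk, AddHom.coe_mk, if_pos hi]
    have hzlow : ∀ i, wt i < v → z i = 0 := by
      intro i hi
      rw [hzc i (by omega)]
      have : wt i ≠ v := by omega
      simp [wcomp, this]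
    have : N (wcomp wt v x) = - wcomp wt (v + d) z := by
      funext i
      by_cases hi : wt i = v + d
      · have h1 : g z i = 0 := hgz i (by omega)
        rw [hg, hN2 z i (fun j hj => hzlow j (by omega))] at h1
        have h2 : N (z - wcomp wt v x) i = 0 := by
          apply hN
          intro j hj
          simp [hzc j (by omega)]
        rw [map_sub] at h2
        simp only [Pi.sub_apply] at h2
        simp only [wcomp, LinearMap.coe_mk, AddHom.coe_mk, Pi.neg_apply, hi, if_true] at h2 ⊢
        linear_combination h1 - h2
      · have h2 : N (wcomp wt v x) i = 0 := by
          apply hN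
          intro j hj
          have : wt j ≠ v := by omega
          simp [wcomp, this]
        rw [h2]
        simp [wcomp, hi]
    rw [this]
    exact E.neg_mem ((hE z).1 hz _)
  intro x hx
  rw [hE]
  intro v
  by_cases hv : d ≤ v
  · have : wcomp wt v (N x) = N (wcomp wt (v - d) x) := by
      funext i
      by_cases hi : wt i = v
      · have h2 : N (x - wcomp wt (v - d) x) i = 0 := by
          apply hN
          intro j hj
          have : wt j = v - d := by omega
          simp [wcomp, this]
        rw [map_sub] at h2
        simp only [Pi.sub_apply] at h2
        have h3 : wcomp wt v (N x) i = N x i := by simp [wcomp, hi]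
        rw [h3]
        linear_combination h2
      · have h2 : N (wcomp wt (v - d) x) i = 0 := by
          apply hN
          intro j hj
          have : wt j ≠ v - d := by omega
          simp [wcomp, this]
        rw [h2]
        simp [wcomp, hi]
    rw [this]
    exact hom _ x hx
  · have : wcomp wt v (N x) = 0 := by
      funext i
      by_cases hi : wt i = v
      · have h2 : N x i = 0 := by
          apply hN
          intro j hj
          omega
        simp [wcomp, h2]
      · simp [wcomp, hi]
    rw [this]
    exact E.zero_mem

end unip
end Weights

/-! ### Part 3: good triples -/

abbrev I9 := Fin 3 × Fin 3
abbrev Sp2 := Submodule ℂ (I9 × I9 → ℂ)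
abbrev Sp3 := Submodule ℂ (I9 × I9 × I9 → ℂ)

def tK1 (E : Sp2) : Sp3 where
  carrier := {τ | (∀ a b c, τ (a, b, c) = τ (b, a, c)) ∧ ∀ a, (fun p : I9 × I9 => τ (a, p.1, p.2)) ∈ E}
  add_mem' := by
    rintro x y ⟨h1, h2⟩ ⟨h3, h4⟩
    refine ⟨fun a b c => ?_, fun a => E.add_mem (h2 a) (h4 a)⟩
    simp only [Pi.add_apply, h1 a b c, h3 a b c]
  zero_mem' := ⟨fun _ _ _ => rfl, fun _ => E.zero_mem⟩
  smul_mem' := by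
    rintro r x ⟨h1, h2⟩
    refine ⟨fun a b c => ?_, fun a => E.smul_mem r (h2 a)⟩
    simp only [Pi.smul_apply, h1 a b c]

def tK2 (E : Sp2) : Sp3 where
  carrier := {τ | (∀ a b c, τ (a, b, c) = τ (a, c, b)) ∧ ∀ c, (fun p : I9 × I9 => τ (p.1, p.2, c)) ∈ E}
  add_mem' := by
    rintro x y ⟨h1, h2⟩ ⟨h3, h4⟩
    refine ⟨fun a b c => ?_, fun a => E.add_mem (h2 a) (h4 a)⟩
    simp only [Pi.add_apply, h1 a b c, h3 a b c]
  zero_mem' := ⟨fun _ _ _ => rfl, fun _ => E.zero_mem⟩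
  smul_mem' := by
    rintro r x ⟨h1, h2⟩
    refine ⟨fun a b c => ?_, fun a => E.smul_mem r (h2 a)⟩
    simp only [Pi.smul_apply, h1 a b c]

def tL (E0 E1 E2 : Sp2) : Sp3 where
  carrier := {τ | (∀ c, (fun p : I9 × I9 => τ (p.1, p.2, c)) ∈ E0) ∧
    (∀ a, (fun p : I9 × I9 => τ (a, p.1, p.2)) ∈ E1) ∧
    (∀ b, (fun p : I9 × I9 => τ (p.2, b, p.1)) ∈ E2)}
  add_mem' := by
    rintro x y ⟨h1, h2, h3⟩ ⟨g1, g2, g3⟩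
    exact ⟨fun a => E0.add_mem (h1 a) (g1 a), fun a => E1.add_mem (h2 a) (g2 a),
      fun a => E2.add_mem (h3 a) (g3 a)⟩
  zero_mem' := ⟨fun _ => E0.zero_mem, fun _ => E1.zero_mem, fun _ => E2.zero_mem⟩
  smul_mem' := by
    rintro r x ⟨h1, h2, h3⟩
    exact ⟨fun a => E0.smul_mem r (h1 a), fun a => E1.smul_mem r (h2 a),
      fun a => E2.smul_mem r (h3 a)⟩

structure GoodOne (E : Sp2) : Prop where
  rk : Module.finrank ℂ E ≤ 16
  k1 : 16 ≤ Module.finrank ℂ (tK1 E)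
  k2 : 16 ≤ Module.finrank ℂ (tK2 E)

structure Good (T : I9 × I9 × I9 → ℂ) (E0 E1 E2 : Sp2) : Prop where
  g0 : GoodOne E0
  g1 : GoodOne E1
  g2 : GoodOne E2
  hT : T ∈ tL E0 E1 E2
  hL : 16 ≤ Module.finrank ℂ (tL E0 E1 E2)

def wt2 (a b : I9 → ℕ) : I9 × I9 → ℕ := fun p => a p.1 + b p.2
def wt3 (a b c : I9 → ℕ) : I9 × I9 × I9 → ℕ := fun p => a p.1 + b p.2.1 + c p.2.2

theorem goodOne_init {E : Sp2} (a b : I9 → ℕ) (h : GoodOne E) : GoodOne (wInit (wt2 a b) E) := by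
  refine ⟨?_, ?_, ?_⟩
  · rw [wInit_finrank]; exact h.rk
  · have : wInit (wt3 a a b) (tK1 E) ≤ tK1 (wInit (wt2 a b) E) := by
      intro x hx
      refine ⟨?_, ?_⟩
      · intro i j k
        exact wInit_symm (wt3 a a b) (fun p => (p.2.1, p.1, p.2.2))
          (fun p => by simp [wt3, add_comm]) (tK1 E) (fun x hx p => hx.1 p.2.1 p.1 p.2.2) x hx (j, i, k)
      · intro i
        exact wInit_comp (wt3 a a b) (wt2 a b) (fun p => (i, p.1, p.2)) (a i)
          (fun p => by simp [wt3, wt2]; ring) (tK1 E) E (fun x hx => hx.2 i) x hx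
    have h2 := Submodule.finrank_mono this
    rw [wInit_finrank] at h2
    exact h.k1.trans h2
  · have : wInit (wt3 a b b) (tK2 E) ≤ tK2 (wInit (wt2 a b) E) := by
      intro x hx
      refine ⟨?_, ?_⟩
      · intro i j k
        exact wInit_symm (wt3 a b b) (fun p => (p.1, p.2.2, p.2.1))
          (fun p => by simp [wt3]; ring) (tK2 E) (fun x hx p => hx.1 p.1 p.2.2 p.2.1) x hx (i, k, j)
      · intro i
        exact wInit_comp (wt3 a b b) (wt2 a b) (fun p => (p.1, p.2, i)) (b i)
          (fun p => by simp [wt3, wt2]) (tK2 E) E (fun x hx => hx.2 i) x hx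
    have h2 := Submodule.finrank_mono this
    rw [wInit_finrank] at h2
    exact h.k2.trans h2

theorem good_init {T : I9 × I9 × I9 → ℂ} {E0 E1 E2 : Sp2} (a b c : I9 → ℕ) (h : Good T E0 E1 E2)
    (w : ℕ) (hw : ∀ p, wt3 a b c p ≠ w → T p = 0) :
    Good T (wInit (wt2 a b) E0) (wInit (wt2 b c) E1) (wInit (wt2 c a) E2) := by
  have key : wInit (wt3 a b c) (tL E0 E1 E2) ≤
      tL (wInit (wt2 a b) E0) (wInit (wt2 b c) E1) (wInit (wt2 c a) E2) := by
    intro x hx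
    refine ⟨?_, ?_, ?_⟩
    · intro i
      exact wInit_comp (wt3 a b c) (wt2 a b) (fun p => (p.1, p.2, i)) (c i)
        (fun p => by simp [wt3, wt2]) (tL E0 E1 E2) E0 (fun x hx => hx.1 i) x hx
    · intro i
      exact wInit_comp (wt3 a b c) (wt2 b c) (fun p => (i, p.1, p.2)) (a i)
        (fun p => by simp [wt3, wt2]; ring) (tL E0 E1 E2) E1 (fun x hx => hx.2.1 i) x hx
    · intro i
      exact wInit_comp (wt3 a b c) (wt2 c a) (fun p => (p.2, i, p.1)) (b i)
        (fun p => by simp [wt3, wt2]; ring) (tL E0 E1 E2) E2 (fun x hx => hx.2.2 i) x hx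
  refine ⟨goodOne_init a b h.g0, goodOne_init b c h.g1, goodOne_init c a h.g2, ?_, ?_⟩
  · exact key (mem_wInit_of_homog _ _ T h.hT w hw)
  · have h2 := Submodule.finrank_mono key
    rw [wInit_finrank] at h2
    exact h.hL.trans h2

/-! monomial unipotent operators -/

def mon {κ : Type*} (c : κ → ℂ) (s : κ → κ) : (κ → ℂ) →ₗ[ℂ] (κ → ℂ) where
  toFun x := fun i => x i + c i * x (s i)
  map_add' := by
    intro x y; funext i; simp; ring
  map_smul' := by
    intro r x; funext i; simp; ring

structure Op where
  c : I9 → ℂ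
  s : I9 → I9

def Op.raises (o : Op) (wt : I9 → ℕ) (d : ℕ) : Prop := ∀ i, o.c i ≠ 0 → wt (o.s i) + d = wt i

theorem mon_injective {κ : Type*} [Fintype κ] (wt : κ → ℕ) (d : ℕ) (hd : 1 ≤ d) (c : κ → ℂ)
    (s : κ → κ) (h : ∀ i, c i ≠ 0 → wt (s i) + d = wt i) : Function.Injective (mon c s) := by
  let N : (κ → ℂ) →ₗ[ℂ] (κ → ℂ) :=
    { toFun := fun x i => c i * x (s i)
      map_add' := by intro x y; funext i; simp; ring
      map_smul' := by intro r x; funext i; simp; ring }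
  apply wUnip_injective wt hd N 0 (mon c s)
  · intro x i hx
    by_cases hc : c i = 0
    · simp [N, hc]
    · simp [N, hx _ (h i hc)]
  · intro x i hx; rfl
  · intro x i; simp [N, mon]

def op2 (X Y : Op) : (I9 × I9 → ℂ) →ₗ[ℂ] (I9 × I9 → ℂ) :=
  (mon (fun p : I9 × I9 => X.c p.1) (fun p => (X.s p.1, p.2))) ∘ₗ
  (mon (fun p : I9 × I9 => Y.c p.2) (fun p => (p.1, Y.s p.2)))

def op3 (X Y Z : Op) : (I9 × I9 × I9 → ℂ) →ₗ[ℂ] (I9 × I9 × I9 → ℂ) :=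
  (mon (fun p : I9 × I9 × I9 => X.c p.1) (fun p => (X.s p.1, p.2))) ∘ₗ
  (mon (fun p : I9 × I9 × I9 => Y.c p.2.1) (fun p => (p.1, Y.s p.2.1, p.2.2))) ∘ₗ
  (mon (fun p : I9 × I9 × I9 => Z.c p.2.2) (fun p => (p.1, p.2.1, Z.s p.2.2)))

theorem op3_injective {X Y Z : Op} {a b c : I9 → ℕ} {d : ℕ} (hd : 1 ≤ d) (hX : X.raises a d)
    (hY : Y.raises b d) (hZ : Z.raises c d) : Function.Injective (op3 X Y Z) := by
  unfold op3
  refine Function.Injective.comp (g := mon _ _) ?_ (Function.Injective.comp (g := mon _ _) ?_ ?_)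
  · exact mon_injective (fun p => a p.1) d hd _ _ (fun p hp => hX _ hp)
  · exact mon_injective (fun p => b p.2.1) d hd _ _ (fun p hp => hY _ hp)
  · exact mon_injective (fun p => c p.2.2) d hd _ _ (fun p hp => hZ _ hp)

theorem slice_c (X Y Z : Op) {E : Sp2} (τ : I9 × I9 × I9 → ℂ)
    (h : ∀ c, (fun p : I9 × I9 => τ (p.1, p.2, c)) ∈ E) (c : I9) :
    (fun p : I9 × I9 => op3 X Y Z τ (p.1, p.2, c)) ∈ E.map (op2 X Y) := by
  have e : (fun p : I9 × I9 => op3 X Y Z τ (p.1, p.2, c)) =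
      op2 X Y (fun p : I9 × I9 => τ (p.1, p.2, c)) +
        Z.c c • op2 X Y (fun p : I9 × I9 => τ (p.1, p.2, Z.s c)) := by
    funext p
    simp [op3, op2, mon]; ring
  rw [e]
  exact Submodule.add_mem _ ⟨_, h _, rfl⟩ (Submodule.smul_mem _ _ ⟨_, h _, rfl⟩)

theorem slice_a (X Y Z : Op) {E : Sp2} (τ : I9 × I9 × I9 → ℂ)
    (h : ∀ a, (fun p : I9 × I9 => τ (a, p.1, p.2)) ∈ E) (a : I9) :
    (fun p : I9 × I9 => op3 X Y Z τ (a, p.1, p.2)) ∈ E.map (op2 Y Z) := by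
  have e : (fun p : I9 × I9 => op3 X Y Z τ (a, p.1, p.2)) =
      op2 Y Z (fun p : I9 × I9 => τ (a, p.1, p.2)) +
        X.c a • op2 Y Z (fun p : I9 × I9 => τ (X.s a, p.1, p.2)) := by
    funext p
    simp [op3, op2, mon]
  rw [e]
  exact Submodule.add_mem _ ⟨_, h _, rfl⟩ (Submodule.smul_mem _ _ ⟨_, h _, rfl⟩)

theorem slice_b (X Y Z : Op) {E : Sp2} (τ : I9 × I9 × I9 → ℂ)
    (h : ∀ b, (fun p : I9 × I9 => τ (p.2, b, p.1)) ∈ E) (b : I9) :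
    (fun p : I9 × I9 => op3 X Y Z τ (p.2, b, p.1)) ∈ E.map (op2 Z X) := by
  have e : (fun p : I9 × I9 => op3 X Y Z τ (p.2, b, p.1)) =
      op2 Z X (fun p : I9 × I9 => τ (p.2, b, p.1)) +
        Y.c b • op2 Z X (fun p : I9 × I9 => τ (p.2, Y.s b, p.1)) := by
    funext p
    simp [op3, op2, mon]; ring
  rw [e]
  exact Submodule.add_mem _ ⟨_, h _, rfl⟩ (Submodule.smul_mem _ _ ⟨_, h _, rfl⟩)

theorem finrank_le_of_map {V : Type*} [AddCommGroup V] [Module ℂ V] [FiniteDimensional ℂ V]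
    (f : V →ₗ[ℂ] V) (hf : Function.Injective f)
    (K K' : Submodule ℂ V) (h : ∀ x ∈ K, f x ∈ K') : Module.finrank ℂ K ≤ Module.finrank ℂ K' := by
  have h1 := finrank_map_add_inf_ker f K
  rw [LinearMap.ker_eq_bot.2 hf, inf_bot_eq, finrank_bot] at h1
  have h2 : K.map f ≤ K' := by
    rintro y ⟨x, hx, rfl⟩
    exact h x hx
  have := Submodule.finrank_mono h2
  omega

theorem goodOne_map {E : Sp2} {X Y : Op} {a b : I9 → ℕ} {d : ℕ} (hd : 1 ≤ d) (hX : X.raises a d)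
    (hY : Y.raises b d) (h : GoodOne E) : GoodOne (E.map (op2 X Y)) := by
  refine ⟨(Submodule.finrank_map_le _ _).trans h.rk, h.k1.trans ?_, h.k2.trans ?_⟩
  · apply finrank_le_of_map (op3 X X Y) (op3_injective hd hX hX hY)
    rintro τ ⟨h1, h2⟩
    refine ⟨?_, slice_a _ _ _ τ h2⟩
    intro i j k
    simp only [op3, mon, LinearMap.comp_apply, LinearMap.coe_mk, AddHom.coe_mk]
    rw [h1 i j k, h1 (X.s i) j k, h1 i (X.s j) k, h1 (X.s i) (X.s j) k,
      h1 i j (Y.s k), h1 (X.s i) j (Y.s k), h1 i (X.s j) (Y.s k), h1 (X.s i) (X.s j) (Y.s k)]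
    ring
  · apply finrank_le_of_map (op3 X Y Y) (op3_injective hd hX hY hY)
    rintro τ ⟨h1, h2⟩
    refine ⟨?_, slice_c _ _ _ τ h2⟩
    intro i j k
    simp only [op3, mon, LinearMap.comp_apply, LinearMap.coe_mk, AddHom.coe_mk]
    rw [h1 i j k, h1 i (Y.s j) k, h1 i j (Y.s k), h1 i (Y.s j) (Y.s k),
      h1 (X.s i) j k, h1 (X.s i) (Y.s j) k, h1 (X.s i) j (Y.s k), h1 (X.s i) (Y.s j) (Y.s k)]
    ring

theorem good_map {T : I9 × I9 × I9 → ℂ} {E0 E1 E2 : Sp2} {X Y Z : Op} {a b c : I9 → ℕ} {d : ℕ}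
    (hd : 1 ≤ d) (hX : X.raises a d) (hY : Y.raises b d) (hZ : Z.raises c d)
    (hT : op3 X Y Z T = T) (h : Good T E0 E1 E2) :
    Good T (E0.map (op2 X Y)) (E1.map (op2 Y Z)) (E2.map (op2 Z X)) := by
  have key : ∀ τ ∈ tL E0 E1 E2, op3 X Y Z τ ∈
      tL (E0.map (op2 X Y)) (E1.map (op2 Y Z)) (E2.map (op2 Z X)) := by
    rintro τ ⟨h1, h2, h3⟩
    exact ⟨slice_c _ _ _ τ h1, slice_a _ _ _ τ h2, slice_b _ _ _ τ h3⟩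
  refine ⟨goodOne_map hd hX hY h.g0, goodOne_map hd hY hZ h.g1, goodOne_map hd hZ hX h.g2, ?_, ?_⟩
  · rw [← hT]; exact key T h.hT
  · exact h.hL.trans (finrank_le_of_map (op3 X Y Z) (op3_injective hd hX hY hZ) _ _ key)

/-- the infinitesimal operator -/
def opN (X Y : Op) : (I9 × I9 → ℂ) →ₗ[ℂ] (I9 × I9 → ℂ) where
  toFun x := fun p => X.c p.1 * x (X.s p.1, p.2) + Y.c p.2 * x (p.1, Y.s p.2)
  map_add' := by intro x y; funext i; simp; ring
  map_smul' := by intro r x; funext i; simp; ring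

def opN2 (X Y : Op) : (I9 × I9 → ℂ) →ₗ[ℂ] (I9 × I9 → ℂ) where
  toFun x := fun p => X.c p.1 * Y.c p.2 * x (X.s p.1, Y.s p.2)
  map_add' := by intro x y; funext i; simp; ring
  map_smul' := by intro r x; funext i; simp; ring

theorem opN_raises {X Y : Op} {a b : I9 → ℕ} {d : ℕ} (hX : X.raises a d)
    (hY : Y.raises b d) : wRaises (wt2 a b) d (opN X Y) := by
  intro x p hp
  have h1 : X.c p.1 * x (X.s p.1, p.2) = 0 := by
    by_cases hc : X.c p.1 = 0
    · simp [hc]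
    · rw [hp _ (by have := hX _ hc; simp only [wt2]; omega), mul_zero]
  have h2 : Y.c p.2 * x (p.1, Y.s p.2) = 0 := by
    by_cases hc : Y.c p.2 = 0
    · simp [hc]
    · rw [hp _ (by have := hY _ hc; simp only [wt2]; omega), mul_zero]
  simp [opN, h1, h2]

theorem opN2_raises {X Y : Op} {a b : I9 → ℕ} {d : ℕ} (hX : X.raises a d)
    (hY : Y.raises b d) : wRaises (wt2 a b) (2 * d) (opN2 X Y) := by
  intro x p hp
  show X.c p.1 * Y.c p.2 * x (X.s p.1, Y.s p.2) = 0
  by_cases hc : X.c p.1 = 0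
  · simp [hc]
  by_cases hc' : Y.c p.2 = 0
  · simp [hc']
  rw [hp _ (by have := hX _ hc; have := hY _ hc'; simp only [wt2]; omega), mul_zero]

theorem op2_eq (X Y : Op) (x : I9 × I9 → ℂ) (p : I9 × I9) :
    op2 X Y x p = x p + opN X Y x p + opN2 X Y x p := by
  simp [op2, mon, opN, opN2]; ring

def wPhi (wt : I9 × I9 → ℕ) (E : Sp2) : ℕ :=
  ∑ w ∈ Finset.range (Finset.univ.sup wt + 1),
    Module.finrank ℂ (E ⊓ wF wt w : Sp2)

theorem wPhi_init (wt : I9 × I9 → ℕ) (E : Sp2) : wPhi wt (wInit wt E) = wPhi wt E := by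
  unfold wPhi
  exact Finset.sum_congr rfl (fun w _ => wInit_finrank_inf wt E w)

section

theorem wPhi_map_le {X Y : Op} {a b : I9 → ℕ} {d : ℕ} (hd : 1 ≤ d) (hX : X.raises a d)
    (hY : Y.raises b d) {E : Sp2} (hE : wGraded (wt2 a b) E)
    : wPhi (wt2 a b) (E.map (op2 X Y)) ≤ wPhi (wt2 a b) E := by
  unfold wPhi
  exact Finset.sum_le_sum (fun w _ => finrank_unip_le (wt2 a b) hd (opN X Y) (opN2 X Y) (op2 X Y)
    (opN_raises hX hY) (opN2_raises hX hY) (op2_eq X Y) hE w)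

theorem stable_of_wPhi {X Y : Op} {a b : I9 → ℕ} {d : ℕ} (hd : 1 ≤ d) (hX : X.raises a d)
    (hY : Y.raises b d) {E : Sp2} (hE : wGraded (wt2 a b) E)
    (h : wPhi (wt2 a b) E ≤ wPhi (wt2 a b) (E.map (op2 X Y))) :
    ∀ x ∈ E, opN X Y x ∈ E := by
  have hle := fun w => finrank_unip_le (wt2 a b) hd (opN X Y) (opN2 X Y) (op2 X Y)
    (opN_raises hX hY) (opN2_raises hX hY) (op2_eq X Y) hE w
  apply unip_stable (wt2 a b) hd (opN X Y) (opN2 X Y) (op2 X Y)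
    (opN_raises hX hY) (opN2_raises hX hY) (op2_eq X Y) hE
  intro w
  by_cases hw : w < Finset.univ.sup (wt2 a b) + 1
  · by_contra hlt
    push Not at hlt
    have : wPhi (wt2 a b) (E.map (op2 X Y)) < wPhi (wt2 a b) E := by
      unfold wPhi
      exact Finset.sum_lt_sum (fun w _ => hle w) ⟨w, Finset.mem_range.2 hw, hlt⟩
    omega
  · have ht : wF (wt2 a b) w = ⊤ := by
      apply wF_top
      intro i
      have := Finset.le_sup (f := wt2 a b) (Finset.mem_univ i)
      omega
    rw [ht, inf_top_eq, inf_top_eq]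
    have h1 := finrank_map_add_inf_ker (op2 X Y) E
    rw [LinearMap.ker_eq_bot.2 (wUnip_injective (wt2 a b) hd (opN X Y) (opN2 X Y) (op2 X Y)
      (opN_raises hX hY) (opN2_raises hX hY) (op2_eq X Y)), inf_bot_eq, finrank_bot] at h1
    omega

end

/-! ### Part 4: Borel-stable triples -/

def T333 : I9 × I9 × I9 → ℂ := fun p => matMulTensor 3 3 3 p.1 p.2.1 p.2.2

def vw : Fin 3 → ℕ := ![4, 3, 0]
def dw : Fin 3 → ℕ := ![0, 1, 4]
def wtS (su sv : ℕ) : I9 → ℕ := fun x => su * dw x.1 + sv * vw x.2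

def opV (p q : Fin 3) : Op := ⟨fun x => if x.2 = p then 1 else 0, fun x => (x.1, q)⟩
def opD (p q : Fin 3) : Op := ⟨fun x => if x.1 = q then -1 else 0, fun x => (p, x.2)⟩
def opI : Op := ⟨fun _ => 0, fun x => x⟩

theorem opI_raises (wt : I9 → ℕ) (d : ℕ) : opI.raises wt d := by
  intro i hi; simp [opI] at hi

theorem opV_raises {p q : Fin 3} {δ : ℕ} (h : vw q + δ = vw p) (su sv : ℕ) :
    (opV p q).raises (wtS su sv) (sv * δ) := by
  intro i hi
  have : i.2 = p := by
    by_contra h'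
    simp [opV, h'] at hi
  simp only [wtS, opV, this, ← h]
  ring

theorem opD_raises {p q : Fin 3} {δ : ℕ} (h : dw p + δ = dw q) (su sv : ℕ) :
    (opD p q).raises (wtS su sv) (su * δ) := by
  intro i hi
  have : i.1 = q := by
    by_contra h'
    simp [opD, h'] at hi
  simp only [wtS, opD, this, ← h]
  ring

theorem T333_inv1 {p q : Fin 3} (h : p ≠ q) : op3 (opV p q) (opD p q) opI T333 = T333 := by
  funext ⟨⟨i, j⟩, ⟨l, k⟩, ⟨k', i'⟩⟩
  simp only [op3, mon, opV, opD, opI, T333, matMulTensor, LinearMap.comp_apply, LinearMap.coe_mk,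
    AddHom.coe_mk]
  by_cases h1 : j = p <;> by_cases h2 : l = q <;> subst_vars <;>
    simp_all [eq_comm] <;> split_ifs <;> simp

theorem T333_inv2 {p q : Fin 3} (h : p ≠ q) : op3 (opD p q) opI (opV p q) T333 = T333 := by
  funext ⟨⟨i, j⟩, ⟨l, k⟩, ⟨k', i'⟩⟩
  simp only [op3, mon, opV, opD, opI, T333, matMulTensor, LinearMap.comp_apply, LinearMap.coe_mk,
    AddHom.coe_mk]
  by_cases h1 : i' = p <;> by_cases h2 : i = q <;> subst_vars <;>
    simp_all [eq_comm] <;> split_ifs <;> simp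

theorem T333_inv3 {p q : Fin 3} (h : p ≠ q) : op3 opI (opV p q) (opD p q) T333 = T333 := by
  funext ⟨⟨i, j⟩, ⟨l, k⟩, ⟨k', i'⟩⟩
  simp only [op3, mon, opV, opD, opI, T333, matMulTensor, LinearMap.comp_apply, LinearMap.coe_mk,
    AddHom.coe_mk]
  by_cases h1 : k = p <;> by_cases h2 : k' = q <;> subst_vars <;>
    simp_all [eq_comm] <;> split_ifs <;> simp

/-- Borel stability -/
def BStable (E : Sp2) : Prop := ∀ p q : Fin 3, (p = 0 ∧ q = 1 ∨ p = 1 ∧ q = 2) → ∀ x ∈ E,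
  opN (opD p q) opI x ∈ E ∧ opN (opV p q) (opD p q) x ∈ E ∧ opN opI (opV p q) x ∈ E

theorem T333_homog : ∀ p, wt3 (wtS 81 1) (wtS 1 9) (wtS 9 81) p ≠ 364 → T333 p = 0 := by
  rintro ⟨⟨i, j⟩, ⟨l, k⟩, ⟨k', i'⟩⟩ h
  simp only [T333, matMulTensor]
  rw [if_neg]
  rintro ⟨h1, h2, h3⟩
  subst h1 h2 h3
  apply h
  have key : ∀ m : Fin 3, vw m + dw m = 4 := by decide
  have a := key i'
  have b := key j
  have c := key k
  simp only [wt3, wtS]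
  omega

theorem stable_step {E0 E1 E2 : Sp2} {X Y Z : Op} {a b c : I9 → ℕ} {d : ℕ}
    (hd : 1 ≤ d) (hX : X.raises a d) (hY : Y.raises b d) (hZ : Z.raises c d)
    (hT : op3 X Y Z T333 = T333) (h : Good T333 E0 E1 E2)
    (h0 : wGraded (wt2 a b) E0) (h1 : wGraded (wt2 b c) E1) (h2 : wGraded (wt2 c a) E2)
    (hmin : ∀ F0 F1 F2, Good T333 F0 F1 F2 →
      wPhi (wt2 a b) E0 + wPhi (wt2 b c) E1 + wPhi (wt2 c a) E2 ≤
      wPhi (wt2 a b) F0 + wPhi (wt2 b c) F1 + wPhi (wt2 c a) F2) :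
    (∀ x ∈ E0, opN X Y x ∈ E0) ∧ (∀ x ∈ E1, opN Y Z x ∈ E1) ∧ (∀ x ∈ E2, opN Z X x ∈ E2) := by
  have hg := hmin _ _ _ (good_map hd hX hY hZ hT h)
  have l0 := wPhi_map_le hd hX hY h0
  have l1 := wPhi_map_le hd hY hZ h1
  have l2 := wPhi_map_le hd hZ hX h2
  exact ⟨stable_of_wPhi hd hX hY h0 (by omega), stable_of_wPhi hd hY hZ h1 (by omega),
    stable_of_wPhi hd hZ hX h2 (by omega)⟩

theorem borel_exists {F0 F1 F2 : Sp2} (h : Good T333 F0 F1 F2) :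
    ∃ E0 E1 E2 : Sp2, Good T333 E0 E1 E2 ∧
      wGraded (wt2 (wtS 81 1) (wtS 1 9)) E0 ∧ wGraded (wt2 (wtS 1 9) (wtS 9 81)) E1 ∧
      wGraded (wt2 (wtS 9 81) (wtS 81 1)) E2 ∧ BStable E0 ∧ BStable E1 ∧ BStable E2 := by
  classical
  let Φ : Sp2 × Sp2 × Sp2 → ℕ := fun F => wPhi (wt2 (wtS 81 1) (wtS 1 9)) F.1 +
    wPhi (wt2 (wtS 1 9) (wtS 9 81)) F.2.1 + wPhi (wt2 (wtS 9 81) (wtS 81 1)) F.2.2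
  let S : Set ℕ := {n | ∃ F : Sp2 × Sp2 × Sp2, Good T333 F.1 F.2.1 F.2.2 ∧ Φ F = n}
  have hS : S.Nonempty := ⟨_, (F0, F1, F2), h, rfl⟩
  obtain ⟨⟨G0, G1, G2⟩, hG, hΦ⟩ := Nat.sInf_mem hS
  have hmin0 : ∀ F : Sp2 × Sp2 × Sp2, Good T333 F.1 F.2.1 F.2.2 → Φ (G0, G1, G2) ≤ Φ F := by
    intro F hF
    rw [hΦ]
    exact Nat.sInf_le ⟨F, hF, rfl⟩
  refine ⟨_, _, _, good_init (wtS 81 1) (wtS 1 9) (wtS 9 81) hG 364 T333_homog,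
    wInit_graded _ _, wInit_graded _ _, wInit_graded _ _, ?_⟩
  have hgood := good_init (wtS 81 1) (wtS 1 9) (wtS 9 81) hG 364 T333_homog
  have g0 := wInit_graded (wt2 (wtS 81 1) (wtS 1 9)) G0
  have g1 := wInit_graded (wt2 (wtS 1 9) (wtS 9 81)) G1
  have g2 := wInit_graded (wt2 (wtS 9 81) (wtS 81 1)) G2
  have e0 := wPhi_init (wt2 (wtS 81 1) (wtS 1 9)) G0
  have e1 := wPhi_init (wt2 (wtS 1 9) (wtS 9 81)) G1
  have e2 := wPhi_init (wt2 (wtS 9 81) (wtS 81 1)) G2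
  generalize wInit (wt2 (wtS 81 1) (wtS 1 9)) G0 = E0 at *
  generalize wInit (wt2 (wtS 1 9) (wtS 9 81)) G1 = E1 at *
  generalize wInit (wt2 (wtS 9 81) (wtS 81 1)) G2 = E2 at *
  have hmin : ∀ F0 F1 F2, Good T333 F0 F1 F2 →
      wPhi (wt2 (wtS 81 1) (wtS 1 9)) E0 + wPhi (wt2 (wtS 1 9) (wtS 9 81)) E1 +
        wPhi (wt2 (wtS 9 81) (wtS 81 1)) E2 ≤
      wPhi (wt2 (wtS 81 1) (wtS 1 9)) F0 + wPhi (wt2 (wtS 1 9) (wtS 9 81)) F1 +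
        wPhi (wt2 (wtS 9 81) (wtS 81 1)) F2 := by
    intro F0 F1 F2 hF
    rw [e0, e1, e2]
    exact hmin0 (F0, F1, F2) hF
  have key : ∀ p q : Fin 3, (p = 0 ∧ q = 1 ∨ p = 1 ∧ q = 2) →
      p ≠ q ∧ ∃ δ, 1 ≤ δ ∧ vw q + δ = vw p ∧ dw p + δ = dw q := by
    rintro p q (⟨rfl, rfl⟩ | ⟨rfl, rfl⟩)
    · exact ⟨by decide, 1, by decide, by decide, by decide⟩
    · exact ⟨by decide, 3, by decide, by decide, by decide⟩
  have main : ∀ p q : Fin 3, (p = 0 ∧ q = 1 ∨ p = 1 ∧ q = 2) →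
      ((∀ x ∈ E0, opN (opV p q) (opD p q) x ∈ E0) ∧ (∀ x ∈ E1, opN (opD p q) opI x ∈ E1) ∧
        (∀ x ∈ E2, opN opI (opV p q) x ∈ E2)) ∧
      ((∀ x ∈ E0, opN (opD p q) opI x ∈ E0) ∧ (∀ x ∈ E1, opN opI (opV p q) x ∈ E1) ∧
        (∀ x ∈ E2, opN (opV p q) (opD p q) x ∈ E2)) ∧
      ((∀ x ∈ E0, opN opI (opV p q) x ∈ E0) ∧ (∀ x ∈ E1, opN (opV p q) (opD p q) x ∈ E1) ∧
        (∀ x ∈ E2, opN (opD p q) opI x ∈ E2)) := by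
    intro p q hpq
    obtain ⟨hne, δ, hδ, hv, hd⟩ := key p q hpq
    refine ⟨?_, ?_, ?_⟩
    · exact stable_step (d := 1 * δ) (by omega) (opV_raises hv 81 1) (opD_raises hd 1 9)
        (opI_raises _ _) (T333_inv1 hne) hgood g0 g1 g2 hmin
    · exact stable_step (d := 81 * δ) (by omega) (opD_raises hd 81 1) (opI_raises _ _)
        (opV_raises hv 9 81) (T333_inv2 hne) hgood g0 g1 g2 hmin
    · exact stable_step (d := 9 * δ) (by omega) (opI_raises _ _) (opV_raises hv 1 9)
        (opD_raises hd 9 81) (T333_inv3 hne) hgood g0 g1 g2 hmin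
  refine ⟨?_, ?_, ?_⟩
  · intro p q hpq x hx
    obtain ⟨a, b, c⟩ := main p q hpq
    exact ⟨b.1 x hx, a.1 x hx, c.1 x hx⟩
  · intro p q hpq x hx
    obtain ⟨a, b, c⟩ := main p q hpq
    exact ⟨a.2.1 x hx, c.2.1 x hx, b.2.1 x hx⟩
  · intro p q hpq x hx
    obtain ⟨a, b, c⟩ := main p q hpq
    exact ⟨c.2.2 x hx, b.2.2 x hx, a.2.2 x hx⟩

/-! ### Part 5: limits of good triples -/

section Lim
open Filter Topology
variable {α : Type*} {κ : Type*} [Fintype κ]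

def uLim (U : Ultrafilter α) (E : α → Submodule ℂ (κ → ℂ)) : Submodule ℂ (κ → ℂ) where
  carrier := {x | ∃ y : α → κ → ℂ, (∀ᶠ s in (U : Filter α), y s ∈ E s) ∧
    Tendsto y (U : Filter α) (𝓝 x)}
  add_mem' := by
    rintro x x' ⟨y, h1, h2⟩ ⟨y', h1', h2'⟩
    refine ⟨fun s => y s + y' s, ?_, h2.add h2'⟩
    filter_upwards [h1, h1'] with s a b
    exact (E s).add_mem a b
  zero_mem' := ⟨fun _ => 0, Eventually.of_forall (fun s => (E s).zero_mem), tendsto_const_nhds⟩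
  smul_mem' := by
    rintro c x ⟨y, h1, h2⟩
    refine ⟨fun s => c • y s, ?_, h2.const_smul c⟩
    filter_upwards [h1] with s a
    exact (E s).smul_mem c a

theorem finrank_uLim_le (U : Ultrafilter α) (E : α → Submodule ℂ (κ → ℂ)) (n : ℕ)
    (h : ∀ᶠ s in (U : Filter α), Module.finrank ℂ (E s) ≤ n) :
    Module.finrank ℂ (uLim U E) ≤ n := by
  by_contra hlt
  push Not at hlt
  let b := Module.finBasis ℂ (uLim U E)
  let x : Fin (Module.finrank ℂ (uLim U E)) → (κ → ℂ) := fun i => (b i).1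
  have hx : LinearIndependent ℂ x :=
    b.linearIndependent.map' (Submodule.subtype _) (Submodule.ker_subtype _)
  have hm : ∀ i, ∃ y : α → κ → ℂ, (∀ᶠ s in (U : Filter α), y s ∈ E s) ∧
    Tendsto y (U : Filter α) (𝓝 (x i)) := fun i => (b i).2
  choose y hy hyt using hm
  have ht : Tendsto (fun s i => y i s) (U : Filter α) (𝓝 x) := tendsto_pi_nhds.2 hyt
  have ho := isOpen_setOfPred_linearIndependent (𝕜 := ℂ) (E := κ → ℂ)
    (ι := Fin (Module.finrank ℂ (uLim U E)))
  have hev := ht.eventually (ho.mem_nhds hx)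
  have hall : ∀ᶠ s in (U : Filter α), ∀ i, y i s ∈ E s := eventually_all.2 hy
  obtain ⟨s, h1, h2, h3⟩ := (hev.and (hall.and h)).exists
  have h1' : LinearIndependent ℂ (fun i => y i s) := h1
  have h4 : LinearIndependent ℂ (fun i => (⟨y i s, h2 i⟩ : E s)) := by
    apply LinearIndependent.of_comp (Submodule.subtype (E s))
    exact h1'
  have h5 := h4.fintype_card_le_finrank
  simp only [Fintype.card_fin] at h5
  omega

theorem exists_orthonormal (K : Submodule ℂ (κ → ℂ)) (n : ℕ) (h : n ≤ Module.finrank ℂ K) :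
    ∃ e : Fin n → κ → ℂ, (∀ i, e i ∈ K) ∧
      ∀ i j, ∑ p, (starRingEnd ℂ) (e i p) * e j p = if i = j then 1 else 0 := by
  classical
  let ψ := (WithLp.linearEquiv 2 ℂ (κ → ℂ)).symm
  let K' : Submodule ℂ (EuclideanSpace ℂ κ) := K.map (ψ : (κ → ℂ) →ₗ[ℂ] EuclideanSpace ℂ κ)
  have hr : Module.finrank ℂ K' = Module.finrank ℂ K := LinearEquiv.finrank_map_eq ψ K
  let b := stdOrthonormalBasis ℂ K'
  have hn : n ≤ Module.finrank ℂ K' := by omega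
  refine ⟨fun i p => (b (Fin.castLE hn i)).1 p, ?_, ?_⟩
  · intro i
    obtain ⟨x, hx, hxe⟩ := (b (Fin.castLE hn i)).2
    have : (fun p => (b (Fin.castLE hn i)).1 p) = x := by
      rw [← hxe]; rfl
    show (fun p => (b (Fin.castLE hn i)).1 p) ∈ K
    rw [this]; exact hx
  · intro i j
    have h1 := (orthonormal_iff_ite.1 b.orthonormal) (Fin.castLE hn i) (Fin.castLE hn j)
    rw [Submodule.coe_inner, PiLp.inner_apply] at h1
    have h2 : (Fin.castLE hn i = Fin.castLE hn j) ↔ i = j := by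
      simp [Fin.ext_iff]
    simp only [h2] at h1
    rw [← h1]
    apply Finset.sum_congr rfl
    intro p _
    simp [mul_comm]

theorem le_finrank_lim (U : Ultrafilter α) (K : α → Submodule ℂ (κ → ℂ))
    (K' : Submodule ℂ (κ → ℂ)) (n : ℕ)
    (hlim : ∀ (y : α → κ → ℂ) x, (∀ᶠ s in (U : Filter α), y s ∈ K s) →
      Tendsto y (U : Filter α) (𝓝 x) → x ∈ K')
    (h : ∀ᶠ s in (U : Filter α), n ≤ Module.finrank ℂ (K s)) : n ≤ Module.finrank ℂ K' := by
  classical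
  have hex : ∀ s, ∃ e : Fin n → κ → ℂ, n ≤ Module.finrank ℂ (K s) → ((∀ i, e i ∈ K s) ∧
      ∀ i j, ∑ p, (starRingEnd ℂ) (e i p) * e j p = if i = j then 1 else 0) := by
    intro s
    by_cases hs : n ≤ Module.finrank ℂ (K s)
    · obtain ⟨e, he⟩ := exists_orthonormal (K s) n hs
      exact ⟨e, fun _ => he⟩
    · exact ⟨0, fun h => absurd h hs⟩
  choose e he using hex
  have hb : ∀ᶠ s in (U : Filter α), e s ∈ Metric.closedBall (0 : Fin n → κ → ℂ) 1 := by
    filter_upwards [h] with s hs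
    rw [mem_closedBall_zero_iff, pi_norm_le_iff_of_nonneg zero_le_one]
    intro i
    rw [pi_norm_le_iff_of_nonneg zero_le_one]
    intro p
    have h1 := (he s hs).2 i i
    rw [if_pos rfl] at h1
    have h2 : ∑ p, ‖e s i p‖ ^ 2 = 1 := by
      have h3 : ∀ p, (starRingEnd ℂ) (e s i p) * e s i p = ((‖e s i p‖ ^ 2 : ℝ) : ℂ) := by
        intro p
        rw [← Complex.normSq_eq_conj_mul_self, Complex.normSq_eq_norm_sq]
      rw [Finset.sum_congr rfl (fun p _ => h3 p)] at h1
      exact_mod_cast h1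
    have h4 : ‖e s i p‖ ^ 2 ≤ 1 := by
      rw [← h2]
      exact Finset.single_le_sum (f := fun p => ‖e s i p‖ ^ 2) (fun q _ => sq_nonneg _)
        (Finset.mem_univ p)
    nlinarith [norm_nonneg (e s i p)]
  obtain ⟨k, _, hk⟩ := (isCompact_closedBall (0 : Fin n → κ → ℂ) 1).ultrafilter_le_nhds (U.map e)
    (by rw [le_principal_iff]; exact hb)
  have hk' : Tendsto e (U : Filter α) (𝓝 k) := hk
  have hki : ∀ i, Tendsto (fun s => e s i) (U : Filter α) (𝓝 (k i)) := fun i =>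
    (tendsto_pi_nhds.1 hk') i
  have hkip : ∀ i p, Tendsto (fun s => e s i p) (U : Filter α) (𝓝 (k i p)) := fun i p =>
    (tendsto_pi_nhds.1 (hki i)) p
  have hmem : ∀ i, k i ∈ K' := by
    intro i
    refine hlim (fun s => e s i) (k i) ?_ (hki i)
    filter_upwards [h] with s hs
    exact (he s hs).1 i
  have horth : ∀ i j, ∑ p, (starRingEnd ℂ) (k i p) * k j p = if i = j then 1 else 0 := by
    intro i j
    have t1 : Tendsto (fun s => ∑ p, (starRingEnd ℂ) (e s i p) * e s j p) (U : Filter α)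
        (𝓝 (∑ p, (starRingEnd ℂ) (k i p) * k j p)) := by
      apply tendsto_finsetSum
      intro p _
      exact ((Complex.continuous_conj.tendsto _).comp (hkip i p)).mul (hkip j p)
    have t2 : Tendsto (fun s => ∑ p, (starRingEnd ℂ) (e s i p) * e s j p) (U : Filter α)
        (𝓝 (if i = j then 1 else 0)) := by
      apply tendsto_const_nhds.congr'
      filter_upwards [h] with s hs
      exact ((he s hs).2 i j).symm
    exact tendsto_nhds_unique t1 t2
  have hli : LinearIndependent ℂ (fun i => (⟨k i, hmem i⟩ : K')) := by
    rw [Fintype.linearIndependent_iff]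
    intro g hg i
    have h1 : ∀ p, ∑ j, g j * k j p = 0 := by
      intro p
      have := congrArg (fun x : K' => x.1 p) hg
      simpa using this
    have h2 : ∑ p, (starRingEnd ℂ) (k i p) * ∑ j, g j * k j p = 0 := by
      simp [h1]
    have h3 : ∑ p, (starRingEnd ℂ) (k i p) * ∑ j, g j * k j p = g i := by
      simp_rw [Finset.mul_sum]
      rw [Finset.sum_comm]
      have : ∀ j, ∑ p, (starRingEnd ℂ) (k i p) * (g j * k j p) = g j * (if i = j then 1 else 0) := by
        intro j
        rw [← horth i j, Finset.mul_sum]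
        apply Finset.sum_congr rfl
        intro p _
        ring
      rw [Finset.sum_congr rfl (fun j _ => this j)]
      simp
    rw [← h3, h2]
  simpa using hli.fintype_card_le_finrank

def unc (S : I9 → I9 → I9 → ℂ) : I9 × I9 × I9 → ℂ := fun p => S p.1 p.2.1 p.2.2

theorem tendsto_pull {κ' : Type*} {U : Filter α} {y : α → κ → ℂ} {x : κ → ℂ}
    (h : Tendsto y U (𝓝 x)) (f : κ' → κ) :
    Tendsto (fun s p => y s (f p)) U (𝓝 (fun p => x (f p))) :=
  tendsto_pi_nhds.2 (fun p => (tendsto_pi_nhds.1 h) (f p))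

theorem goodOne_lim (U : Ultrafilter α) (E : α → Sp2)
    (h : ∀ᶠ s in (U : Filter α), GoodOne (E s)) : GoodOne (uLim U E) := by
  refine ⟨finrank_uLim_le U E 16 (h.mono fun s hs => hs.rk), ?_, ?_⟩
  · apply le_finrank_lim U (fun s => tK1 (E s)) _ 16 _ (h.mono fun s hs => hs.k1)
    intro y x hy hyx
    refine ⟨?_, ?_⟩
    · intro a b c
      have t1 := (tendsto_pi_nhds.1 hyx) (a, b, c)
      have t2 := (tendsto_pi_nhds.1 hyx) (b, a, c)
      exact tendsto_nhds_unique t1 (t2.congr' (hy.mono fun s hs => hs.1 b a c))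
    · intro a
      exact ⟨_, hy.mono fun s hs => hs.2 a, tendsto_pull hyx _⟩
  · apply le_finrank_lim U (fun s => tK2 (E s)) _ 16 _ (h.mono fun s hs => hs.k2)
    intro y x hy hyx
    refine ⟨?_, ?_⟩
    · intro a b c
      have t1 := (tendsto_pi_nhds.1 hyx) (a, b, c)
      have t2 := (tendsto_pi_nhds.1 hyx) (a, c, b)
      exact tendsto_nhds_unique t1 (t2.congr' (hy.mono fun s hs => hs.1 a c b))
    · intro a
      exact ⟨_, hy.mono fun s hs => hs.2 a, tendsto_pull hyx _⟩

theorem good_lim (T : I9 → I9 → I9 → ℂ)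
    (h : T ∈ closure {S : I9 → I9 → I9 → ℂ | ∃ E0 E1 E2, Good (unc S) E0 E1 E2}) :
    ∃ E0 E1 E2, Good (unc T) E0 E1 E2 := by
  rw [mem_closure_iff_ultrafilter] at h
  obtain ⟨U, hU, hUT⟩ := h
  have hex : ∀ S : I9 → I9 → I9 → ℂ, ∃ E : Sp2 × Sp2 × Sp2,
      (∃ E0 E1 E2, Good (unc S) E0 E1 E2) → Good (unc S) E.1 E.2.1 E.2.2 := by
    intro S
    by_cases hs : ∃ E0 E1 E2, Good (unc S) E0 E1 E2
    · obtain ⟨E0, E1, E2, hE⟩ := hs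
      exact ⟨(E0, E1, E2), fun _ => hE⟩
    · exact ⟨(⊥, ⊥, ⊥), fun h => absurd h hs⟩
  choose E hE using hex
  have hev : ∀ᶠ S in (U : Filter (I9 → I9 → I9 → ℂ)), Good (unc S) (E S).1 (E S).2.1 (E S).2.2 := by
    have : ∀ᶠ S in (U : Filter (I9 → I9 → I9 → ℂ)), ∃ E0 E1 E2, Good (unc S) E0 E1 E2 := hU
    exact this.mono fun S hS => hE S hS
  have key : ∀ (y : (I9 → I9 → I9 → ℂ) → (I9 × I9 × I9 → ℂ)) (x : I9 × I9 × I9 → ℂ),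
      (∀ᶠ s in (U : Filter (I9 → I9 → I9 → ℂ)), y s ∈ tL (E s).1 (E s).2.1 (E s).2.2) →
      Tendsto y (U : Filter (I9 → I9 → I9 → ℂ)) (𝓝 x) →
      x ∈ tL (uLim U fun s => (E s).1) (uLim U fun s => (E s).2.1) (uLim U fun s => (E s).2.2) := by
    intro y x hy hyx
    exact ⟨fun c => ⟨_, hy.mono fun s hs => hs.1 c, tendsto_pull hyx _⟩,
      fun c => ⟨_, hy.mono fun s hs => hs.2.1 c, tendsto_pull hyx _⟩,
      fun c => ⟨_, hy.mono fun s hs => hs.2.2 c, tendsto_pull hyx _⟩⟩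
  refine ⟨uLim U fun s => (E s).1, uLim U fun s => (E s).2.1, uLim U fun s => (E s).2.2,
    goodOne_lim U _ (hev.mono fun s hs => hs.g0), goodOne_lim U _ (hev.mono fun s hs => hs.g1),
    goodOne_lim U _ (hev.mono fun s hs => hs.g2), ?_, ?_⟩
  · refine key unc (unc T) (hev.mono fun s hs => hs.hT) ?_
    have hc : Continuous unc := by unfold unc; fun_prop
    exact (hc.tendsto T).mono_left hUT
  · exact le_finrank_lim U _ _ 16 key (hev.mono fun s hs => hs.hL)
end Lim

/-! ### Part 6: rank-16 tensors are limits of tensors with good triples -/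

/-- the pair products are linearly independent -/
def PIndep (u v : Fin 16 → I9 → ℂ) : Prop :=
  ∀ c : Fin 16 → ℂ, (∀ a b, ∑ l, c l * (u l a * v l b) = 0) → ∀ l, c l = 0

theorem PIndep.ne_left {u v : Fin 16 → I9 → ℂ} (h : PIndep u v) (l : Fin 16) : ∃ a, u l a ≠ 0 := by
  by_contra hc
  push Not at hc
  have := h (fun m => if m = l then 1 else 0) (by intro a b; simp [hc]) l
  simp at this

theorem PIndep.ne_right {u v : Fin 16 → I9 → ℂ} (h : PIndep u v) (l : Fin 16) : ∃ a, v l a ≠ 0 := by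
  by_contra hc
  push Not at hc
  have := h (fun m => if m = l then 1 else 0) (by intro a b; simp [hc]) l
  simp at this

def spanPair (u v : Fin 16 → I9 → ℂ) : Sp2 :=
  Submodule.span ℂ (Set.range fun l => fun p : I9 × I9 => u l p.1 * v l p.2)

theorem spanPair_mem (u v : Fin 16 → I9 → ℂ) (c : Fin 16 → ℂ) (x : I9 × I9 → ℂ)
    (hx : ∀ p, x p = ∑ l, c l * (u l p.1 * v l p.2)) : x ∈ spanPair u v := by
  have : x = ∑ l, c l • (fun p : I9 × I9 => u l p.1 * v l p.2) := by
    funext p; simp [hx p]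
  rw [this]
  exact Submodule.sum_mem _ fun l _ => Submodule.smul_mem _ _ (Submodule.subset_span ⟨l, rfl⟩)

theorem sixteen_le {K : Sp3} (f : Fin 16 → I9 × I9 × I9 → ℂ) (hf : ∀ l, f l ∈ K)
    (h : ∀ c : Fin 16 → ℂ, (∀ p, ∑ l, c l * f l p = 0) → ∀ l, c l = 0) :
    16 ≤ Module.finrank ℂ K := by
  have hli : LinearIndependent ℂ (fun l => (⟨f l, hf l⟩ : K)) := by
    rw [Fintype.linearIndependent_iff]
    intro g hg
    apply h
    intro p
    have := congrArg (fun x : K => x.1 p) hg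
    simpa using this
  simpa using hli.fintype_card_le_finrank

theorem goodOne_span {u v : Fin 16 → I9 → ℂ} (h : PIndep u v) : GoodOne (spanPair u v) := by
  refine ⟨?_, ?_, ?_⟩
  · have := finrank_range_le_card (R := ℂ) (fun l => fun p : I9 × I9 => u l p.1 * v l p.2)
    rw [Fintype.card_fin] at this
    exact this
  · apply sixteen_le (fun l p => u l p.1 * (u l p.2.1 * v l p.2.2))
    · intro l
      refine ⟨fun a b c => by ring, fun a => ?_⟩
      exact Submodule.smul_mem _ (u l a) (Submodule.subset_span ⟨l, rfl⟩)
    · intro c hc l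
      obtain ⟨a, ha⟩ := h.ne_left l
      have := h (fun l => c l * u l a) (fun i j => by
        rw [← hc (a, i, j)]; exact Finset.sum_congr rfl fun l _ => by ring) l
      simpa [ha] using this
  · apply sixteen_le (fun l p => v l p.2.2 * (u l p.1 * v l p.2.1))
    · intro l
      refine ⟨fun a b c => by ring, fun a => ?_⟩
      exact Submodule.smul_mem _ (v l a) (Submodule.subset_span ⟨l, rfl⟩)
    · intro c hc l
      obtain ⟨a, ha⟩ := h.ne_right l
      have := h (fun l => c l * v l a) (fun i j => by
        rw [← hc (i, j, a)]; exact Finset.sum_congr rfl fun l _ => by ring) l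
      simpa [ha] using this

theorem good_span {u v w : Fin 16 → I9 → ℂ} (h0 : PIndep u v) (h1 : PIndep v w) (h2 : PIndep w u) :
    Good (unc (fun i j k => ∑ l, u l i * v l j * w l k)) (spanPair u v) (spanPair v w)
      (spanPair w u) := by
  refine ⟨goodOne_span h0, goodOne_span h1, goodOne_span h2, ⟨?_, ?_, ?_⟩, ?_⟩
  · intro c
    exact spanPair_mem _ _ (fun l => w l c) _ fun p => Finset.sum_congr rfl fun l _ => by ring
  · intro c
    exact spanPair_mem _ _ (fun l => u l c) _ fun p => Finset.sum_congr rfl fun l _ => by ring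
  · intro c
    exact spanPair_mem _ _ (fun l => v l c) _ fun p => Finset.sum_congr rfl fun l _ => by ring
  · apply sixteen_le (fun l p => w l p.2.2 * (u l p.1 * v l p.2.1))
    · intro l
      refine ⟨fun c => ?_, fun c => ?_, fun c => ?_⟩
      · exact Submodule.smul_mem _ (w l c) (Submodule.subset_span ⟨l, rfl⟩)
      · have e : (fun p : I9 × I9 => w l p.2 * (u l c * v l p.1)) =
          u l c • (fun p : I9 × I9 => v l p.1 * w l p.2) := by
          funext p; simp; ring
        exact e ▸ Submodule.smul_mem _ (u l c) (Submodule.subset_span ⟨l, rfl⟩)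
      · have e : (fun p : I9 × I9 => w l p.1 * (u l p.2 * v l c)) =
          v l c • (fun p : I9 × I9 => w l p.1 * u l p.2) := by
          funext p; simp; ring
        exact e ▸ Submodule.smul_mem _ (v l c) (Submodule.subset_span ⟨l, rfl⟩)
    · intro c hc l
      obtain ⟨a, ha⟩ := h1.ne_right l
      have := h0 (fun l => c l * w l a) (fun i j => by
        rw [← hc (i, j, a)]; exact Finset.sum_congr rfl fun l _ => by ring) l
      simpa [ha] using this

/-- generic pairs of perturbations are independent -/
theorem pindep_generic (u v : Fin 16 → I9 → ℂ) (a b : Fin 16 → I9)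
    (hab : ∀ l m, a l = a m → b l = b m → l = m) :
    {ε : ℂ | ¬ PIndep (fun l x => ε * u l x + if a l = x then 1 else 0)
      (fun l x => ε * v l x + if b l = x then 1 else 0)}.Finite := by
  classical
  open Polynomial in
  let M : Matrix (Fin 16) (Fin 16) ℂ[X] := fun l m =>
    (X * C (u l (a m)) + if a l = a m then 1 else 0) * (X * C (v l (b m)) + if b l = b m then 1 else 0)
  have hev : ∀ ε : ℂ, M.det.eval ε = Matrix.det (fun l m =>
      (ε * u l (a m) + if a l = a m then 1 else 0) * (ε * v l (b m) + if b l = b m then 1 else 0)) := by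
    intro ε
    have h1 : M.det.eval ε = (Polynomial.evalRingHom ε) M.det := rfl
    rw [h1, RingHom.map_det]
    congr 1
    ext l m
    show Polynomial.evalRingHom ε (M l m) = _
    show Polynomial.evalRingHom ε ((Polynomial.X * Polynomial.C (u l (a m)) +
      if a l = a m then 1 else 0) * (Polynomial.X * Polynomial.C (v l (b m)) +
      if b l = b m then 1 else 0)) = _
    simp only [Polynomial.coe_evalRingHom, Polynomial.eval_mul, Polynomial.eval_add,
      Polynomial.eval_X, Polynomial.eval_C]
    congr 2 <;> split_ifs <;> simp
  have hne : M.det ≠ 0 := by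
    intro h0
    have h1 := hev 0
    rw [h0, Polynomial.eval_zero] at h1
    have h2 : (fun l m => ((0:ℂ) * u l (a m) + if a l = a m then 1 else 0) *
        (0 * v l (b m) + if b l = b m then 1 else 0)) = (1 : Matrix (Fin 16) (Fin 16) ℂ) := by
      ext l m
      by_cases hlm : l = m
      · subst hlm; simp
      · rw [Matrix.one_apply_ne hlm]
        by_cases ha : a l = a m
        · have hb : b l ≠ b m := fun hb => hlm (hab l m ha hb)
          simp [hb]
        · simp [ha]
    rw [h2, Matrix.det_one] at h1
    exact zero_ne_one h1
  apply (Polynomial.finite_setOfPred_isRoot hne).subset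
  intro ε hε
  by_contra hroot
  apply hε
  intro c hc
  have hdet : Matrix.det (fun l m =>
      (ε * u l (a m) + if a l = a m then 1 else 0) *
        (ε * v l (b m) + if b l = b m then 1 else 0)) ≠ 0 := by
    rw [← hev]; exact hroot
  have hv := Matrix.eq_zero_of_vecMul_eq_zero hdet (v := c) (by
    funext m
    simp only [Matrix.vecMul, dotProduct, Pi.zero_apply]
    exact hc (a m) (b m))
  exact fun l => congrFun hv l

theorem PIndep.scale {u v : Fin 16 → I9 → ℂ} (h : PIndep u v) {δ : ℂ} (hδ : δ ≠ 0) :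
    PIndep (fun l x => δ * u l x) (fun l x => δ * v l x) := by
  intro c hc l
  have := h (fun l => c l * δ ^ 2) (fun a b => by
    rw [← hc a b]; exact Finset.sum_congr rfl fun l _ => by ring) l
  simpa [hδ] using this

def pa (l : Fin 16) : I9 := (Fin.ofNat 3 (l.1 / 4 / 3), Fin.ofNat 3 (l.1 / 4 % 3))
def pb (l : Fin 16) : I9 := (Fin.ofNat 3 (l.1 % 4 / 3), Fin.ofNat 3 (l.1 % 4 % 3))
def pc (l : Fin 16) : I9 :=
  (Fin.ofNat 3 ((l.1 / 4 + l.1) % 4 / 3), Fin.ofNat 3 ((l.1 / 4 + l.1) % 4 % 3))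

theorem rank16_good (S : I9 → I9 → I9 → ℂ) (hS : rankLE S 16) :
    S ∈ closure {S : I9 → I9 → I9 → ℂ | ∃ E0 E1 E2, Good (unc S) E0 E1 E2} := by
  obtain ⟨u, v, w, rfl⟩ := hS
  have f0 := pindep_generic u v pa pb (by decide)
  have f1 := pindep_generic v w pb pc (by decide)
  have f2 := pindep_generic w u pc pa (by decide)
  have hfin := (f0.union f1).union f2
  obtain ⟨B, hB⟩ := (hfin.isBounded).exists_norm_le
  let F : ℂ → I9 → I9 → I9 → ℂ := fun δ i j k => ∑ l,
    (u l i + δ * if pa l = i then 1 else 0) * (v l j + δ * if pb l = j then 1 else 0) *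
      (w l k + δ * if pc l = k then 1 else 0)
  have hF : Continuous F := by
    refine continuous_pi fun i => continuous_pi fun j => continuous_pi fun k => ?_
    fun_prop
  have hF0 : F 0 = fun i j k => ∑ l, u l i * v l j * w l k := by
    simp [F]
  rw [← hF0]
  have ht : Filter.Tendsto F (nhdsWithin 0 {0}ᶜ) (nhds (F 0)) :=
    (hF.tendsto 0).mono_left nhdsWithin_le_nhds
  apply mem_closure_of_tendsto ht
  have hinv := Filter.tendsto_inv₀_nhdsNE_zero (α := ℂ)
  have hbig : ∀ᶠ δ in nhdsWithin (0:ℂ) {0}ᶜ, B < ‖δ⁻¹‖ := by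
    have := (tendsto_norm_cobounded_atTop (E := ℂ)).comp hinv
    exact this.eventually_gt_atTop B
  filter_upwards [hbig, self_mem_nhdsWithin] with δ h1 h2
  have hδ : δ ≠ 0 := h2
  have hnot : δ⁻¹ ∉ _ := fun hmem => absurd (hB _ hmem) (not_le.2 h1)
  simp only [Set.mem_union, Set.mem_ofPred_eq, not_or, not_not] at hnot
  obtain ⟨⟨g0, g1⟩, g2⟩ := hnot
  have fix : ∀ (z : Fin 16 → I9 → ℂ) (q : Fin 16 → I9),
      (fun l x => δ * (δ⁻¹ * z l x + if q l = x then 1 else 0)) =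
      (fun l x => z l x + δ * if q l = x then 1 else 0) := by
    intro z q
    funext l x
    rw [mul_add, ← mul_assoc, mul_inv_cancel₀ hδ, one_mul]
  have k0 := g0.scale hδ
  have k1 := g1.scale hδ
  have k2 := g2.scale hδ
  rw [fix, fix] at k0 k1 k2
  exact ⟨_, _, _, good_span k0 k1 k2⟩

theorem closure_good (T : I9 → I9 → I9 → ℂ)
    (h : T ∈ closure {S : I9 → I9 → I9 → ℂ | rankLE S 16}) :
    ∃ E0 E1 E2, Good (unc T) E0 E1 E2 :=
  good_lim T (closure_minimal (fun S hS => rank16_good S hS) isClosed_closure h)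

theorem rankLE_mono {T : I9 → I9 → I9 → ℂ} {r : ℕ} (hr : r ≤ 16) (h : rankLE T r) :
    rankLE T 16 := by
  obtain ⟨u, v, w, rfl⟩ := h
  obtain ⟨s, hs⟩ := Nat.exists_eq_add_of_le hr
  rw [hs]
  refine ⟨Fin.append u 0, Fin.append v 0, Fin.append w 0, ?_⟩
  funext i j k
  rw [Fin.sum_univ_add]
  simp

/-! ### Part 7: cells of a Borel-stable space -/

def eS (i j l k : Fin 3) : I9 × I9 → ℂ := Pi.single ((i, j), (l, k)) 1

def dg (i k : Fin 3) : (Fin 3 → ℂ) →ₗ[ℂ] (I9 × I9 → ℂ) where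
  toFun h := fun p => if p.1.1 = i ∧ p.2.2 = k ∧ p.1.2 = p.2.1 then h p.1.2 else 0
  map_add' := by
    intro x y; funext p
    by_cases h : p.1.1 = i ∧ p.2.2 = k ∧ p.1.2 = p.2.1 <;> simp [h]
  map_smul' := by
    intro c x; funext p
    by_cases h : p.1.1 = i ∧ p.2.2 = k ∧ p.1.2 = p.2.1 <;> simp [h]

def cS (E : Sp2) (i k j l : Fin 3) : Prop := eS i j l k ∈ E
def cH (E : Sp2) (i k : Fin 3) : Submodule ℂ (Fin 3 → ℂ) := E.comap (dg i k)

/-- all the structural facts about the spaces `E` used in the combinatorial part -/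
structure BE (E : Sp2) : Prop where
  off : ∀ x ∈ E, ∀ i j l k, j ≠ l → x ((i, j), (l, k)) ≠ 0 → cS E i k j l
  dia : ∀ x ∈ E, ∀ i k, (fun j => x ((i, j), (j, k))) ∈ cH E i k
  st : BStable E
  idm : ∀ i k, (fun _ => 1) ∈ cH E i k
  good : GoodOne E

theorem class_sep (s1 s2 s3 : ℕ) (hs : (s1 = 81 ∧ s2 = 1 ∧ s3 = 9) ∨ (s1 = 1 ∧ s2 = 9 ∧ s3 = 81) ∨
    (s1 = 9 ∧ s2 = 81 ∧ s3 = 1)) (i j l k i' j' l' k' : Fin 3)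
    (h : wt2 (wtS s1 s2) (wtS s2 s3) ((i, j), (l, k)) =
      wt2 (wtS s1 s2) (wtS s2 s3) ((i', j'), (l', k'))) :
    i = i' ∧ k = k' ∧ ((j = j' ∧ l = l') ∨ (j = l ∧ j' = l')) := by
  have hd : ∀ a : Fin 3, dw a ≤ 4 := by decide
  have hv : ∀ a : Fin 3, vw a ≤ 4 := by decide
  have hdi : ∀ a b : Fin 3, dw a = dw b → a = b := by decide
  have hvi : ∀ a b : Fin 3, vw a = vw b → a = b := by decide
  have hjl : ∀ j l j' l' : Fin 3, vw j + dw l = vw j' + dw l' →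
    ((j = j' ∧ l = l') ∨ (j = l ∧ j' = l')) := by decide
  have b1 := hd i
  have b2 := hd i'
  have b3 := hd l
  have b4 := hd l'
  have b5 := hv j
  have b6 := hv j'
  have b7 := hv k
  have b8 := hv k'
  simp only [wt2, wtS] at h
  have : dw i = dw i' ∧ vw k = vw k' ∧ vw j + dw l = vw j' + dw l' := by
    rcases hs with ⟨rfl, rfl, rfl⟩ | ⟨rfl, rfl, rfl⟩ | ⟨rfl, rfl, rfl⟩ <;> omega
  exact ⟨hdi _ _ this.1, hvi _ _ this.2.1, hjl _ _ _ _ this.2.2⟩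

theorem diag_wt (s1 s2 s3 : ℕ) (i j k : Fin 3) :
    wt2 (wtS s1 s2) (wtS s2 s3) ((i, j), (j, k)) =
      wt2 (wtS s1 s2) (wtS s2 s3) ((i, 0), (0, k)) := by
  have : vw j + dw j = 4 := by revert j; decide
  have h0 : vw 0 + dw 0 = 4 := by decide
  simp only [wt2, wtS]
  have e : s2 * vw j + s2 * dw j = s2 * vw 0 + s2 * dw 0 := by
    rw [← mul_add, ← mul_add, this, h0]
  omega

theorem BE_of {E : Sp2} (s1 s2 s3 : ℕ) (hs : (s1 = 81 ∧ s2 = 1 ∧ s3 = 9) ∨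
    (s1 = 1 ∧ s2 = 9 ∧ s3 = 81) ∨ (s1 = 9 ∧ s2 = 81 ∧ s3 = 1))
    (hg : wGraded (wt2 (wtS s1 s2) (wtS s2 s3)) E) (hst : BStable E) (hgood : GoodOne E)
    (hid : ∀ i k, (fun p : I9 × I9 => if p.1.1 = i ∧ p.2.2 = k ∧ p.1.2 = p.2.1 then (1:ℂ) else 0) ∈ E) :
    BE E := by
  refine ⟨?_, ?_, hst, hid, hgood⟩
  · intro x hx i j l k hjl hne
    have h1 := (hg x).1 hx (wt2 (wtS s1 s2) (wtS s2 s3) ((i, j), (l, k)))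
    have e : eS i j l k = (x ((i, j), (l, k)))⁻¹ •
        wcomp (wt2 (wtS s1 s2) (wtS s2 s3)) (wt2 (wtS s1 s2) (wtS s2 s3) ((i, j), (l, k))) x := by
      funext ⟨⟨i', j'⟩, ⟨l', k'⟩⟩
      by_cases hw : wt2 (wtS s1 s2) (wtS s2 s3) ((i', j'), (l', k')) =
          wt2 (wtS s1 s2) (wtS s2 s3) ((i, j), (l, k))
      · obtain ⟨rfl, rfl, ⟨rfl, rfl⟩ | ⟨_, h⟩⟩ := class_sep s1 s2 s3 hs _ _ _ _ _ _ _ _ hw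
        · simp [wcomp, eS, hne]
        · exact absurd h hjl
      · have hne' : ((i', j'), (l', k')) ≠ ((i, j), (l, k)) := fun he => hw (by rw [he])
        simp [wcomp, eS, hw, Pi.single_eq_of_ne hne']
    show eS i j l k ∈ E
    rw [e]
    exact E.smul_mem _ h1
  · intro x hx i k
    have h1 := (hg x).1 hx (wt2 (wtS s1 s2) (wtS s2 s3) ((i, 0), (0, k)))
    have e : dg i k (fun j => x ((i, j), (j, k))) =
        wcomp (wt2 (wtS s1 s2) (wtS s2 s3)) (wt2 (wtS s1 s2) (wtS s2 s3) ((i, 0), (0, k))) x := by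
      funext ⟨⟨i', j'⟩, ⟨l', k'⟩⟩
      by_cases hw : wt2 (wtS s1 s2) (wtS s2 s3) ((i', j'), (l', k')) =
          wt2 (wtS s1 s2) (wtS s2 s3) ((i, 0), (0, k))
      · have hjl' : i' = i ∧ k' = k ∧ j' = l' := by
          obtain ⟨rfl, rfl, ⟨rfl, rfl⟩ | ⟨h, _⟩⟩ := class_sep s1 s2 s3 hs _ _ _ _ _ _ _ _ hw
          · exact ⟨rfl, rfl, rfl⟩
          · exact ⟨rfl, rfl, h⟩
        obtain ⟨rfl, rfl, rfl⟩ := hjl'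
        simp [wcomp, dg, hw]
      · have hne' : ¬ (i' = i ∧ k' = k ∧ j' = l') := by
          rintro ⟨rfl, rfl, rfl⟩
          exact hw (diag_wt _ _ _ _ _ _)
        simp only [wcomp, dg, LinearMap.coe_mk, AddHom.coe_mk, if_neg hw, if_neg hne']
    show dg i k _ ∈ E
    rw [e]
    exact h1

section

theorem BE.row {E : Sp2} (h : BE E)
    {p q : Fin 3} (hpq : p = 0 ∧ q = 1 ∨ p = 1 ∧ q = 2) (k : Fin 3) :
    (∀ j l, cS E p k j l → cS E q k j l) ∧ cH E p k ≤ cH E q k := by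
  refine ⟨?_, ?_⟩
  · intro j l hx
    have h1 := E.neg_mem (h.st p q hpq _ hx).1
    have e : - opN (opD p q) opI (eS p j l k) = eS q j l k := by
      funext ⟨⟨i', j'⟩, ⟨l', k'⟩⟩
      by_cases hi : i' = q
      · simp [opN, opD, opI, eS, hi, Pi.single_apply]
      · simp [opN, opD, opI, eS, hi, Pi.single_apply]
    rwa [e] at h1
  · intro x hx
    have h1 := E.neg_mem (h.st p q hpq _ hx).1
    have e : - opN (opD p q) opI (dg p k x) = dg q k x := by
      funext ⟨⟨i', j'⟩, ⟨l', k'⟩⟩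
      by_cases hi : i' = q
      · simp [opN, opD, opI, dg, hi]
      · simp [opN, opD, opI, dg, hi]
    rwa [e] at h1

theorem BE.col {E : Sp2} (h : BE E)
    {p q : Fin 3} (hpq : p = 0 ∧ q = 1 ∨ p = 1 ∧ q = 2) (i : Fin 3) :
    (∀ j l, cS E i q j l → cS E i p j l) ∧ cH E i q ≤ cH E i p := by
  refine ⟨?_, ?_⟩
  · intro j l hx
    have h1 := (h.st p q hpq _ hx).2.2
    have e : opN opI (opV p q) (eS i j l q) = eS i j l p := by
      funext ⟨⟨i', j'⟩, ⟨l', k'⟩⟩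
      by_cases hi : k' = p
      · simp [opN, opV, opI, eS, hi, Pi.single_apply]
      · simp [opN, opV, opI, eS, hi, Pi.single_apply]
    rwa [e] at h1
  · intro x hx
    have h1 := (h.st p q hpq _ hx).2.2
    have e : opN opI (opV p q) (dg i q x) = dg i p x := by
      funext ⟨⟨i', j'⟩, ⟨l', k'⟩⟩
      by_cases hi : k' = p
      · simp [opN, opV, opI, dg, hi]
      · simp [opN, opV, opI, dg, hi]
    rwa [e] at h1

theorem BE.s12 {E : Sp2} (h : BE E)
    (i k : Fin 3) (hx : cS E i k 1 2) : cS E i k 0 2 := by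
  have h1 := (h.st 0 1 (by simp) _ hx).2.1
  refine h.off _ h1 i 0 2 k (by decide) ?_
  simp [opN, opV, opD, eS]

theorem BE.s01 {E : Sp2} (h : BE E)
    (i k : Fin 3) (hx : cS E i k 0 1) : cS E i k 0 2 := by
  have h1 := (h.st 1 2 (by simp) _ hx).2.1
  refine h.off _ h1 i 0 2 k (by decide) ?_
  simp [opN, opV, opD, eS]

theorem BE.s20a {E : Sp2} (h : BE E)
    (i k : Fin 3) (hx : cS E i k 2 0) : cS E i k 2 1 := by
  have h1 := (h.st 0 1 (by simp) _ hx).2.1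
  refine h.off _ h1 i 2 1 k (by decide) ?_
  simp [opN, opV, opD, eS]

theorem BE.s20b {E : Sp2} (h : BE E)
    (i k : Fin 3) (hx : cS E i k 2 0) : cS E i k 1 0 := by
  have h1 := (h.st 1 2 (by simp) _ hx).2.1
  refine h.off _ h1 i 1 0 k (by decide) ?_
  simp [opN, opV, opD, eS]

theorem BE.d01 {E : Sp2} (h : BE E)
    (i k : Fin 3) (hs : ¬ cS E i k 0 1) (x : Fin 3 → ℂ) (hx : x ∈ cH E i k) :
    x 0 = x 1 := by
  by_contra hne
  apply hs
  have h1 := (h.st 0 1 (by simp) _ hx).2.1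
  refine h.off _ h1 i 0 1 k (by decide) ?_
  simp only [opN, opV, opD, dg, LinearMap.coe_mk, AddHom.coe_mk]
  simp
  intro h2
  apply hne
  linear_combination -h2

theorem BE.d12 {E : Sp2} (h : BE E)
    (i k : Fin 3) (hs : ¬ cS E i k 1 2) (x : Fin 3 → ℂ) (hx : x ∈ cH E i k) :
    x 1 = x 2 := by
  by_contra hne
  apply hs
  have h1 := (h.st 1 2 (by simp) _ hx).2.1
  refine h.off _ h1 i 1 2 k (by decide) ?_
  simp only [opN, opV, opD, dg, LinearMap.coe_mk, AddHom.coe_mk]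
  simp
  intro h2
  apply hne
  linear_combination -h2

theorem BE.s10 {E : Sp2} (h : BE E)
    (i k : Fin 3) (hx : cS E i k 1 0) : ![1, -1, 0] ∈ cH E i k := by
  have h1 := h.dia _ (h.st 0 1 (by simp) _ hx).2.1 i k
  convert h1 using 1
  funext j
  fin_cases j <;> simp [opN, opV, opD, eS]

theorem BE.s21 {E : Sp2} (h : BE E)
    (i k : Fin 3) (hx : cS E i k 2 1) : ![0, 1, -1] ∈ cH E i k := by
  have h1 := h.dia _ (h.st 1 2 (by simp) _ hx).2.1 i k
  convert h1 using 1
  funext j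
  fin_cases j <;> simp [opN, opV, opD, eS]

end

/-! ### Part 8: cell types -/

/-- the type of a cell: the off-diagonal entries which are present, and the kind of diagonal -/
structure Cell where
  b01 : Bool
  b02 : Bool
  b10 : Bool
  b12 : Bool
  b20 : Bool
  b21 : Bool
  h : Fin 6
  deriving DecidableEq

def Cell.S (c : Cell) (j l : Fin 3) : Bool :=
  match j, l with
  | 0, 1 => c.b01
  | 0, 2 => c.b02
  | 1, 0 => c.b10
  | 1, 2 => c.b12
  | 2, 0 => c.b20
  | 2, 1 => c.b21
  | _, _ => false

def Cell.T (c : Cell) : Cell := ⟨c.b10, c.b20, c.b01, c.b21, c.b02, c.b12, c.h⟩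

theorem Cell.T_S (c : Cell) (j l : Fin 3) : c.T.S j l = c.S l j := by
  fin_cases j <;> fin_cases l <;> rfl

/-- kinds: 0 scalar, 1 `x1 = x2`, 2 `x0 = x2`, 3 `x0 = x1`, 4 generic plane, 5 everything -/
def Hup (h : Fin 6) (x : Fin 3 → ℂ) : Prop :=
  match h with
  | 0 => x 0 = x 1 ∧ x 1 = x 2
  | 1 => x 1 = x 2
  | 2 => x 0 = x 2
  | 3 => x 0 = x 1
  | 4 => (x 0 = 0 → x 1 = 0 → x 2 = 0) ∧ (x 0 = 0 → x 2 = 0 → x 1 = 0) ∧ (x 1 = 0 → x 2 = 0 → x 0 = 0)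
  | 5 => True

/-- diagonal coordinates forming a basis of coordinates -/
def ds (h : Fin 6) (c : Fin 3) : Bool :=
  match h, c with
  | 0, 0 => true
  | 1, 0 => true
  | 1, 1 => true
  | 2, 0 => true
  | 2, 1 => true
  | 3, 0 => true
  | 3, 2 => true
  | 4, 0 => true
  | 4, 1 => true
  | 5, _ => true
  | _, _ => false

def piv (h : Fin 6) (f : Fin 3 → Bool) (c : Fin 3) : Bool :=
  match h, c with
  | 0, 0 => f 0 && (f 1 && f 2)
  | 1, 0 => f 0
  | 1, 1 => f 1 && f 2
  | 2, 0 => f 0 && f 2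
  | 2, 1 => f 1
  | 3, 0 => f 0 && f 1
  | 3, 2 => f 2
  | 4, 0 => f 0 && (f 1 || f 2)
  | 4, 1 => f 1 && f 2
  | 5, c => f c
  | _, _ => false

theorem ds_zero {h : Fin 6} {x : Fin 3 → ℂ} (hx : Hup h x) (h0 : ∀ c, ds h c = true → x c = 0) :
    x = 0 := by
  have a0 := h0 0
  have a1 := h0 1
  have a2 := h0 2
  have : x 0 = 0 ∧ x 1 = 0 ∧ x 2 = 0 := by
    fin_cases h <;> simp [Hup, ds] at hx a0 a1 a2 <;> simp_all
  funext c
  fin_cases c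
  · exact this.1
  · exact this.2.1
  · exact this.2.2

theorem piv_zero {h : Fin 6} {f : Fin 3 → Bool} {x : Fin 3 → ℂ} (hx : Hup h x)
    (hf : ∀ c, x c ≠ 0 → f c = true) (h0 : ∀ c, piv h f c = true → x c = 0) : x = 0 := by
  have a0 := h0 0
  have a1 := h0 1
  have a2 := h0 2
  have f0 := hf 0
  have f1 := hf 1
  have f2 := hf 2
  have : x 0 = 0 ∧ x 1 = 0 ∧ x 2 = 0 := by
    clear h0 hf
    fin_cases h <;> simp [Hup, piv] at hx a0 a1 a2 <;> by_cases y0 : x 0 = 0 <;>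
      by_cases y1 : x 1 = 0 <;> by_cases y2 : x 2 = 0 <;> grind
  funext c
  fin_cases c
  · exact this.1
  · exact this.2.1
  · exact this.2.2

theorem classify (H : Submodule ℂ (Fin 3 → ℂ)) (h1 : (fun _ => (1:ℂ)) ∈ H) :
    ∃ h : Fin 6, (∀ x ∈ H, Hup h x) ∧ ∀ p, ds h p = true → ∃ v ∈ H, v p = 1 ∧
      ∀ q, ds h q = true → q ≠ p → v q = 0 := by
  -- exhibiting a vector of `H` by a scalar and a linear combination
  have mk : ∀ (x : Fin 3 → ℂ) (s t : ℂ), x ∈ H → (fun c => s * x c + t) ∈ H := by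
    intro x s t hx
    have := H.add_mem (H.smul_mem s hx) (H.smul_mem t h1)
    convert this using 1
    funext c; simp
  have scal : ∀ (x y : Fin 3 → ℂ) (s : ℂ), s ≠ 0 → x ∈ H → (∀ c, x c = s * y c) → y ∈ H := by
    intro x y s hs hx hxy
    have := H.smul_mem s⁻¹ hx
    convert this using 1
    funext c; simp [hxy c, hs]
  have e3 : ∀ y z : Fin 3 → ℂ, y 0 = z 0 → y 1 = z 1 → y 2 = z 2 → y = z := by
    intro y z p q r; funext c; fin_cases c <;> assumption
  have dsd : ∀ h : Fin 6, (∀ p, ds h p = true → ∃ v ∈ H, v p = 1 ∧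
      ∀ q, ds h q = true → q ≠ p → v q = 0) ↔
      (ds h 0 = true → ∃ v ∈ H, v 0 = 1 ∧ (ds h 1 = true → v 1 = 0) ∧ (ds h 2 = true → v 2 = 0)) ∧
      (ds h 1 = true → ∃ v ∈ H, v 1 = 1 ∧ (ds h 0 = true → v 0 = 0) ∧ (ds h 2 = true → v 2 = 0)) ∧
      (ds h 2 = true → ∃ v ∈ H, v 2 = 1 ∧ (ds h 0 = true → v 0 = 0) ∧ (ds h 1 = true → v 1 = 0)) := by
    intro h
    simp [Fin.forall_fin_succ]
  simp only [dsd]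
  clear dsd
  have hA : ∀ x ∈ H, x 1 = x 2 → x 0 ≠ x 1 → ![1,0,0] ∈ H := by
    intro x hx ha hb
    refine scal _ _ (x 0 - x 1) (sub_ne_zero.2 hb) (mk x 1 (-x 1) hx) ?_
    intro c; fin_cases c <;> simp [ha] <;> ring
  have hB : ∀ x ∈ H, x 0 = x 2 → x 0 ≠ x 1 → ![0,1,0] ∈ H := by
    intro x hx ha hb
    refine scal _ _ (x 1 - x 0) (sub_ne_zero.2 hb.symm) (mk x 1 (-x 0) hx) ?_
    intro c; fin_cases c <;> simp [ha] <;> ring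
  have hC : ∀ x ∈ H, x 0 = x 1 → x 0 ≠ x 2 → ![0,0,1] ∈ H := by
    intro x hx ha hb
    refine scal _ _ (x 2 - x 0) (sub_ne_zero.2 hb.symm) (mk x 1 (-x 0) hx) ?_
    intro c; fin_cases c <;> simp [ha] <;> ring
  by_cases hall : ![1,0,0] ∈ H ∧ ![0,1,0] ∈ H ∧ ![0,0,1] ∈ H
  · obtain ⟨p0, p1, p2⟩ := hall
    exact ⟨5, fun _ _ => trivial, fun _ => ⟨_, p0, by simp⟩, fun _ => ⟨_, p1, by simp⟩,
      fun _ => ⟨_, p2, by simp⟩⟩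
  by_cases p0 : ![1,0,0] ∈ H
  · refine ⟨1, ?_, fun _ => ⟨_, p0, by simp [ds]⟩,
      fun _ => ⟨(fun _ => 1) - ![1,0,0], H.sub_mem h1 p0, by simp [ds]⟩, by simp [ds]⟩
    intro x hx
    by_contra hne
    simp only [Hup] at hne
    apply hall
    have q := H.sub_mem hx (H.smul_mem (x 0 - x 1) p0)
    have r := H.sub_mem hx (H.smul_mem (x 0 - x 2) p0)
    exact ⟨p0, hB _ r (by simp) (by simpa using fun h => hne h.symm), hC _ q (by simp) (by simpa using hne)⟩
  by_cases p1 : ![0,1,0] ∈ H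
  · refine ⟨2, ?_, fun _ => ⟨(fun _ => 1) - ![0,1,0], H.sub_mem h1 p1, by simp [ds]⟩,
      fun _ => ⟨_, p1, by simp [ds]⟩, by simp [ds]⟩
    intro x hx
    by_contra hne
    simp only [Hup] at hne
    have r := H.sub_mem hx (H.smul_mem (x 1 - x 2) p1)
    exact p0 (hA _ r (by simp) (by simpa using hne))
  by_cases p2 : ![0,0,1] ∈ H
  · refine ⟨3, ?_, fun _ => ⟨(fun _ => 1) - ![0,0,1], H.sub_mem h1 p2, by simp [ds]⟩,
      by simp [ds], fun _ => ⟨_, p2, by simp [ds]⟩⟩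
    intro x hx
    by_contra hne
    simp only [Hup] at hne
    have r := H.sub_mem hx (H.smul_mem (x 2 - x 1) p2)
    exact p0 (hA _ r (by simp) (by simpa using hne))
  by_cases hc : ∀ x ∈ H, x 0 = x 1 ∧ x 1 = x 2
  · exact ⟨0, hc, fun _ => ⟨_, h1, by simp [ds]⟩, by simp [ds], by simp [ds]⟩
  push Not at hc
  obtain ⟨x, hx, hne⟩ := hc
  have h01 : x 0 ≠ x 1 := by
    intro h
    exact p2 (hC x hx h (by rw [h]; exact hne h))
  have hd : x 1 - x 0 ≠ 0 := sub_ne_zero.2 h01.symm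
  refine ⟨4, ?_, fun _ => ⟨_, mk x (-(x 1 - x 0)⁻¹) ((x 1 - x 0)⁻¹ * x 1) hx, ?_⟩,
    fun _ => ⟨_, mk x ((x 1 - x 0)⁻¹) (-(x 1 - x 0)⁻¹ * x 0) hx, ?_⟩, by simp [ds]⟩
  · intro y hy
    refine ⟨fun a b => ?_, fun a b => ?_, fun a b => ?_⟩
    · by_contra hz
      exact p2 (hC y hy (by rw [a, b]) (by rw [a]; exact fun h => hz h.symm))
    · by_contra hz
      exact p1 (hB y hy (by rw [a, b]) (by rw [a]; exact fun h => hz h.symm))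
    · by_contra hz
      exact p0 (hA y hy (by rw [a, b]) (by rw [a]; exact hz))
  · refine ⟨by field_simp; ring, fun _ => by field_simp; ring, by simp [ds]⟩
  · refine ⟨by field_simp; ring, fun _ => by field_simp; ring, by simp [ds]⟩

/-! ### Part 9: the cell grid of a Borel-stable space -/

structure IsCell (E : Sp2) (i k : Fin 3) (X : Cell) : Prop where
  s : ∀ j l, j ≠ l → (cS E i k j l ↔ X.S j l = true)
  hup : ∀ x ∈ cH E i k, Hup X.h x
  low : ∀ p, ds X.h p = true → ∃ v ∈ cH E i k, v p = 1 ∧ ∀ q, ds X.h q = true → q ≠ p → v q = 0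

def dH (h : Fin 6) : ℕ := ∑ c, if ds h c = true then 1 else 0

def Cell.N (X : Cell) : ℕ :=
  ∑ j : Fin 3, ∑ l : Fin 3, if (if j = l then ds X.h j else X.S j l) = true then 1 else 0

def Cell.valid (X : Cell) : Bool :=
  (!X.b12 || X.b02) && (!X.b01 || X.b02) && (!X.b20 || (X.b21 && X.b10)) &&
  (X.b01 || (X.h == 0 || X.h == 3)) && (X.b12 || (X.h == 0 || X.h == 1)) &&
  (!X.b10 || (X.h == 4 || X.h == 5)) && (!X.b21 || (X.h == 4 || X.h == 5)) &&
  (!(X.b10 && X.b21) || X.h == 5)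

theorem exists_cell {E : Sp2} (hE : BE E) (i k : Fin 3) :
    ∃ X : Cell, IsCell E i k X ∧ X.valid = true := by
  classical
  obtain ⟨h, hu, hl⟩ := classify (cH E i k) (hE.idm i k)
  let X : Cell := ⟨decide (cS E i k 0 1), decide (cS E i k 0 2), decide (cS E i k 1 0),
    decide (cS E i k 1 2), decide (cS E i k 2 0), decide (cS E i k 2 1), h⟩
  have c1 := hE.s12 i k
  have c2 := hE.s01 i k
  have c3 : cS E i k 2 0 → cS E i k 2 1 ∧ cS E i k 1 0 := fun x => ⟨hE.s20a i k x, hE.s20b i k x⟩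
  have c4 : cS E i k 0 1 ∨ (h = 0 ∨ h = 3) := by
    by_contra hc
    push Not at hc
    have hd := hE.d01 i k hc.1
    have : ds h 0 = true ∧ ds h 1 = true := by
      obtain ⟨-, h0, h3⟩ := hc
      clear hu hl X
      revert h
      decide
    obtain ⟨v, hv, v0, v1⟩ := hl 0 this.1
    have e := hd v hv
    rw [v0, v1 1 this.2 (by decide)] at e
    exact one_ne_zero e
  have c5 : cS E i k 1 2 ∨ (h = 0 ∨ h = 1) := by
    by_contra hc
    push Not at hc
    have hd := hE.d12 i k hc.1
    obtain ⟨-, h0, h1⟩ := hc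
    have h4 : h = 2 ∨ h = 3 ∨ h = 4 ∨ h = 5 := by
      clear hu hl X c4
      revert h
      decide
    rcases h4 with rfl | rfl | rfl | rfl
    · obtain ⟨v, hv, v0, v1⟩ := hl 1 rfl
      have e1 := hd v hv
      have e2 : v 0 = v 2 := hu v hv
      rw [← e1, v0, v1 0 rfl (by decide)] at e2
      exact zero_ne_one e2
    · obtain ⟨v, hv, v0, v1⟩ := hl 2 rfl
      have e1 := hd v hv
      have e2 : v 0 = v 1 := hu v hv
      rw [e1, v0, v1 0 rfl (by decide)] at e2
      exact zero_ne_one e2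
    · obtain ⟨v, hv, v0, v1⟩ := hl 0 rfl
      have e1 := hd v hv
      have e2 := v1 1 rfl (by decide)
      have := (hu v hv).2.2 e2 (by rw [← e1, e2])
      rw [v0] at this
      exact one_ne_zero this
    · obtain ⟨v, hv, v0, v1⟩ := hl 1 rfl
      have e1 := hd v hv
      rw [v0, v1 2 rfl (by decide)] at e1
      exact one_ne_zero e1
  have c6 : cS E i k 1 0 → (h = 4 ∨ h = 5) := by
    intro hc
    have := hu _ (hE.s10 i k hc)
    clear hl X c4 c5
    fin_cases h <;> simp [Hup] at this ⊢
    all_goals norm_num at this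
  have c7 : cS E i k 2 1 → (h = 4 ∨ h = 5) := by
    intro hc
    have := hu _ (hE.s21 i k hc)
    clear hl X c4 c5
    fin_cases h <;> simp [Hup] at this ⊢
    all_goals norm_num at this
  have c8 : cS E i k 1 0 → cS E i k 2 1 → h = 5 := by
    intro hc hc'
    rcases c6 hc with rfl | rfl
    · exfalso
      have e1 : (fun _ => (1:ℂ)) = ![1, 1, 1] := by funext c; fin_cases c <;> rfl
      have m := (cH E i k).add_mem ((cH E i k).add_mem (e1 ▸ hE.idm i k)
        ((cH E i k).smul_mem 2 (hE.s10 i k hc))) (hE.s21 i k hc')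
      have := (hu _ m).2.2 (by simp [Pi.add_apply]; norm_num)
        (by simp)
      simp at this
      norm_num at this
    · rfl
  refine ⟨X, ⟨?_, hu, hl⟩, ?_⟩
  · intro j l hjl
    fin_cases j <;> fin_cases l <;> simp [Cell.S, X] at hjl ⊢
  · simp only [Cell.valid, X]
    clear hu hl X
    simp only [Bool.and_eq_true, Bool.or_eq_true, Bool.not_eq_true', decide_eq_false_iff_not,
      decide_eq_true_eq, beq_iff_eq, Bool.and_eq_false_iff]
    refine ⟨⟨⟨⟨⟨⟨⟨?_, ?_⟩, ?_⟩, ?_⟩, ?_⟩, ?_⟩, ?_⟩, ?_⟩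
    · exact imp_iff_not_or.1 c1
    · exact imp_iff_not_or.1 c2
    · exact imp_iff_not_or.1 c3
    · exact c4
    · exact c5
    · exact imp_iff_not_or.1 c6
    · exact imp_iff_not_or.1 c7
    · clear c1 c2 c3 c4 c5 c6 c7
      by_cases ha : cS E i k 1 0
      · by_cases hb : cS E i k 2 1
        · exact Or.inr (c8 ha hb)
        · exact Or.inl (Or.inr hb)
      · exact Or.inl (Or.inl ha)

theorem IsCell.finrank_H {E : Sp2} {i k : Fin 3} {X : Cell} (h : IsCell E i k X) :
    Module.finrank ℂ (cH E i k) = dH X.h := by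
  have e : (Finset.univ.filter fun c => ds X.h c = true).card = dH X.h := by
    rw [dH, Finset.card_filter]
  rw [← e]
  apply le_antisymm
  · apply finrank_le_of_pivots
    intro x hx h0
    exact ds_zero (h.hup x hx) (fun c hc => h0 c (by simp [hc]))
  · apply card_le_finrank_of_indep
    intro p hp
    obtain ⟨v, hv, v1, v0⟩ := h.low p (by simpa using hp)
    exact ⟨v, hv, v1, fun q hq hne => v0 q (by simpa using hq) hne⟩

def cle (Y X : Cell) : Bool :=
  (!Y.b01 || X.b01) && (!Y.b02 || X.b02) && (!Y.b10 || X.b10) && (!Y.b12 || X.b12) &&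
  (!Y.b20 || X.b20) && (!Y.b21 || X.b21) && Nat.ble (dH Y.h) (dH X.h)

theorem imp_b {a b : Bool} (h : a = true → b = true) : a = false ∨ b = true := by
  cases a
  · exact Or.inl rfl
  · exact Or.inr (h rfl)

theorem cle_of {E : Sp2} {i k i' k' : Fin 3} {X Y : Cell} (hX : IsCell E i k X)
    (hY : IsCell E i' k' Y) (hs : ∀ j l, cS E i' k' j l → cS E i k j l)
    (hH : cH E i' k' ≤ cH E i k) : cle Y X = true := by
  have h1 := Submodule.finrank_mono hH
  rw [hX.finrank_H, hY.finrank_H] at h1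
  have h2 : ∀ j l, j ≠ l → Y.S j l = true → X.S j l = true := fun j l hjl hy =>
    (hX.s j l hjl).1 (hs j l ((hY.s j l hjl).2 hy))
  have a1 := h2 0 1 (by decide)
  have a2 := h2 0 2 (by decide)
  have a3 := h2 1 0 (by decide)
  have a4 := h2 1 2 (by decide)
  have a5 := h2 2 0 (by decide)
  have a6 := h2 2 1 (by decide)
  simp only [Cell.S] at a1 a2 a3 a4 a5 a6
  simp only [cle, Bool.and_eq_true, Bool.or_eq_true, Bool.not_eq_true', Nat.ble_eq]
  refine ⟨⟨⟨⟨⟨⟨?_, ?_⟩, ?_⟩, ?_⟩, ?_⟩, ?_⟩, h1⟩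
  · exact imp_b a1
  · exact imp_b a2
  · exact imp_b a3
  · exact imp_b a4
  · exact imp_b a5
  · exact imp_b a6

theorem sum_N_le {E : Sp2} (hE : BE E) (X : Fin 3 → Fin 3 → Cell)
    (hX : ∀ i k, IsCell E i k (X i k)) : ∑ i, ∑ k, (X i k).N ≤ 16 := by
  classical
  let φ : Fin 3 × Fin 3 × Fin 3 × Fin 3 → I9 × I9 := fun q => ((q.1, q.2.2.1), (q.2.2.2, q.2.1))
  have hφ : Function.Injective φ := by
    rintro ⟨a, b, c, d⟩ ⟨a', b', c', d'⟩ h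
    simp only [φ, Prod.mk.injEq] at h
    simp [h]
  let pr : Fin 3 × Fin 3 × Fin 3 × Fin 3 → Bool := fun q =>
    if q.2.2.1 = q.2.2.2 then ds (X q.1 q.2.1).h q.2.2.1 else (X q.1 q.2.1).S q.2.2.1 q.2.2.2
  let Q : Finset (Fin 3 × Fin 3 × Fin 3 × Fin 3) := Finset.univ.filter fun q => pr q = true
  have hQ : Q.card = ∑ i, ∑ k, (X i k).N := by
    simp only [Q, Finset.card_filter, Fintype.sum_prod_type, Cell.N, pr]
  rw [← hQ, ← Finset.card_image_of_injective Q hφ]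
  refine le_trans (card_le_finrank_of_indep E _ ?_) hE.good.rk
  intro p hp
  obtain ⟨⟨i, k, j, l⟩, hq, rfl⟩ := Finset.mem_image.1 hp
  have hq' : pr (i, k, j, l) = true := by simpa [Q] using hq
  by_cases hjl : j = l
  · subst hjl
    simp only [pr, if_true] at hq'
    obtain ⟨v, hv, v1, v0⟩ := (hX i k).low j hq'
    refine ⟨dg i k v, hv, by simp [φ, dg, v1], ?_⟩
    intro p' hp' hne
    obtain ⟨⟨i', k', j', l'⟩, hq2, rfl⟩ := Finset.mem_image.1 hp'
    have hq3 : pr (i', k', j', l') = true := by simpa [Q] using hq2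
    simp only [φ, dg, LinearMap.coe_mk, AddHom.coe_mk]
    split_ifs with hc
    · obtain ⟨rfl, rfl, rfl⟩ := hc
      simp only [pr, if_true] at hq3
      refine v0 j' hq3 ?_
      rintro rfl
      exact hne rfl
    · rfl
  · simp only [pr, if_neg hjl] at hq'
    refine ⟨eS i j l k, ((hX i k).s j l hjl).2 hq', by simp [φ, eS], ?_⟩
    intro p' _ hne
    simp only [eS]
    exact Pi.single_eq_of_ne hne _

/-! ### Part 10: the (210) and (120) bounds -/

def sP (X : Cell) (a b l : Fin 3) : Bool :=
  if b = l then piv X.h (fun c => c == a || X.S a c) b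
  else if a = l then false
  else if a ≤ b then X.S a l && X.S b l else false

def pcnt (h : Fin 6) (f : Fin 3 → Bool) : ℕ := ∑ c, if piv h f c = true then 1 else 0

def fl1 (X : Cell) (g c : Fin 3) : Bool := c == g || X.S g c
def fl0 (X : Cell) (g c : Fin 3) : Bool := !(c == g) && X.S g c

/-- should the diagonal of `Y` be eliminated first? -/
def yFirst (X Y : Cell) (g : Fin 3) : Bool :=
  Nat.ble (pcnt Y.h (fl1 X g) + pcnt X.h (fl0 Y g)) (pcnt X.h (fl1 Y g) + pcnt Y.h (fl0 X g))

def mP (X Y : Cell) (a b l : Fin 3) : Bool :=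
  if b = l then
    if yFirst X Y a then piv Y.h (fl1 X a) b
    else if a = l then piv X.h (fl1 Y a) a else piv Y.h (fl0 X a) b
  else if a = l then
    if yFirst X Y b then piv X.h (fl0 Y b) a else piv X.h (fl1 Y b) a
  else X.S a l && Y.S b l

theorem blockS (X : Cell) (f : Fin 3 → Fin 3 → Fin 3 → ℂ) (hsym : ∀ a b l, f a b l = f b a l)
    (hoff : ∀ a b l, a ≠ l → f a b l ≠ 0 → X.S a l = true)
    (hdia : ∀ b, Hup X.h (fun a => f a b a))
    (h0 : ∀ a b l, sP X a b l = true → f a b l = 0) : ∀ a b l, f a b l = 0 := by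
  have hd : ∀ a c, f a c c = 0 := by
    intro a
    have h1 : Hup X.h (fun c => f a c c) := by
      have := hdia a
      simpa only [hsym _ a] using this
    have := piv_zero (f := fun c => c == a || X.S a c) h1 (by
      intro c hc
      by_cases hca : c = a
      · simp [hca]
      · simp [hoff a c c (fun h => hca h.symm) hc]) (by
      intro c hc
      apply h0
      simpa [sP] using hc)
    intro c
    exact congrFun this c
  have hle : ∀ a b l, a ≠ l → b ≠ l → a ≤ b → f a b l = 0 := by
    intro a b l ha hb hab
    by_contra hne
    apply hne
    apply h0
    have h1 := hoff a b l ha hne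
    have h2 := hoff b a l hb (by rwa [hsym])
    simp [sP, ha, hb, hab, h1, h2]
  intro a b l
  by_cases hb : b = l
  · subst hb; exact hd a b
  by_cases ha : a = l
  · subst ha; rw [hsym]; exact hd b a
  rcases le_total a b with h | h
  · exact hle a b l ha hb h
  · rw [hsym]; exact hle b a l hb ha h

theorem blockM (X Y : Cell) (f : Fin 3 → Fin 3 → Fin 3 → ℂ)
    (hoX : ∀ a b l, a ≠ l → f a b l ≠ 0 → X.S a l = true)
    (hoY : ∀ a b l, b ≠ l → f a b l ≠ 0 → Y.S b l = true)
    (hdX : ∀ b, Hup X.h (fun a => f a b a))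
    (hdY : ∀ a, Hup Y.h (fun b => f a b b))
    (h0 : ∀ a b l, mP X Y a b l = true → f a b l = 0) : ∀ a b l, f a b l = 0 := by
  have key : ∀ g, (∀ c, f g c c = 0) ∧ (∀ c, f c g c = 0) := by
    intro g
    by_cases hy : yFirst X Y g = true
    · have h1 : (fun c => f g c c) = 0 := piv_zero (f := fl1 X g) (hdY g) (by
        intro c hc
        by_cases hca : c = g
        · simp [fl1, hca]
        · simp [fl1, hoX g c c (fun h => hca h.symm) hc]) (by
        intro c hc
        apply h0
        simpa [mP, hy] using hc)
      have h2 : (fun c => f c g c) = 0 := piv_zero (f := fl0 Y g) (hdX g) (by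
        intro c hc
        by_cases hca : c = g
        · exact absurd (by rw [hca]; exact congrFun h1 g) hc
        · simp [fl0, hca, hoY c g c (fun h => hca h.symm) hc]) (by
        intro c hc
        by_cases hca : c = g
        · rw [hca]; exact congrFun h1 g
        · apply h0
          have : ¬ g = c := fun h => hca h.symm
          simpa [mP, hy, this] using hc)
      exact ⟨congrFun h1, congrFun h2⟩
    · have h2 : (fun c => f c g c) = 0 := piv_zero (f := fl1 Y g) (hdX g) (by
        intro c hc
        by_cases hca : c = g
        · simp [fl1, hca]
        · simp [fl1, hoY c g c (fun h => hca h.symm) hc]) (by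
        intro c hc
        apply h0
        by_cases hca : c = g
        · subst hca
          simpa [mP, hy] using hc
        · have : ¬ g = c := fun h => hca h.symm
          simpa [mP, hy, this] using hc)
      have h1 : (fun c => f g c c) = 0 := piv_zero (f := fl0 X g) (hdY g) (by
        intro c hc
        by_cases hca : c = g
        · exact absurd (by rw [hca]; exact congrFun h2 g) hc
        · simp [fl0, hca, hoX g c c (fun h => hca h.symm) hc]) (by
        intro c hc
        by_cases hca : c = g
        · rw [hca]; exact congrFun h2 g
        · apply h0
          have : ¬ g = c := fun h => hca h.symm
          simpa [mP, hy, this] using hc)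
      exact ⟨congrFun h1, congrFun h2⟩
  intro a b l
  by_cases hb : b = l
  · subst hb; exact (key a).1 b
  by_cases ha : a = l
  · subst ha; exact (key b).2 a
  by_contra hne
  apply hne
  apply h0
  simp [mP, ha, hb, hoX a b l ha hne, hoY a b l hb hne]

def sumS (X : Cell) : ℕ := ∑ a, ∑ b, ∑ l, if sP X a b l = true then 1 else 0
def sumM (X Y : Cell) : ℕ := ∑ a, ∑ b, ∑ l, if mP X Y a b l = true then 1 else 0

/-- the bound; `G k i` is a column-major grid -/
def tsum3 (G : Fin 3 → Fin 3 → Cell) : ℕ :=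
  ∑ k, ∑ i, ∑ i', if i = i' then sumS (G k i) else if i < i' then sumM (G k i) (G k i') else 0

theorem tbound (K : Sp3) (G : Fin 3 → Fin 3 → Cell)
    (φ : Fin 3 → Fin 3 → Fin 3 → Fin 3 → Fin 3 → Fin 3 → I9 × I9 × I9)
    (hφ : ∀ p, ∃ k i i' a b l, φ k i i' a b l = p)
    (hsym : ∀ τ ∈ K, ∀ k i i' a b l, τ (φ k i i' a b l) = τ (φ k i' i b a l))
    (hoff : ∀ τ ∈ K, ∀ k i i' a b l, a ≠ l → τ (φ k i i' a b l) ≠ 0 → (G k i).S a l = true)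
    (hdia : ∀ τ ∈ K, ∀ k i i' b, Hup (G k i).h (fun a => τ (φ k i i' a b a))) :
    Module.finrank ℂ K ≤ tsum3 G := by
  classical
  let pr : Fin 3 × Fin 3 × Fin 3 × Fin 3 × Fin 3 × Fin 3 → Prop := fun q =>
    if q.2.1 = q.2.2.1 then sP (G q.1 q.2.1) q.2.2.2.1 q.2.2.2.2.1 q.2.2.2.2.2 = true
    else if q.2.1 < q.2.2.1 then
      mP (G q.1 q.2.1) (G q.1 q.2.2.1) q.2.2.2.1 q.2.2.2.2.1 q.2.2.2.2.2 = true
    else False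
  let Q : Finset (Fin 3 × Fin 3 × Fin 3 × Fin 3 × Fin 3 × Fin 3) := Finset.univ.filter pr
  let ψ : Fin 3 × Fin 3 × Fin 3 × Fin 3 × Fin 3 × Fin 3 → I9 × I9 × I9 := fun q =>
    φ q.1 q.2.1 q.2.2.1 q.2.2.2.1 q.2.2.2.2.1 q.2.2.2.2.2
  have hQ : Q.card = tsum3 G := by
    simp only [Q, Finset.card_filter, Fintype.sum_prod_type, tsum3, pr]
    refine Finset.sum_congr rfl fun k _ => Finset.sum_congr rfl fun i _ =>
      Finset.sum_congr rfl fun i' _ => ?_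
    by_cases h1 : i = i'
    · simp [h1, sumS]
    · by_cases h2 : i < i'
      · simp [h1, h2, sumM]
      · simp [h1, h2]
  rw [← hQ]
  refine le_trans (finrank_le_of_pivots K (Q.image ψ) ?_) Finset.card_image_le
  intro τ hτ h0
  have hlt : ∀ k i i', i < i' → ∀ a b l, τ (φ k i i' a b l) = 0 := by
    intro k i i' hi
    refine blockM (G k i) (G k i') (fun a b l => τ (φ k i i' a b l)) (hoff τ hτ k i i') ?_
      (hdia τ hτ k i i') ?_ ?_
    · intro a b l hbl hne
      refine hoff τ hτ k i' i b a l hbl ?_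
      rwa [hsym τ hτ]
    · intro a
      have := hdia τ hτ k i' i a
      simpa only [hsym τ hτ k i' i] using this
    · intro a b l hm
      apply h0
      refine Finset.mem_image.2 ⟨(k, i, i', a, b, l), ?_, rfl⟩
      simp [Q, pr, hi.ne, hi, hm]
  have heq : ∀ k i, ∀ a b l, τ (φ k i i a b l) = 0 := by
    intro k i
    refine blockS (G k i) (fun a b l => τ (φ k i i a b l)) (hsym τ hτ k i i) (hoff τ hτ k i i)
      (hdia τ hτ k i i) ?_
    intro a b l hm
    apply h0
    refine Finset.mem_image.2 ⟨(k, i, i, a, b, l), ?_, rfl⟩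
    simp [Q, pr, hm]
  funext p
  obtain ⟨k, i, i', a, b, l, rfl⟩ := hφ p
  rcases lt_trichotomy i i' with h | h | h
  · exact hlt k i i' h a b l
  · subst h; exact heq k i a b l
  · rw [hsym τ hτ]; exact hlt k i' i h b a l

theorem t210 {E : Sp2} (hE : BE E) (X : Fin 3 → Fin 3 → Cell)
    (hX : ∀ i k, IsCell E i k (X i k)) : 16 ≤ tsum3 (fun k i => X i k) := by
  refine le_trans hE.good.k1 (tbound (tK1 E) _ (fun k i i' a b l => ((i, a), (i', b), (l, k)))
    ?_ ?_ ?_ ?_)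
  · rintro ⟨⟨i, a⟩, ⟨i', b⟩, ⟨l, k⟩⟩
    exact ⟨k, i, i', a, b, l, rfl⟩
  · intro τ hτ k i i' a b l
    exact hτ.1 _ _ _
  · intro τ hτ k i i' a b l hal hne
    rw [hτ.1] at hne
    exact ((hX i k).s a l hal).1 (hE.off _ (hτ.2 (i', b)) i a l k hal hne)
  · intro τ hτ k i i' b
    have := (hX i k).hup _ (hE.dia _ (hτ.2 (i', b)) i k)
    simp only [hτ.1 (i', b)] at this
    exact this

theorem t120 {E : Sp2} (hE : BE E) (X : Fin 3 → Fin 3 → Cell)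
    (hX : ∀ i k, IsCell E i k (X i k)) : 16 ≤ tsum3 (fun i k => (X i k).T) := by
  refine le_trans hE.good.k2 (tbound (tK2 E) _ (fun i k k' a b l => ((i, l), (a, k), (b, k')))
    ?_ ?_ ?_ ?_)
  · rintro ⟨⟨i, l⟩, ⟨a, k⟩, ⟨b, k'⟩⟩
    exact ⟨i, k, k', a, b, l, rfl⟩
  · intro τ hτ i k k' a b l
    exact hτ.1 _ _ _
  · intro τ hτ i k k' a b l hal hne
    rw [Cell.T_S]
    exact ((hX i k).s l a (Ne.symm hal)).1 (hE.off _ (hτ.2 (b, k')) i l a k (Ne.symm hal) hne)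
  · intro τ hτ i k k' b
    exact (hX i k).hup _ (hE.dia _ (hτ.2 (b, k')) i k)

/-! ### Part 11: the finite search -/

def tyL : List Cell := [
  ⟨false, false, false, false, false, false, 0⟩,
  ⟨false, true, false, false, false, false, 0⟩,
  ⟨true, true, false, false, false, false, 0⟩,
  ⟨false, true, false, true, false, false, 0⟩,
  ⟨true, true, false, false, false, false, 1⟩,
  ⟨true, true, false, true, false, false, 0⟩,
  ⟨false, true, false, true, false, false, 3⟩,
  ⟨true, true, false, true, false, false, 1⟩,
  ⟨true, true, false, true, false, false, 2⟩,
  ⟨true, true, false, true, false, false, 3⟩,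
  ⟨true, true, false, true, false, false, 4⟩,
  ⟨true, true, true, true, false, false, 4⟩,
  ⟨true, true, false, true, false, false, 5⟩,
  ⟨true, true, false, true, false, true, 4⟩,
  ⟨true, true, true, true, false, false, 5⟩,
  ⟨true, true, false, true, false, true, 5⟩,
  ⟨true, true, true, true, false, true, 5⟩]

def ty (n : ℕ) : Cell := tyL.getD n ⟨false, false, false, false, false, false, 0⟩

theorem ty_cover : ∀ (b01 b02 b10 b12 b20 b21 : Bool) (h : Fin 6),
    Cell.valid ⟨b01, b02, b10, b12, b20, b21, h⟩ = true →
    Cell.N ⟨b01, b02, b10, b12, b20, b21, h⟩ ≤ 8 →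
    tyL.contains ⟨b01, b02, b10, b12, b20, b21, h⟩ = true := by
  decide +kernel

def idx : List ℕ := [0, 1, 2, 3, 4, 5, 6, 7, 8, 9, 10, 11, 12, 13, 14, 15, 16]

theorem ty_exists (X : Cell) (hv : X.valid = true) (hN : X.N ≤ 8) : ∃ n ∈ idx, ty n = X := by
  obtain ⟨b01, b02, b10, b12, b20, b21, h⟩ := X
  have h1 := ty_cover b01 b02 b10 b12 b20 b21 h hv hN
  have h2 : tyL = idx.map ty := by decide +kernel
  rw [List.contains_iff_mem, h2] at h1
  exact List.mem_map.1 h1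

def dT (x : ℕ) : ℕ := Nat.mod (Nat.div 8696428295045572811884576 (Nat.pow 32 x)) 32
def sT (x : ℕ) : ℕ := Nat.mod (Nat.div 18639561304412901127326752 (Nat.pow 32 x)) 32
def sTT (x : ℕ) : ℕ := Nat.mod (Nat.div 18602926106676158819044384 (Nat.pow 32 x)) 32
def leT (y x : ℕ) : Bool := Nat.beq (Nat.mod (Nat.div
  497328927858742221501545124616757947982328518886515476702091110293393463759346213978111
  (Nat.pow 2 (Nat.add (Nat.mul 17 y) x))) 2) 1
def mT (x y : ℕ) : ℕ := Nat.mod (Nat.div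
  337654312882955385160590372736147721626160796528979867530388317990274713937454354508690135351516031439041789329091629199202273880881429217418617241800814934226856086435035264787437612852366109889874267904247451025831430957226422952906752233426472178855962844710548603678447032218926440045624325349261689982238160164586171062757293526667873938394308148498680588738598011229206481163139242167712386182141489454550559909406550362448958040464913601370581224575526844564319484972571849885115411306436630195108939790216350138368
  (Nat.pow 64 (Nat.add (Nat.mul 17 x) y))) 64
def mTT (x y : ℕ) : ℕ := Nat.mod (Nat.div
  337421546219609680547506296622993199890224106797269845455205834978874700905571946638460298976122387717624283525824645999890119763249789599941633733936880435548893332132600472216509517510324894954491223710802002279851138066684401928771932660457226982543388584434230718993893359819095570157447935770938796731772285030886130934096397319012081714560380930574077181805975027390169624052981702053418759290097721450935529274917104084430399491569770942120770060354035863809979083979301389770534215501499226206438532856048984784896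
  (Nat.pow 64 (Nat.add (Nat.mul 17 x) y))) 64

theorem dT_eq : ∀ x ∈ idx, (ty x).N = dT x + 1 := by decide +kernel
theorem sT_eq : ∀ x ∈ idx, sumS (ty x) = sT x := by decide +kernel
theorem sTT_eq : ∀ x ∈ idx, sumS (ty x).T = sTT x := by decide +kernel
theorem leT_eq : ∀ y ∈ idx, ∀ x ∈ idx, cle (ty y) (ty x) = leT y x := by decide +kernel
theorem mT_eq : ∀ x ∈ idx, ∀ y ∈ idx, sumM (ty x) (ty y) = mT x y := by decide +kernel
theorem mTT_eq : ∀ x ∈ idx, ∀ y ∈ idx, sumM (ty x).T (ty y).T = mTT x y := by decide +kernel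

def allT (p : ℕ → Bool) : Bool := idx.all p
def imp (a b : Bool) : Bool := !a || b

theorem allT_spec {p : ℕ → Bool} (h : allT p = true) (x : ℕ) (hx : x ∈ idx) : p x = true :=
  List.all_eq_true.1 h x hx

theorem imp_spec {a b : Bool} (h : imp a b = true) (ha : a = true) : b = true := by
  subst ha
  simpa [imp] using h

def sum1 (c20 c21 c22 c10 c11 c12 c00 c01 c02 : ℕ) : ℕ :=
  Nat.add (Nat.add (Nat.add (Nat.add (Nat.add (Nat.add (Nat.add (Nat.add (Nat.add (Nat.add (Nat.add (Nat.add (Nat.add (Nat.add (Nat.add (Nat.add (Nat.add (sT c00) (sT c10)) (sT c20)) (mT c00 c10)) (mT c00 c20)) (mT c10 c20)) (sT c01)) (sT c11)) (sT c21)) (mT c01 c11)) (mT c01 c21)) (mT c11 c21)) (sT c02)) (sT c12)) (sT c22)) (mT c02 c12)) (mT c02 c22)) (mT c12 c22)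

def sum2 (c20 c21 c22 c10 c11 c12 c00 c01 c02 : ℕ) : ℕ :=
  Nat.add (Nat.add (Nat.add (Nat.add (Nat.add (Nat.add (Nat.add (Nat.add (Nat.add (Nat.add (Nat.add (Nat.add (Nat.add (Nat.add (Nat.add (Nat.add (Nat.add (sTT c00) (sTT c01)) (sTT c02)) (mTT c00 c01)) (mTT c00 c02)) (mTT c01 c02)) (sTT c10)) (sTT c11)) (sTT c12)) (mTT c10 c11)) (mTT c10 c12)) (mTT c11 c12)) (sTT c20)) (sTT c21)) (sTT c22)) (mTT c20 c21)) (mTT c20 c22)) (mTT c21 c22)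

def isOne (x : ℕ) : Bool := Nat.beq x 0
def isT (x : ℕ) : Bool := Nat.ble x 1
def isTak (x : ℕ) : Bool := Nat.ble x 1 || Nat.beq x 2 || Nat.beq x 4
def isTbk (x : ℕ) : Bool := Nat.ble x 1 || Nat.beq x 3 || Nat.beq x 6

def leaf (c20 c21 c22 c10 c11 c12 c00 c01 c02 : ℕ) : Bool :=
  Nat.ble (sum1 c20 c21 c22 c10 c11 c12 c00 c01 c02) 15 || Nat.ble (sum2 c20 c21 c22 c10 c11 c12 c00 c01 c02) 15 ||
  (isOne c22 && isOne c11 && isOne c12 && isOne c00 && isOne c01 && isOne c02 &&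
    ((isTbk c21 && isT c10) || (isT c21 && isTak c10)))

def search : Bool :=
  allT fun c20 => imp (Nat.ble (dT c20) 7) <|
  allT fun c21 => imp (Nat.ble (Nat.add (dT c20) (dT c21)) 7 && leT c21 c20) <|
  allT fun c22 => imp (Nat.ble (Nat.add (Nat.add (dT c20) (dT c21)) (dT c22)) 7 && leT c22 c21) <|
  allT fun c10 => imp (Nat.ble (Nat.add (Nat.add (Nat.add (dT c20) (dT c21)) (dT c22)) (dT c10)) 7 && leT c10 c20) <|
  allT fun c11 => imp (Nat.ble (Nat.add (Nat.add (Nat.add (Nat.add (dT c20) (dT c21)) (dT c22)) (dT c10)) (dT c11)) 7 && leT c11 c10 && leT c11 c21) <|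
  allT fun c12 => imp (Nat.ble (Nat.add (Nat.add (Nat.add (Nat.add (Nat.add (dT c20) (dT c21)) (dT c22)) (dT c10)) (dT c11)) (dT c12)) 7 && leT c12 c11 && leT c12 c22) <|
  allT fun c00 => imp (Nat.ble (Nat.add (Nat.add (Nat.add (Nat.add (Nat.add (Nat.add (dT c20) (dT c21)) (dT c22)) (dT c10)) (dT c11)) (dT c12)) (dT c00)) 7 && leT c00 c10) <|
  allT fun c01 => imp (Nat.ble (Nat.add (Nat.add (Nat.add (Nat.add (Nat.add (Nat.add (Nat.add (dT c20) (dT c21)) (dT c22)) (dT c10)) (dT c11)) (dT c12)) (dT c00)) (dT c01)) 7 && leT c01 c00 && leT c01 c11) <|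
  allT fun c02 => imp (Nat.ble (Nat.add (Nat.add (Nat.add (Nat.add (Nat.add (Nat.add (Nat.add (Nat.add (dT c20) (dT c21)) (dT c22)) (dT c10)) (dT c11)) (dT c12)) (dT c00)) (dT c01)) (dT c02)) 7 && leT c02 c01 && leT c02 c12) <|
  leaf c20 c21 c22 c10 c11 c12 c00 c01 c02

theorem search_true : search = true := by decide +kernel

/-! ### Part 12: the two hulls -/

def al (m : Bool) (i k j l : Fin 3) : Bool :=
  if i = 2 ∧ k = 0 then !(j == 2 && l == 0)
  else if i = 2 ∧ k = 1 then (l == 2 && (j == 0 || (m && j == 1)))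
  else if i = 1 ∧ k = 0 then (j == 0 && (l == 2 || (!m && l == 1)))
  else false

def cls (m : Bool) (i k a : Fin 3) : ℕ :=
  if i = 2 ∧ k = 0 then a.val
  else if i = 2 ∧ k = 1 ∧ m = true then (if a = 2 then 1 else 0)
  else if i = 1 ∧ k = 0 ∧ m = false then (if a = 0 then 0 else 1)
  else 0

structure Hull (E : Sp2) (m : Bool) : Prop where
  off : ∀ x ∈ E, ∀ i j l k, j ≠ l → x ((i, j), (l, k)) ≠ 0 → al m i k j l = true
  eq : ∀ x ∈ E, ∀ i k a b, cls m i k a = cls m i k b → x ((i, a), (a, k)) = x ((i, b), (b, k))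

def okc (m : Bool) (i k : Fin 3) (X : Cell) : Bool :=
  decide (∀ j l, j ≠ l → X.S j l = true → al m i k j l = true) &&
  decide (∀ a b, cls m i k a = cls m i k b → a = b ∨ X.h = 0 ∨ (X.h = 3 ∧ a ≠ 2 ∧ b ≠ 2) ∨
    (X.h = 1 ∧ a ≠ 0 ∧ b ≠ 0))

theorem okc_20 : ∀ x ∈ idx, ∀ m, okc m 2 0 (ty x) = true := by decide +kernel
theorem okc_one : ∀ x ∈ idx, isOne x = true → ∀ m i k, okc m i k (ty x) = true := by decide +kernel
theorem okc_21t : ∀ x ∈ idx, isTbk x = true → okc true 2 1 (ty x) = true := by decide +kernel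
theorem okc_10t : ∀ x ∈ idx, isT x = true → okc true 1 0 (ty x) = true := by decide +kernel
theorem okc_21f : ∀ x ∈ idx, isT x = true → okc false 2 1 (ty x) = true := by decide +kernel
theorem okc_10f : ∀ x ∈ idx, isTak x = true → okc false 1 0 (ty x) = true := by decide +kernel

theorem hull_of {E : Sp2} (hE : BE E) (X : Fin 3 → Fin 3 → Cell)
    (hX : ∀ i k, IsCell E i k (X i k)) (m : Bool) (hok : ∀ i k, okc m i k (X i k) = true) :
    Hull E m := by
  refine ⟨?_, ?_⟩
  · intro x hx i j l k hjl hne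
    have h1 := hok i k
    simp only [okc, Bool.and_eq_true, decide_eq_true_eq] at h1
    exact h1.1 j l hjl (((hX i k).s j l hjl).1 (hE.off x hx i j l k hjl hne))
  · intro x hx i k a b hab
    have h1 := hok i k
    simp only [okc, Bool.and_eq_true, decide_eq_true_eq] at h1
    have h2 := (hX i k).hup _ (hE.dia x hx i k)
    have key : ∀ y : Fin 3 → ℂ, Hup (X i k).h y → y a = y b := by
      intro y hy
      rcases h1.2 a b hab with h | h | ⟨h, ha, hb⟩ | ⟨h, ha, hb⟩
      · rw [h]
      · rw [h] at hy
        obtain ⟨p, q⟩ : y 0 = y 1 ∧ y 1 = y 2 := hy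
        fin_cases a <;> fin_cases b <;> simp_all
      · rw [h] at hy
        have p : y 0 = y 1 := hy
        fin_cases a <;> fin_cases b <;> simp_all
      · rw [h] at hy
        have p : y 1 = y 2 := hy
        fin_cases a <;> fin_cases b <;> simp_all
    exact key _ h2

theorem N_pos (X : Cell) : 1 ≤ X.N := by
  have h : ∀ h : Fin 6, ds h 0 = true := by decide
  have h0 : (1 : ℕ) ≤ ∑ l : Fin 3, if (if (0 : Fin 3) = l then ds X.h 0 else X.S 0 l) = true then 1 else 0 := by
    refine le_trans ?_ (Finset.single_le_sum (fun _ _ => Nat.zero_le _) (Finset.mem_univ (0 : Fin 3)))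
    simp [h]
  exact le_trans h0 (Finset.single_le_sum
    (f := fun j : Fin 3 => ∑ l : Fin 3, if (if j = l then ds X.h j else X.S j l) = true then 1 else 0)
    (fun _ _ => Nat.zero_le _) (Finset.mem_univ (0 : Fin 3)))

theorem hull_exists {E : Sp2} (hE : BE E) : ∃ m, Hull E m := by
  choose X hX hv using exists_cell hE
  have hN := sum_N_le hE X hX
  have hN8 : ∀ i k, (X i k).N ≤ 8 := by
    intro i k
    have p := fun i k => N_pos (X i k)
    simp only [Fin.sum_univ_three] at hN
    have p00 := p 0 0
    have p01 := p 0 1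
    have p02 := p 0 2
    have p10 := p 1 0
    have p11 := p 1 1
    have p12 := p 1 2
    have p20 := p 2 0
    have p21 := p 2 1
    have p22 := p 2 2
    fin_cases i <;> fin_cases k <;> simp <;> omega
  have hex : ∀ i k, ∃ n ∈ idx, ty n = X i k := fun i k => ty_exists _ (hv i k) (hN8 i k)
  choose n hn hty using hex
  have T1 := t210 hE X hX
  have T2 := t120 hE X hX
  have hN' : ∑ i, ∑ k, (dT (n i k) + 1) ≤ 16 := by
    refine le_trans (le_of_eq ?_) hN
    refine Finset.sum_congr rfl fun i _ => Finset.sum_congr rfl fun k _ => ?_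
    rw [← dT_eq _ (hn i k), hty]
  simp only [Fin.sum_univ_three] at hN'
  have hs0 : Nat.ble (dT (n 2 0)) 7 = true := Nat.ble_eq_true_of_le (by
    try simp only [Nat.add_eq]
    omega)
  have hs1 : Nat.ble (Nat.add (dT (n 2 0)) (dT (n 2 1))) 7 = true := Nat.ble_eq_true_of_le (by
    try simp only [Nat.add_eq]
    omega)
  have hs2 : Nat.ble (Nat.add (Nat.add (dT (n 2 0)) (dT (n 2 1))) (dT (n 2 2))) 7 = true := Nat.ble_eq_true_of_le (by
    try simp only [Nat.add_eq]
    omega)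
  have hs3 : Nat.ble (Nat.add (Nat.add (Nat.add (dT (n 2 0)) (dT (n 2 1))) (dT (n 2 2))) (dT (n 1 0))) 7 = true := Nat.ble_eq_true_of_le (by
    try simp only [Nat.add_eq]
    omega)
  have hs4 : Nat.ble (Nat.add (Nat.add (Nat.add (Nat.add (dT (n 2 0)) (dT (n 2 1))) (dT (n 2 2))) (dT (n 1 0))) (dT (n 1 1))) 7 = true := Nat.ble_eq_true_of_le (by
    try simp only [Nat.add_eq]
    omega)
  have hs5 : Nat.ble (Nat.add (Nat.add (Nat.add (Nat.add (Nat.add (dT (n 2 0)) (dT (n 2 1))) (dT (n 2 2))) (dT (n 1 0))) (dT (n 1 1))) (dT (n 1 2))) 7 = true := Nat.ble_eq_true_of_le (by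
    try simp only [Nat.add_eq]
    omega)
  have hs6 : Nat.ble (Nat.add (Nat.add (Nat.add (Nat.add (Nat.add (Nat.add (dT (n 2 0)) (dT (n 2 1))) (dT (n 2 2))) (dT (n 1 0))) (dT (n 1 1))) (dT (n 1 2))) (dT (n 0 0))) 7 = true := Nat.ble_eq_true_of_le (by
    try simp only [Nat.add_eq]
    omega)
  have hs7 : Nat.ble (Nat.add (Nat.add (Nat.add (Nat.add (Nat.add (Nat.add (Nat.add (dT (n 2 0)) (dT (n 2 1))) (dT (n 2 2))) (dT (n 1 0))) (dT (n 1 1))) (dT (n 1 2))) (dT (n 0 0))) (dT (n 0 1))) 7 = true := Nat.ble_eq_true_of_le (by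
    try simp only [Nat.add_eq]
    omega)
  have hs8 : Nat.ble (Nat.add (Nat.add (Nat.add (Nat.add (Nat.add (Nat.add (Nat.add (Nat.add (dT (n 2 0)) (dT (n 2 1))) (dT (n 2 2))) (dT (n 1 0))) (dT (n 1 1))) (dT (n 1 2))) (dT (n 0 0))) (dT (n 0 1))) (dT (n 0 2))) 7 = true := Nat.ble_eq_true_of_le (by
    try simp only [Nat.add_eq]
    omega)
  have hl_c21_c20 : leT (n 2 1) (n 2 0) = true := by
    have := hE.col (p := 0) (q := 1) (by decide) 2
    rw [← leT_eq _ (hn _ _) _ (hn _ _), hty, hty]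
    exact cle_of (hX _ _) (hX _ _) this.1 this.2
  have hl_c22_c21 : leT (n 2 2) (n 2 1) = true := by
    have := hE.col (p := 1) (q := 2) (by decide) 2
    rw [← leT_eq _ (hn _ _) _ (hn _ _), hty, hty]
    exact cle_of (hX _ _) (hX _ _) this.1 this.2
  have hl_c10_c20 : leT (n 1 0) (n 2 0) = true := by
    have := hE.row (p := 1) (q := 2) (by decide) 0
    rw [← leT_eq _ (hn _ _) _ (hn _ _), hty, hty]
    exact cle_of (hX _ _) (hX _ _) this.1 this.2
  have hl_c11_c10 : leT (n 1 1) (n 1 0) = true := by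
    have := hE.col (p := 0) (q := 1) (by decide) 1
    rw [← leT_eq _ (hn _ _) _ (hn _ _), hty, hty]
    exact cle_of (hX _ _) (hX _ _) this.1 this.2
  have hl_c11_c21 : leT (n 1 1) (n 2 1) = true := by
    have := hE.row (p := 1) (q := 2) (by decide) 1
    rw [← leT_eq _ (hn _ _) _ (hn _ _), hty, hty]
    exact cle_of (hX _ _) (hX _ _) this.1 this.2
  have hl_c12_c11 : leT (n 1 2) (n 1 1) = true := by
    have := hE.col (p := 1) (q := 2) (by decide) 1
    rw [← leT_eq _ (hn _ _) _ (hn _ _), hty, hty]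
    exact cle_of (hX _ _) (hX _ _) this.1 this.2
  have hl_c12_c22 : leT (n 1 2) (n 2 2) = true := by
    have := hE.row (p := 1) (q := 2) (by decide) 2
    rw [← leT_eq _ (hn _ _) _ (hn _ _), hty, hty]
    exact cle_of (hX _ _) (hX _ _) this.1 this.2
  have hl_c00_c10 : leT (n 0 0) (n 1 0) = true := by
    have := hE.row (p := 0) (q := 1) (by decide) 0
    rw [← leT_eq _ (hn _ _) _ (hn _ _), hty, hty]
    exact cle_of (hX _ _) (hX _ _) this.1 this.2
  have hl_c01_c00 : leT (n 0 1) (n 0 0) = true := by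
    have := hE.col (p := 0) (q := 1) (by decide) 0
    rw [← leT_eq _ (hn _ _) _ (hn _ _), hty, hty]
    exact cle_of (hX _ _) (hX _ _) this.1 this.2
  have hl_c01_c11 : leT (n 0 1) (n 1 1) = true := by
    have := hE.row (p := 0) (q := 1) (by decide) 1
    rw [← leT_eq _ (hn _ _) _ (hn _ _), hty, hty]
    exact cle_of (hX _ _) (hX _ _) this.1 this.2
  have hl_c02_c01 : leT (n 0 2) (n 0 1) = true := by
    have := hE.col (p := 1) (q := 2) (by decide) 0
    rw [← leT_eq _ (hn _ _) _ (hn _ _), hty, hty]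
    exact cle_of (hX _ _) (hX _ _) this.1 this.2
  have hl_c02_c12 : leT (n 0 2) (n 1 2) = true := by
    have := hE.row (p := 0) (q := 1) (by decide) 2
    rw [← leT_eq _ (hn _ _) _ (hn _ _), hty, hty]
    exact cle_of (hX _ _) (hX _ _) this.1 this.2
  have h0 := imp_spec (allT_spec search_true (n 2 0) (hn 2 0)) (by
    exact hs0)
  have h1 := imp_spec (allT_spec h0 (n 2 1) (hn 2 1)) (by
    simp only [Bool.and_eq_true]
    exact ⟨hs1, hl_c21_c20⟩)
  have h2 := imp_spec (allT_spec h1 (n 2 2) (hn 2 2)) (by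
    simp only [Bool.and_eq_true]
    exact ⟨hs2, hl_c22_c21⟩)
  have h3 := imp_spec (allT_spec h2 (n 1 0) (hn 1 0)) (by
    simp only [Bool.and_eq_true]
    exact ⟨hs3, hl_c10_c20⟩)
  have h4 := imp_spec (allT_spec h3 (n 1 1) (hn 1 1)) (by
    simp only [Bool.and_eq_true]
    exact ⟨⟨hs4, hl_c11_c10⟩, hl_c11_c21⟩)
  have h5 := imp_spec (allT_spec h4 (n 1 2) (hn 1 2)) (by
    simp only [Bool.and_eq_true]
    exact ⟨⟨hs5, hl_c12_c11⟩, hl_c12_c22⟩)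
  have h6 := imp_spec (allT_spec h5 (n 0 0) (hn 0 0)) (by
    simp only [Bool.and_eq_true]
    exact ⟨hs6, hl_c00_c10⟩)
  have h7 := imp_spec (allT_spec h6 (n 0 1) (hn 0 1)) (by
    simp only [Bool.and_eq_true]
    exact ⟨⟨hs7, hl_c01_c00⟩, hl_c01_c11⟩)
  have h8 := imp_spec (allT_spec h7 (n 0 2) (hn 0 2)) (by
    simp only [Bool.and_eq_true]
    exact ⟨⟨hs8, hl_c02_c01⟩, hl_c02_c12⟩)

  have g1 : tsum3 (fun k i => X i k) = sum1 (n 2 0) (n 2 1) (n 2 2) (n 1 0) (n 1 1) (n 1 2) (n 0 0) (n 0 1) (n 0 2) := by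
    simp only [tsum3, Fin.sum_univ_three, ← hty]
    simp [sT_eq _ (hn _ _), mT_eq _ (hn _ _) _ (hn _ _), sum1]
    omega
  have g2 : tsum3 (fun i k => (X i k).T) = sum2 (n 2 0) (n 2 1) (n 2 2) (n 1 0) (n 1 1) (n 1 2) (n 0 0) (n 0 1) (n 0 2) := by
    simp only [tsum3, Fin.sum_univ_three, ← hty]
    simp [sTT_eq _ (hn _ _), mTT_eq _ (hn _ _) _ (hn _ _), sum2]
    omega
  rw [g1] at T1
  rw [g2] at T2
  simp only [leaf, Bool.or_eq_true, Bool.and_eq_true, Nat.ble_eq] at h8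
  rcases h8 with (h8 | h8) | ⟨⟨⟨⟨⟨⟨o22, o11⟩, o12⟩, o00⟩, o01⟩, o02⟩, ⟨h8, h9⟩ | ⟨h8, h9⟩⟩
  · omega
  · omega
  · refine ⟨true, hull_of hE X hX true ?_⟩
    intro i k
    rw [← hty]
    fin_cases i <;> fin_cases k
    · exact okc_one _ (hn _ _) o00 _ _ _
    · exact okc_one _ (hn _ _) o01 _ _ _
    · exact okc_one _ (hn _ _) o02 _ _ _
    · exact okc_10t _ (hn _ _) h9
    · exact okc_one _ (hn _ _) o11 _ _ _
    · exact okc_one _ (hn _ _) o12 _ _ _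
    · exact okc_20 _ (hn _ _) _
    · exact okc_21t _ (hn _ _) h8
    · exact okc_one _ (hn _ _) o22 _ _ _
  · refine ⟨false, hull_of hE X hX false ?_⟩
    intro i k
    rw [← hty]
    fin_cases i <;> fin_cases k
    · exact okc_one _ (hn _ _) o00 _ _ _
    · exact okc_one _ (hn _ _) o01 _ _ _
    · exact okc_one _ (hn _ _) o02 _ _ _
    · exact okc_10f _ (hn _ _) h9
    · exact okc_one _ (hn _ _) o11 _ _ _
    · exact okc_one _ (hn _ _) o12 _ _ _
    · exact okc_20 _ (hn _ _) _
    · exact okc_21f _ (hn _ _) h8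
    · exact okc_one _ (hn _ _) o22 _ _ _

/-! ### Part 13: the (111) test -/

/-- the certificate: for each coordinate, how it is seen to vanish -/
def dirT (m0 m1 m2 : Bool) : ℕ :=
  match m0, m1, m2 with
  | true, true, true =>
    19875468651475101246288912719148016051802124058892340846866674812564424911961222232140087504139248359518137256223814444231233499601867062265343995014092560967461715358898521873565912137971953243970262724381741023561806511829135895882243324133016208789643691112555377952391057983371722757342619718013045592948951034504026707642127647527911655210770013055217561150455568716129435898352303070105614543372342703410903802095457306627538181307363918298679399967288527383964129937221262389398712674224814024341933819925237408389879172472932084235090089927765022099743838319782828915559281651544405561011436514830915562369711815988089945103771625917767045298939177083492722755371772706422283269865263286440033929538357329101393736866158516008097171729263392605442837347447752129113540606612443222109939461369258117722079349141948209418889983982871078562984182201803046440492345220661249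
  | true, true, false =>
    19875468651475143613398523118680418447840103787942466288936589526171030054192712265533584764762251824706527699899856559893529073102324939384795117926986995271995595242873821049685211593261905894641591770500350157598302622652212720988588521667490665718513121775046832616899066831750258116498780713811844961153141267009385145247542648637080579814357179547687995725086459058587144300783321940042774743311930434749809491886546030215250831111131823502612881683704357186811114476360207556238783034286950024649388924329434970016448709017114310246226612152657414793395046658607812297076073251471775087242859753297236605942688230837130316507315847540601741564430191818586937604593799152899065471268544861120065393512759790582692103902649956968744415826767643603091404819991227421558457065497866467506235168635387871402247667028473410688296765243225304899101573557619347624378186193698817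
  | true, false, true =>
    19875468651475101246288912719148016051802124058892340846866674812564424911961222232140087504139248359518137256223814444231233499601867062265343991194027940555318771546908934592339730469243579858440822029925473683764324723128492814434589372889687215448904413448308072553192318448786319340568461850751615661682060875469929974451814948298465827181377616934447526445571066484747329129069500879008510518326092872573667103729729332450983522493005138578134601348549034447759477492376403894633848751035175443755862912879029544879517122372118619183790428366646012681193012446747955659163373932442046625890564725365453671348419767901362509945828248810832327413135647258986247347451237373773571588245853288659410682023127976450792758921032805303943390392681043241021195253310688533686950421028069326717826640738859957623653420876857242435551835743150259881606741707054574715745532614017025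
  | true, false, false =>
    19875468651475101246288912719148016051802124058892340846866674812564424911961222232140087504139248359518137256223814444231233499601867062286707340950898784285708404182934089327064285434301803270366065043773979617319089632631811514540855141088702784680984470425597664900810131066475053180711837019316360454874098887269676148294754726534037512672369069362189069898028510463223930887120902105126257654394161285226352830405753895013287134311559407240121119856654675924283256333459364778072182251355534998894371150311764210167907550453232413913520465226216078404524802406392701469163173980080013348421977409995405416853357538765312576989548872764937598041976447203291613100584083394716380336044409724338771292247813697504508212460081687513732493857283680895633049564710195443350756523246351959587839780750173712867975210826439466253272816268041101703391765123967863021771117895352321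
  | false, true, true =>
    19875468651475101246288912719148016051802124058892340846866674812564424911961222232140087504139248359518137256223814444231233499601866362231099161870285203115265445901660973238128275951273396321892535720089323076901780101745378817897109902604398308817144698230088779319150797972207309401611280162698645850311848124342116890609923388432280627839864774893527773911411299678189929583571689001034882679904212913494459282636572747791804793837160388140845548965147111239178269783452923663504981080388982960770242382405133393448411483340543764114934473799544223881835892229623905602428546815114172491555272302158318636839855827077208084306566332250737703383697374172345421123623175115916845905338526120386237689636937428969504717388791962455375037453821260856728653062994941115255664604644978561114550757404488828026696085775437605597346265920298782261712418581960449106491615419039745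
  | false, true, false =>
    19875468651475143613398523118680418447840103787942466288936589526171030054192712265533584764762251824706527699899856559893529073102324239350550284783179637419799325785636272414247575406563348972563864766207932210938276212568455643003455100138872765746014128892580233983658806820585844760767441158497445218516038356847475328215338464460473109636906903103519648821146673185920647396830239919311597869972467492708185223466910859359619583260079588300217961603075593725149710969805200570209005692395573086302919185595833840525550096624557889459812167144772699034680108304197709820791731121960071919720509538952548342044863845749193200266077062413544199650777904161842690896907693048754947393470189115043045419005185242619229156349527268495449202289528679866435685377154359684912853707375985237864576916476514511203633871759498754267767543684486097816326800224297350734466425068453889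
  | false, false, true =>
    19875468651475101246288912719148016051802124058892340846866674812564424911961222232140087504139248359518137256223814444231233499601866362231099158050220582703122502089671385956902094282545022936363095025633055737104298313044735736449455951361069315476405420565841473919952058437621905984837122276765129007340366451861401195899058584191793090459755907921668757297942907317347004108317768083081518625255502746668090777794958062034623595589272313522544033491569226399620533180579356627056268567575550782749366643459974518718495046187996481327635023929451378940035474788834239658935202045069590661601256395344835291943465927915755981044638789882409544310507246883772361718503337312212626251890046151159408096129723067397534924885831096080108920950982194400400402299791922757356163240372433723274927565366255319555124481832904712701750045079356308106656704494481488406343277910949889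
  | false, false, false =>
    19875468651475101246288912719148016051802124058892340846866674812564424911961222232140087504139248359518137256223814444231233499601866362252462507807091426433512134725696540691626649247603246348288338039481561670659063222548054436555721719560084884708485477543131066267569871055310639824980497445329873800532404463661147369741998362427364775950747360349410300750400351295823605866369169309199265761323571159320776504470982624596927207407826582184530551999674867876144312021662317510494602067895910337887874880892709184006885474269110276057365060789021444663367264748478985468935002092707557384132669079974787037448403698779706048088359413836514814939348046828077727471636183333155434999688602586838768706354408788451250378424879978289898024415584832055012256611191429704596650666972048002376630254006961512810367054315604867836126570119591551762176823330578750868668111703244801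

/-- the free coordinates -/
def pvT (m0 m1 m2 : Bool) : List ℕ :=
  match m0, m1, m2 with
  | true, true, true => [0, 181, 424, 173, 101, 182, 425, 128, 209, 452, 176, 185, 428, 212, 455]
  | true, true, false => [0, 100, 181, 424, 173, 101, 182, 425, 128, 209, 452, 176, 185, 212]
  | true, false, true => [0, 181, 424, 92, 173, 101, 182, 425, 128, 209, 176, 185, 428, 212]
  | true, false, false => [0, 100, 181, 424, 92, 173, 101, 182, 425, 128, 209, 176, 185, 212]
  | false, true, true => [0, 172, 181, 424, 173, 101, 182, 425, 128, 209, 452, 176, 185, 428]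
  | false, true, false => [0, 172, 100, 181, 424, 173, 101, 182, 425, 128, 209, 452, 176, 185]
  | false, false, true => [0, 172, 181, 424, 92, 173, 101, 182, 425, 128, 209, 176, 185, 428]
  | false, false, false => [0, 91, 172, 100, 181, 424, 92, 173, 101, 182, 425, 128, 209, 176, 185]

def cde (i j l k q p : Fin 3) : ℕ :=
  i.val + 3 * j.val + 9 * l.val + 27 * k.val + 81 * q.val + 243 * p.val

def decd (c : ℕ) : I9 × I9 × I9 :=
  ((Fin.ofNat 3 c, Fin.ofNat 3 (c / 3)), (Fin.ofNat 3 (c / 9), Fin.ofNat 3 (c / 27)),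
    (Fin.ofNat 3 (c / 81), Fin.ofNat 3 (c / 243)))

theorem decd_cde : ∀ i j l k q p, decd (cde i j l k q p) = ((i, j), (l, k), (q, p)) := by
  decide +kernel

def zz (m0 m1 m2 : Bool) : ℕ → Fin 3 → Fin 3 → Fin 3 → Fin 3 → Fin 3 → Fin 3 → Bool
  | 0, _, _, _, _, _, _ => false
  | f + 1, i, j, l, k, q, p =>
    let c := cde i j l k q p
    let d := Nat.mod (Nat.div (dirT m0 m1 m2) (Nat.pow 16 c)) 16
    let t := Fin.ofNat 3 (d + 1)
    if Nat.beq d 0 then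
      ((!(j == l) && !(al m0 i k j l)) || (!(k == q) && !(al m1 l p k q)) ||
        (!(p == i) && !(al m2 q j p i)))
    else if Nat.beq d 1 then (pvT m0 m1 m2).contains c
    else if Nat.ble d 4 then
      (j == l && (Nat.beq (cls m0 i k j) (cls m0 i k t) && zz m0 m1 m2 f i t t k q p))
    else if Nat.ble d 7 then
      (k == q && (Nat.beq (cls m1 l p k) (cls m1 l p t) && zz m0 m1 m2 f i j l t t p))
    else
      (p == i && (Nat.beq (cls m2 q j p) (cls m2 q j t) && zz m0 m1 m2 f t j l k q t))

theorem zz_all : ∀ m0 m1 m2 i j l k q p, zz m0 m1 m2 5 i j l k q p = true := by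
  decide +kernel

theorem pvT_len : ∀ m0 m1 m2, (pvT m0 m1 m2).length ≤ 15 := by decide +kernel

theorem zz_sound {E0 E1 E2 : Sp2} {m0 m1 m2 : Bool} (H0 : Hull E0 m0) (H1 : Hull E1 m1)
    (H2 : Hull E2 m2) (τ : I9 × I9 × I9 → ℂ) (hτ : τ ∈ tL E0 E1 E2)
    (h0 : ∀ c ∈ pvT m0 m1 m2, τ (decd c) = 0) :
    ∀ f i j l k q p, zz m0 m1 m2 f i j l k q p = true → τ ((i, j), (l, k), (q, p)) = 0 := by
  obtain ⟨t0, t1, t2⟩ := hτ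
  intro f
  induction f with
  | zero => intro i j l k q p h; simp [zz] at h
  | succ f ih =>
    intro i j l k q p h
    simp only [zz] at h
    generalize Fin.ofNat 3 _ = t at h
    generalize Nat.mod _ 16 = d at h
    split_ifs at h with c0 c1 c2 c3
    · simp only [Bool.or_eq_true, Bool.and_eq_true, Bool.not_eq_true', beq_eq_false_iff_ne] at h
      by_contra hne
      rcases h with (⟨hn, ha⟩ | ⟨hn, ha⟩) | ⟨hn, ha⟩
      · have := H0.off _ (t0 (q, p)) i j l k hn hne
        rw [ha] at this
        exact Bool.false_ne_true this
      · have := H1.off _ (t1 (i, j)) l k q p hn hne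
        rw [ha] at this
        exact Bool.false_ne_true this
      · have := H2.off _ (t2 (l, k)) q p i j hn hne
        rw [ha] at this
        exact Bool.false_ne_true this
    · rw [← decd_cde]
      exact h0 _ (by simpa using h)
    · simp only [Bool.and_eq_true, beq_iff_eq, Nat.beq_eq] at h
      obtain ⟨rfl, hc, hz⟩ := h
      have := H0.eq _ (t0 (q, p)) i k j t hc
      exact this.trans (ih _ _ _ _ _ _ hz)
    · simp only [Bool.and_eq_true, beq_iff_eq, Nat.beq_eq] at h
      obtain ⟨rfl, hc, hz⟩ := h
      have := H1.eq _ (t1 (i, j)) l p k t hc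
      exact this.trans (ih _ _ _ _ _ _ hz)
    · simp only [Bool.and_eq_true, beq_iff_eq, Nat.beq_eq] at h
      obtain ⟨rfl, hc, hz⟩ := h
      have := H2.eq _ (t2 (l, k)) q j p t hc
      exact this.trans (ih _ _ _ _ _ _ hz)

theorem test111 {E0 E1 E2 : Sp2} {m0 m1 m2 : Bool} (H0 : Hull E0 m0) (H1 : Hull E1 m1)
    (H2 : Hull E2 m2) : Module.finrank ℂ (tL E0 E1 E2) ≤ 15 := by
  classical
  refine le_trans (finrank_le_of_pivots _ ((pvT m0 m1 m2).map decd).toFinset ?_) ?_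
  · intro τ hτ h0
    funext ⟨⟨i, j⟩, ⟨l, k⟩, ⟨q, p⟩⟩
    refine zz_sound H0 H1 H2 τ hτ ?_ 5 i j l k q p (zz_all _ _ _ _ _ _ _ _ _)
    intro c hc
    exact h0 _ (List.mem_toFinset.2 (List.mem_map.2 ⟨c, hc, rfl⟩))
  · refine le_trans (List.toFinset_card_le _) ?_
    rw [List.length_map]
    exact pvT_len _ _ _

theorem no_good16 (T : I9 → I9 → I9 → ℂ) (hT : T = matMulTensor 3 3 3) :
    T ∉ closure {S | rankLE S 16} := by
  intro h
  obtain ⟨F0, F1, F2, hF⟩ := closure_good T h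
  have e : unc T = T333 := by rw [hT]; rfl
  rw [e] at hF
  obtain ⟨E0, E1, E2, hG, w0, w1, w2, b0, b1, b2⟩ := borel_exists hF
  obtain ⟨t0, t1, t2⟩ := hG.hT
  have B0 : BE E0 := BE_of 81 1 9 (by decide) w0 b0 hG.g0 (by
    intro i k
    convert t0 (k, i) using 1
    funext ⟨⟨a, b⟩, ⟨c, d⟩⟩
    simp only [T333, matMulTensor]
    congr 1
    apply propext
    grind)
  have B1 : BE E1 := BE_of 1 9 81 (by decide) w1 b1 hG.g1 (by
    intro i k
    convert t1 (k, i) using 1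
    funext ⟨⟨a, b⟩, ⟨c, d⟩⟩
    simp only [T333, matMulTensor]
    congr 1
    apply propext
    grind)
  have B2 : BE E2 := BE_of 9 81 1 (by decide) w2 b2 hG.g2 (by
    intro i k
    convert t2 (k, i) using 1
    funext ⟨⟨a, b⟩, ⟨c, d⟩⟩
    simp only [T333, matMulTensor]
    congr 1
    apply propext
    grind)
  obtain ⟨m0, H0⟩ := hull_exists B0
  obtain ⟨m1, H1⟩ := hull_exists B1
  obtain ⟨m2, H2⟩ := hull_exists B2
  have := test111 H0 H1 H2
  have := hG.hL
  omega

theorem rankLE_27 : ∃ r, rankLE (matMulTensor 3 3 3) r := by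
  classical
  let e := Fintype.equivFin (Fin 3 × Fin 3 × Fin 3)
  refine ⟨_, fun r x => if x = ((e.symm r).1, (e.symm r).2.1) then 1 else 0,
    fun r x => if x = ((e.symm r).2.1, (e.symm r).2.2) then 1 else 0,
    fun r x => if x = ((e.symm r).2.2, (e.symm r).1) then 1 else 0, ?_⟩
  funext ⟨a, b⟩ ⟨c, d⟩ ⟨f, g⟩
  rw [Equiv.sum_comp e.symm (fun s : Fin 3 × Fin 3 × Fin 3 =>
    (if (a, b) = (s.1, s.2.1) then (1:ℂ) else 0) * (if (c, d) = (s.2.1, s.2.2) then 1 else 0) *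
      (if (f, g) = (s.2.2, s.1) then 1 else 0))]
  rw [Finset.sum_eq_single (a, b, d)]
  · simp only [matMulTensor, Prod.mk.injEq]
    by_cases h1 : b = c <;> by_cases h2 : d = f <;> by_cases h3 : g = a <;>
      simp [h1, h2, h3, eq_comm] <;> tauto
  · rintro ⟨x, y, z⟩ _ hne
    simp only [Prod.mk.injEq, ne_eq] at hne ⊢
    by_cases h1 : a = x ∧ b = y
    · by_cases h2 : c = y ∧ d = z
      · exact absurd ⟨h1.1.symm, h1.2.symm, h2.2.symm⟩ hne
      · simp [h2]
    · simp [h1]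
  · simp

/-- `BR(M⟨3⟩) ≥ 17`. -/
theorem borderRank_matMul_three_ge_17 :
    17 ≤ brank (matMulTensor 3 3 3) := by
  unfold brank
  obtain ⟨r0, h0⟩ := rankLE_27
  refine le_csInf (s := {r | matMulTensor 3 3 3 ∈ closure {S : I9 → I9 → I9 → ℂ | rankLE S r}})
    ⟨r0, ?_⟩ ?_
  · exact subset_closure (s := {S : I9 → I9 → I9 → ℂ | rankLE S r0}) h0
  intro r hr
  by_contra hlt
  exact no_good16 _ rfl (closure_mono (fun S hS => rankLE_mono (by omega) hS) hr)

end
end
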